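/- Let (M,p) be a germ of a generic real-analytic submanifold of ℂ^N which is minimal at p, and let a deformation (M'_ε)_{ε ∈ X} of targets through p' ∈ ℂ^{N'} with defining function ρ = (ρ_1,…,ρ_d) be given. Let ε₀ ∈ X be a point near which X is a real-analytic submanifold of ℝ^m, and let H be a holomorphic map on a neighborhood of p with H(p) = p', H(M) ⊆ M'_{ε₀} near p, and H finitely nondegenerate of order at most ℓ at p with respect to I_{p'}(M'_{ε₀}). Suppose that the only pair (v, Y), where v ∈ T_{ε₀}X and Y is a holomorphic map on a neighborhood of p with values in ℂ^{N'} and Y(p) = 0, satisfying 2·Re(∂_w ρ_i(H(z), ε₀) · Y(z)) + (∂ρ_i/∂ε)(H(z), ε₀) · v = 0 for all z ∈ M near p and i = 1,…,d, is (v, Y) = (0, 0). Then (ε₀, H) is isolated: there exist a compact neighborhood K ⊆ dom(H) of p and δ > 0 such that whenever ε ∈ X with |ε − ε₀| < δ and Ĥ is a holomorphic map on an open neighborhood of K with Ĥ(p) = p', Ĥ(M ∩ K) ⊆ M'_ε, Ĥ finitely nondegenerate of order at most ℓ at p with respect to I_{p'}(M'_ε), and sup_{z ∈ K} |Ĥ(z)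 − H(z)| < δ, then ε = ε₀ and Ĥ coincides with H on a neighborhood of p. -/

import Mathlib

open Complex Topology

noncomputable section

/-- `ℂ^n`. -/
abbrev Cn (n : ℕ) : Type := EuclideanSpace ℂ (Fin n)

/-- `ℝ^m`. -/
abbrev Rm (m : ℕ) : Type := EuclideanSpace ℝ (Fin m)

/-- The vector of `ℂ^n` with entry `c` in the `j`-th coordinate and `0` elsewhere. -/
def cbasis {n : ℕ} (j : Fin n) (c : ℂ) : Cn n := EuclideanSpace.single j c

/-- The `j`-th component of the Wirtinger gradient `∂f(q)` of a real-valued function `f`. -/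
def wirtD {n : ℕ} (f : Cn n → ℝ) (q : Cn n) : Fin n → ℂ := fun j =>
  (1 / 2 : ℂ) * ((fderiv ℝ f q (cbasis j 1) : ℂ)
    - Complex.I * (fderiv ℝ f q (cbasis j Complex.I) : ℂ))

/-- The `j`-th component of `∂̄g(q)` for a complex-valued function `g`. -/
def wirtDBar {n : ℕ} (g : Cn n → ℂ) (q : Cn n) : Fin n → ℂ := fun j =>
  (1 / 2 : ℂ) * (fderiv ℝ g q (cbasis j 1) + Complex.I * fderiv ℝ g q (cbasis j Complex.I))

/-- The `j`-th component of `∂̄f(q)` for a real-valued function `f`. -/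
def wirtDBarR {n : ℕ} (f : Cn n → ℝ) (q : Cn n) : Fin n → ℂ := fun j =>
  (1 / 2 : ℂ) * ((fderiv ℝ f q (cbasis j 1) : ℂ)
    + Complex.I * (fderiv ℝ f q (cbasis j Complex.I) : ℂ))

/-- `M` is a generic real-analytic submanifold of codimension `d` near `p`. -/
def IsGenericAt {n : ℕ} (M : Set (Cn n)) (d : ℕ) (p : Cn n) : Prop :=
  p ∈ M ∧ ∃ (U : Set (Cn n)) (ρ : Cn n → Fin d → ℝ),
    IsOpen U ∧ p ∈ U ∧ (∀ k, AnalyticOnNhd ℝ (fun z => ρ z k) U) ∧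
    (M ∩ U = {z | z ∈ U ∧ ∀ k, ρ z k = 0}) ∧
    ∀ q ∈ M ∩ U, LinearIndependent ℂ (fun k : Fin d => wirtD (fun z => ρ z k) q)

/-- `S` is, near its point `q`, a real-analytic submanifold of (real) dimension `mdim`. -/
def IsRASubmanifoldAt {E : Type*} [NormedAddCommGroup E] [NormedSpace ℝ E]
    (S : Set E) (q : E) (mdim : ℕ) : Prop :=
  ∃ (c : ℕ) (U : Set E) (ρ : E → Fin c → ℝ),
    IsOpen U ∧ q ∈ U ∧ mdim + c = Module.finrank ℝ E ∧
    (∀ k, AnalyticOnNhd ℝ (fun z => ρ z k) U) ∧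
    (S ∩ U = {z | z ∈ U ∧ ∀ k, ρ z k = 0}) ∧
    ∀ x ∈ S ∩ U, LinearIndependent ℝ (fun k : Fin c => fderiv ℝ (fun z => ρ z k) x)

/-- The tangent space of a set at a point: the span of the tangent cone. -/
def tangentSpaceAt {E : Type*} [NormedAddCommGroup E] [NormedSpace ℝ E] (S : Set E) (q : E) :
    Submodule ℝ E := Submodule.span ℝ (tangentConeAt ℝ S q)

/-- Multiplication by `i` on `ℂ^n` as an `ℝ`-linear map. -/
def mulI {n : ℕ} : Cn n →ₗ[ℝ] Cn n :=
  (LinearMap.lsmul ℂ (Cn n) Complex.I).restrictScalars ℝ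

/-- `M` (a generic submanifold of codimension `d`, hence of real dimension `2n - d`) is
minimal at `p`: there is no real-analytic submanifold `S ⊆ M` through `p` of strictly
smaller dimension whose tangent spaces contain the complex tangent spaces of `M`. -/
def IsMinimalAt {n : ℕ} (M : Set (Cn n)) (d : ℕ) (p : Cn n) : Prop :=
  ¬ ∃ (S : Set (Cn n)) (mdim : ℕ), S ⊆ M ∧ p ∈ S ∧ mdim < 2 * n - d ∧
      (∀ q ∈ S, IsRASubmanifoldAt S q mdim) ∧
      ∀ q ∈ S, tangentSpaceAt M q ⊓ (tangentSpaceAt M q).map mulI ≤ tangentSpaceAt S q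

/-- A real-analytic CR vector field of `M` near `p`. -/
structure CRVectorField {N : ℕ} (M : Set (Cn N)) (p : Cn N) where
  coeff : Cn N → Fin N → ℂ
  dom : Set (Cn N)
  isOpen : IsOpen dom
  mem : p ∈ dom
  analytic : ∀ j, AnalyticOnNhd ℝ (fun z => coeff z j) dom
  tangent : ∀ (f : Cn N → ℝ) (U : Set (Cn N)), IsOpen U → p ∈ U → AnalyticOnNhd ℝ f U →
    (∀ z ∈ M ∩ U, f z = 0) →
    ∃ V, IsOpen V ∧ p ∈ V ∧ ∀ z ∈ M ∩ V, (∑ j, coeff z j * wirtDBarR f z j) = 0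

/-- Application of a CR vector field to a complex-valued function. -/
def CRVectorField.apply {N : ℕ} {M : Set (Cn N)} {p : Cn N} (L : CRVectorField M p)
    (g : Cn N → ℂ) : Cn N → ℂ := fun z => ∑ j, L.coeff z j * wirtDBar g z j

/-- Iterated application `L̄₁ ⋯ L̄ₖ g` of a list of CR vector fields. -/
def CRApplyList {N : ℕ} {M : Set (Cn N)} {p : Cn N} (Ls : List (CRVectorField M p))
    (g : Cn N → ℂ) : Cn N → ℂ := Ls.foldr CRVectorField.apply g

/-- `H` is finitely nondegenerate of order at most `ℓ` at `p` (as a map of `M` into `M'`). -/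
def FinNondeg {N N' : ℕ} (M : Set (Cn N)) (p : Cn N) (M' : Set (Cn N')) (ℓ : ℕ)
    (H : Cn N → Cn N') : Prop :=
  Submodule.span ℂ
    { v : Fin N' → ℂ | ∃ (Ls : List (CRVectorField M p)) (ρ' : Cn N' → ℝ) (U' : Set (Cn N')),
        Ls.length ≤ ℓ ∧ IsOpen U' ∧ H p ∈ U' ∧ AnalyticOnNhd ℝ ρ' U' ∧
        (∀ w ∈ M' ∩ U', ρ' w = 0) ∧
        v = fun j => CRApplyList Ls (fun z => wirtD ρ' (H z) j) p } = ⊤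

/-- The mapping locus `E_ℓ ⊆ M'`. -/
def MappingLocus {N N' : ℕ} (M : Set (Cn N)) (p : Cn N) (M' : Set (Cn N')) (ℓ : ℕ) :
    Set (Cn N') :=
  { p' | p' ∈ M' ∧ ∃ (Ω : Set (Cn N)) (H : Cn N → Cn N'),
      IsOpen Ω ∧ p ∈ Ω ∧ DifferentiableOn ℂ H Ω ∧ H p = p' ∧
      (∀ z ∈ M ∩ Ω, H z ∈ M') ∧ FinNondeg M p M' ℓ H }

/-- A semi-analytic subset of a real vector space. -/
def SemiAnalyticSet {E : Type*} [NormedAddCommGroup E] [NormedSpace ℝ E] (A : Set E) : Prop :=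
  ∀ x : E, ∃ U : Set E, IsOpen U ∧ x ∈ U ∧
    ∃ (n k : ℕ) (f : Fin n → Fin k → E → ℝ) (iseq : Fin n → Fin k → Bool),
      (∀ i j, AnalyticOnNhd ℝ (f i j) U) ∧
      A ∩ U = ⋃ i, ⋂ j, {x | x ∈ U ∧ if iseq i j then f i j x = 0 else 0 < f i j x}

/-- `A` is locally semi-analytic along `M'`. -/
def LocallySemiAnalyticOn {E : Type*} [NormedAddCommGroup E] [NormedSpace ℝ E]
    (M' A : Set E) : Prop :=
  ∀ q ∈ M', ∃ U : Set E, IsOpen U ∧ q ∈ U ∧ SemiAnalyticSet (A ∩ U)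

/-- A real-analytic deformation `(M'_ε)_{ε ∈ X}` of generic submanifolds of codimension `d`
through `p' ∈ ℂ^{N'}`, parametrized by a compact semi-analytic set `X ⊆ ℝ^m`. -/
structure Deformation (N' m d : ℕ) (p' : Cn N') where
  X : Set (Rm m)
  compact_X : IsCompact X
  semiAnalytic_X : SemiAnalyticSet X
  W : Set (Rm m)
  isOpen_W : IsOpen W
  X_subset_W : X ⊆ W
  U' : Set (Cn N')
  isOpen_U' : IsOpen U'
  basept_mem : p' ∈ U'
  ρ : Cn N' → Rm m → Fin d → ℝ
  analytic_ρ : ∀ k, AnalyticOnNhd ℝ (fun we : Cn N' × Rm m => ρ we.1 we.2 k) (U' ×ˢ W)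
  basept : ∀ ε ∈ W, ∀ k, ρ p' ε k = 0
  generic : ∀ ε ∈ X, ∀ q ∈ U', (∀ k, ρ q ε k = 0) →
    LinearIndependent ℂ (fun k : Fin d => wirtD (fun w => ρ w ε k) q)

/-- The fiber `M'_ε` of a deformation. -/
def Deformation.Mfib {N' m d : ℕ} {p' : Cn N'} (D : Deformation N' m d p') (ε : Rm m) :
    Set (Cn N') := {w | w ∈ D.U' ∧ ∀ k, D.ρ w ε k = 0}

/-- The mapping locus `E_ℓ ⊆ X` of a deformation. -/
def DefLocus {N N' m d : ℕ} (M : Set (Cn N)) (p : Cn N) {p' : Cn N'}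
    (D : Deformation N' m d p') (ℓ : ℕ) : Set (Rm m) :=
  { ε | ε ∈ D.X ∧ ∃ (Ω : Set (Cn N)) (H : Cn N → Cn N'),
      IsOpen Ω ∧ p ∈ Ω ∧ DifferentiableOn ℂ H Ω ∧ H p = p' ∧
      (∀ z ∈ M ∩ Ω, H z ∈ D.Mfib ε) ∧ FinNondeg M p (D.Mfib ε) ℓ H }


section CplxAn
open Filter Metric Set

variable {E F : Type*} [NormedAddCommGroup E] [NormedSpace ℂ E]
  [NormedAddCommGroup F] [NormedSpace ℂ F]

lemma iso_cauchy1 {f : E → F} {x : E} {r M : ℝ} (hr : 0 < r)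
    (hd : DifferentiableOn ℂ f (ball x r)) (hb : ∀ y ∈ ball x r, ‖f y‖ ≤ M) :
    ‖fderiv ℂ f x‖ ≤ 2 * M / r := by
  refine Complex.norm_fderiv_le_div_of_mapsTo_ball hd ?_ hr
  intro y hy
  rw [mem_closedBall, dist_eq_norm]
  have h1 := hb y hy
  have h2 := hb x (mem_ball_self hr)
  calc ‖f y - f x‖ ≤ ‖f y‖ + ‖f x‖ := norm_sub_le _ _
    _ ≤ 2 * M := by linarith

lemma iso_cauchy_lip {f : E → F} {x : E} {r M : ℝ} (hr : 0 < r)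
    (hd : DifferentiableOn ℂ f (ball x (4 * r))) (hb : ∀ y ∈ ball x (4 * r), ‖f y‖ ≤ M)
    {y z : E} (hy : y ∈ ball x (3 * r)) (hz : z ∈ ball x (3 * r)) :
    ‖f y - f z‖ ≤ 2 * M / r * ‖y - z‖ := by
  have hsub : ∀ w ∈ ball x (3 * r), ball w r ⊆ ball x (4 * r) := by
    intro w hw
    apply ball_subset_ball'
    rw [mem_ball] at hw; linarith
  refine (convex_ball x (3 * r)).norm_image_sub_le_of_norm_fderiv_le (𝕜 := ℂ) ?_ ?_ hz hy
  · intro w hw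
    exact hd.differentiableAt (isOpen_ball.mem_nhds (hsub w hw (mem_ball_self hr)))
  · intro w hw
    exact iso_cauchy1 hr (hd.mono (hsub w hw)) fun u hu => hb u (hsub w hw hu)

lemma iso_cauchy2 {f : E → F} {x : E} {r M : ℝ} (hr : 0 < r)
    (hd : DifferentiableOn ℂ f (ball x (4 * r))) (hb : ∀ y ∈ ball x (4 * r), ‖f y‖ ≤ M)
    {y : E} (hy : y ∈ ball x r) :
    ‖fderiv ℂ f y - fderiv ℂ f x‖ ≤ 4 * M / r ^ 2 * ‖y - x‖ := by
  set g : E → F := fun z => f (z + (y - x)) - f z with hg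
  have hyx : ‖y - x‖ < r := by rwa [mem_ball, dist_eq_norm] at hy
  have hda : ∀ z ∈ ball x (4 * r), DifferentiableAt ℂ f z := fun z hz =>
    hd.differentiableAt (isOpen_ball.mem_nhds hz)
  have hsh : ∀ z ∈ ball x r, z + (y - x) ∈ ball x (3 * r) := by
    intro z hz
    rw [mem_ball, dist_eq_norm] at hz ⊢
    calc ‖z + (y - x) - x‖ = ‖(z - x) + (y - x)‖ := by congr 1; abel
      _ ≤ ‖z - x‖ + ‖y - x‖ := norm_add_le _ _
      _ < 3 * r := by linarith
  have hdg : ∀ z ∈ ball x r, HasFDerivAt g (fderiv ℂ f (z + (y - x)) - fderiv ℂ f z) z := by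
    intro z hz
    have h1 := (hda _ (ball_subset_ball (by linarith) (hsh z hz))).hasFDerivAt
    have h2 := (hda z (ball_subset_ball (by linarith) hz)).hasFDerivAt
    exact ((hasFDerivAt_comp_add_right (y - x)).2 h1).sub h2
  have h := iso_cauchy1 (f := g) (x := x) (M := 2 * M / r * ‖y - x‖) hr
    (fun z hz => (hdg z hz).differentiableAt.differentiableWithinAt) (by
      intro z hz
      have := iso_cauchy_lip hr hd hb (hsh z hz) (ball_subset_ball (by linarith) hz)
      simpa [hg] using this)
  rw [(hdg x (mem_ball_self hr)).fderiv] at h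
  have e : x + (y - x) = y := by abel
  rw [e] at h
  refine h.trans_eq ?_
  field_simp; ring

lemma iso_cauchy3 {f : E → F} {x : E} {r M : ℝ} (hr : 0 < r)
    (hd : DifferentiableOn ℂ f (ball x (4 * r))) (hb : ∀ y ∈ ball x (4 * r), ‖f y‖ ≤ M)
    {y : E} (hy : y ∈ ball x r) :
    ‖f y - f x - fderiv ℂ f x (y - x)‖ ≤ 4 * M / r ^ 2 * ‖y - x‖ ^ 2 := by
  have hyx : ‖y - x‖ < r := by rwa [mem_ball, dist_eq_norm] at hy
  have hM : 0 ≤ M := (norm_nonneg _).trans (hb x (mem_ball_self (by linarith)))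
  have hsub : closedBall x ‖y - x‖ ⊆ ball x r := closedBall_subset_ball hyx
  have h := (convex_closedBall x ‖y - x‖).norm_image_sub_le_of_norm_fderiv_le' (𝕜 := ℂ)
    (f := f) (φ := fderiv ℂ f x) (C := 4 * M / r ^ 2 * ‖y - x‖) (x := x) (y := y)
    (fun w hw => hd.differentiableAt (isOpen_ball.mem_nhds
      (ball_subset_ball (by linarith) (hsub hw)))) ?_ (mem_closedBall_self (norm_nonneg _))
      (by simp [dist_eq_norm])
  · refine h.trans_eq ?_
    ring
  · intro w hw
    refine (iso_cauchy2 hr hd hb (hsub hw)).trans ?_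
    rw [mem_closedBall, dist_eq_norm] at hw
    gcongr

/-- Pointwise limits of uniformly bounded holomorphic maps are holomorphic. -/
lemma iso_vitali [FiniteDimensional ℂ E] [FiniteDimensional ℂ F] {ι : Type*} {l : Filter ι}
    [l.NeBot] {f : ι → E → F} {g : E → F} {x0 : E} {r M : ℝ}
    (hd : ∀ᶠ n in l, DifferentiableOn ℂ (f n) (ball x0 r))
    (hb : ∀ᶠ n in l, ∀ y ∈ ball x0 r, ‖f n y‖ ≤ M)
    (hlim : ∀ y ∈ ball x0 r, Tendsto (fun n => f n y) l (𝓝 (g y))) :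
    DifferentiableOn ℂ g (ball x0 r) := by
  intro x hx
  have hx' : dist x x0 < r := hx
  set t := (r - dist x x0) / 4 with ht
  have htpos : 0 < t := by rw [ht]; linarith
  have hsub : ball x (4 * t) ⊆ ball x0 r := by
    apply ball_subset_ball'; rw [ht]; linarith
  let u : Ultrafilter ι := Ultrafilter.of l
  have hu : (u : Filter ι) ≤ l := Ultrafilter.of_le l
  have : FiniteDimensional ℂ (E →L[ℂ] F) := inferInstance
  have : ProperSpace (E →L[ℂ] F) := FiniteDimensional.proper ℂ _
  obtain ⟨A, -, hA⟩ := (isCompact_closedBall (0 : E →L[ℂ] F) (2 * M / t)).ultrafilter_le_nhds'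
    (u.map fun n => fderiv ℂ (f n) x) (by
      rw [Ultrafilter.mem_map]
      have : ∀ᶠ n in (u : Filter ι), fderiv ℂ (f n) x ∈ closedBall (0 : E →L[ℂ] F) (2 * M / t) := by
        filter_upwards [hu hd, hu hb] with n h1 h2
        rw [mem_closedBall_zero_iff]
        have hs2 : ball x t ⊆ ball x0 r := (ball_subset_ball (by linarith)).trans hsub
        exact iso_cauchy1 htpos (h1.mono hs2) fun y hy => h2 y (hs2 hy)
      exact this)
  have hA' : Tendsto (fun n => fderiv ℂ (f n) x) u (𝓝 A) := hA
  have key : ∀ y ∈ ball x t, ‖g y - g x - A (y - x)‖ ≤ 4 * M / t ^ 2 * ‖y - x‖ ^ 2 := by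
    intro y hy
    have hys : y ∈ ball x (4 * t) := ball_subset_ball (by linarith) hy
    have l1 := (hlim y (hsub hys)).mono_left hu
    have l2 := (hlim x hx).mono_left hu
    have l3 : Tendsto (fun n => fderiv ℂ (f n) x (y - x)) u (𝓝 (A (y - x))) :=
      ((ContinuousLinearMap.apply ℂ F (y - x)).continuous.tendsto A).comp hA'
    refine le_of_tendsto ((l1.sub l2).sub l3).norm ?_
    filter_upwards [hu hd, hu hb] with n h1 h2
    exact iso_cauchy3 htpos (h1.mono hsub) (fun y hy => h2 y (hsub hy)) hy
  have : HasFDerivAt g A x := by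
    rw [hasFDerivAt_iff_isLittleO]
    have hO : (fun y => g y - g x - A (y - x)) =O[𝓝 x] fun y => ‖y - x‖ ^ 2 := by
      refine Asymptotics.IsBigO.of_bound (4 * M / t ^ 2) ?_
      filter_upwards [ball_mem_nhds x htpos] with y hy
      simpa using key y hy
    refine hO.trans_isLittleO ?_
    have h2 : (fun h : E => ‖h‖ ^ 2) =o[𝓝 0] fun h => h :=
      Asymptotics.isLittleO_norm_pow_id one_lt_two
    have h3 : Tendsto (fun y : E => y - x) (𝓝 x) (𝓝 0) := by
      have : Continuous fun y : E => y - x := by fun_prop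
      simpa using this.tendsto x
    exact h2.comp_tendsto h3
  exact this.differentiableAt.differentiableWithinAt

lemma iso_bdd_near {f : E → F} {U : Set E} (hU : IsOpen U) (hd : DifferentiableOn ℂ f U)
    {x : E} (hx : x ∈ U) : ∃ r > 0, ball x r ⊆ U ∧ ∀ y ∈ ball x r, ‖f y‖ ≤ ‖f x‖ + 1 := by
  have hc : ContinuousAt f x := (hd.differentiableAt (hU.mem_nhds hx)).continuousAt
  have h1 : ∀ᶠ y in 𝓝 x, ‖f y‖ < ‖f x‖ + 1 :=
    hc.norm.eventually_lt continuousAt_const (by linarith)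
  obtain ⟨r, hr, h⟩ := Metric.eventually_nhds_iff_ball.1 (h1.and (hU.mem_nhds hx))
  exact ⟨r, hr, fun y hy => (h y hy).2, fun y hy => (h y hy).1.le⟩

/-- Directional derivatives of holomorphic maps are holomorphic. -/
lemma iso_diff_dir [FiniteDimensional ℂ E] [FiniteDimensional ℂ F] {f : E → F} {U : Set E}
    (hU : IsOpen U) (hd : DifferentiableOn ℂ f U) (v : E) :
    DifferentiableOn ℂ (fun x => fderiv ℂ f x v) U := by
  intro x hx
  obtain ⟨R, hR, hRU, hRb⟩ := iso_bdd_near hU hd hx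
  set r := R / 4 with hr
  have hr0 : 0 < r := by rw [hr]; linarith
  have h4 : (4 * r) = R := by rw [hr]; ring
  rw [← h4] at hRU hRb
  have hlim0 : Tendsto (fun n : ℕ => ((1 : ℂ) / ((n : ℂ) + 1))) atTop (𝓝 0) :=
    tendsto_one_div_add_atTop_nhds_zero_nat
  have hne : ∀ n : ℕ, ((1 : ℂ) / ((n : ℂ) + 1)) ≠ 0 := fun n =>
    one_div_ne_zero (Nat.cast_add_one_ne_zero n)
  set c : ℕ → ℂ := fun n => (1 : ℂ) / ((n : ℂ) + 1) with hc
  have hsm : ∀ᶠ n in (atTop : Filter ℕ), ‖c n • v‖ < r := by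
    have : Tendsto (fun n => ‖c n • v‖) atTop (𝓝 0) := by
      simpa using (hlim0.smul_const v).norm
    exact this.eventually (gt_mem_nhds hr0)
  have hmv : ∀ n, ‖c n • v‖ < r → ∀ y ∈ ball x r, y + c n • v ∈ ball x (3 * r) := by
    intro n hn y hy
    rw [mem_ball, dist_eq_norm] at hy ⊢
    calc ‖y + c n • v - x‖ = ‖(y - x) + c n • v‖ := by congr 1; abel
      _ ≤ ‖y - x‖ + ‖c n • v‖ := norm_add_le _ _
      _ < 3 * r := by linarith
  have hV := iso_vitali (l := atTop) (f := fun n y => (c n)⁻¹ • (f (y + c n • v) - f y))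
    (g := fun y => fderiv ℂ f y v) (x0 := x) (r := r) (M := 2 * (‖f x‖ + 1) / r * ‖v‖) ?_ ?_ ?_
  · exact ((hV x (mem_ball_self hr0)).differentiableAt (ball_mem_nhds x hr0)).differentiableWithinAt
  · filter_upwards [hsm] with n hn
    intro y hy
    have h1 : DifferentiableAt ℂ f (y + c n • v) := hd.differentiableAt
      (hU.mem_nhds (hRU (ball_subset_ball (by linarith) (hmv n hn y hy))))
    have h2 : DifferentiableAt ℂ f y := hd.differentiableAt
      (hU.mem_nhds (hRU (ball_subset_ball (by linarith) hy)))
    have h3 : DifferentiableAt ℂ (fun y => f (y + c n • v)) y :=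
      (differentiableAt_comp_add_right _).2 h1
    exact ((h3.sub h2).const_smul _).differentiableWithinAt
  · filter_upwards [hsm] with n hn
    intro y hy
    have := iso_cauchy_lip hr0 (hd.mono hRU) hRb (hmv n hn y hy)
      (ball_subset_ball (by linarith) hy)
    rw [norm_smul, norm_inv]
    have hcn : 0 < ‖c n‖ := norm_pos_iff.2 (hne n)
    rw [inv_mul_le_iff₀ hcn]
    refine this.trans_eq ?_
    rw [add_sub_cancel_left, norm_smul]; ring
  · intro y hy
    have h2 : DifferentiableAt ℂ f y := hd.differentiableAt
      (hU.mem_nhds (hRU (ball_subset_ball (by linarith) hy)))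
    have hl := h2.hasFDerivAt.hasLineDerivAt v
    rw [HasLineDerivAt, hasDerivAt_iff_tendsto_slope_zero] at hl
    have hc' : Tendsto c atTop (𝓝[≠] 0) :=
      tendsto_nhdsWithin_iff.2 ⟨hlim0, Eventually.of_forall hne⟩
    have := hl.comp hc'
    simpa [Function.comp_def] using this

lemma iso_contDiffOn_nat [FiniteDimensional ℂ E] [FiniteDimensional ℂ F] (n : ℕ) :
    ∀ {f : E → F} {U : Set E} (_ : IsOpen U) (_ : DifferentiableOn ℂ f U),
    ContDiffOn ℂ n f U := by
  induction n with
  | zero => intro f U hU hd; exact contDiffOn_zero.2 hd.continuousOn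
  | succ n ih =>
    intro f U hU hd
    have := (contDiffOn_succ_iff_fderiv_of_isOpen (𝕜 := ℂ) (n := n) (f := f) hU).2
      ⟨hd, by simp, contDiffOn_clm_apply.2 fun y => ih hU (iso_diff_dir hU hd y)⟩
    exact_mod_cast this

lemma iso_contDiffOn [FiniteDimensional ℂ E] [FiniteDimensional ℂ F] {f : E → F} {U : Set E}
    (hU : IsOpen U) (hd : DifferentiableOn ℂ f U) : ContDiffOn ℂ (⊤ : ℕ∞) f U :=
  contDiffOn_infty.2 fun n => iso_contDiffOn_nat n hU hd

lemma iso_diff_fderiv [FiniteDimensional ℂ E] [FiniteDimensional ℂ F] {f : E → F} {U : Set E}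
    (hU : IsOpen U) (hd : DifferentiableOn ℂ f U) :
    DifferentiableOn ℂ (fderiv ℂ f) U := by
  have h := (contDiffOn_succ_iff_fderiv_of_isOpen (𝕜 := ℂ) (n := 1) (f := f) hU).1
    (by exact_mod_cast iso_contDiffOn_nat 2 hU hd)
  exact h.2.2.differentiableOn (by simp)

end CplxAn

section VecOps
open Filter Metric Set

variable {E F W : Type*} [NormedAddCommGroup E] [NormedSpace ℂ E]
  [NormedAddCommGroup F] [NormedSpace ℂ F] [NormedAddCommGroup W] [NormedSpace ℂ W]

/-- Locally uniform bound of a sequence of functions by a sequence of numbers. -/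
def IsoUB {E F : Type*} [TopologicalSpace E] [NormedAddCommGroup F] (l : Filter ℕ) (s : ℕ → ℝ)
    (f : ℕ → E → F) (x0 : E) : Prop :=
  ∃ C : ℝ, ∃ V ∈ 𝓝 x0, ∀ᶠ n in l, ∀ x ∈ V, ‖f n x‖ ≤ C * s n

lemma IsoUB.der {l : Filter ℕ} {s : ℕ → ℝ} {f : ℕ → E → F} {x0 : E} {U : Set E}
    (hU : U ∈ 𝓝 x0) (hd : ∀ᶠ n in l, DifferentiableOn ℂ (f n) U) (h : IsoUB l s f x0) :
    IsoUB l s (fun n x => fderiv ℂ (f n) x) x0 := by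
  obtain ⟨C, V, hV, hb⟩ := h
  obtain ⟨r, hr, hrs⟩ := Metric.mem_nhds_iff.1 (inter_mem hU hV)
  refine ⟨2 * C / (r / 2), ball x0 (r / 2), ball_mem_nhds _ (by linarith), ?_⟩
  filter_upwards [hd, hb] with n h1 h2 x hx
  have hs : ball x (r / 2) ⊆ U ∩ V := by
    refine (ball_subset_ball' ?_).trans hrs
    rw [mem_ball] at hx; linarith
  have := iso_cauchy1 (half_pos hr) (h1.mono fun y hy => (hs hy).1) (fun y hy => h2 y (hs hy).2)
  refine this.trans_eq ?_
  ring

/-- Derivative of `g` along the vector field `ξ`. -/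
def isoVop (ξ : E → E) (g : E → ℂ) : E → ℂ := fun x => fderiv ℂ g x (ξ x)

/-- Iterated derivatives along vector fields. -/
def isoVops (ξs : List (E → E)) (g : E → ℂ) : E → ℂ := ξs.foldr isoVop g

@[simp] lemma isoVops_nil (g : E → ℂ) : isoVops [] g = g := rfl
@[simp] lemma isoVops_cons (ξ : E → E) (ξs) (g : E → ℂ) :
    isoVops (ξ :: ξs) g = isoVop ξ (isoVops ξs g) := rfl

lemma IsoUB.vop {l : Filter ℕ} {s : ℕ → ℝ} {f : ℕ → E → ℂ} {x0 : E} {U : Set E}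
    (hU : U ∈ 𝓝 x0) (hd : ∀ᶠ n in l, DifferentiableOn ℂ (f n) U) (h : IsoUB l s f x0)
    {ξ : E → E} (hξ : ContinuousAt ξ x0) : IsoUB l s (fun n => isoVop ξ (f n)) x0 := by
  obtain ⟨C, V, hV, hb⟩ := h.der hU hd
  have h1 : ∀ᶠ y in 𝓝 x0, ‖ξ y‖ < ‖ξ x0‖ + 1 :=
    hξ.norm.eventually_lt continuousAt_const (by linarith)
  refine ⟨C * (‖ξ x0‖ + 1), _, inter_mem hV h1, ?_⟩
  filter_upwards [hb] with n h2 x hx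
  have hx2 : ‖ξ x‖ < ‖ξ x0‖ + 1 := hx.2
  have h3 := h2 x hx.1
  calc ‖isoVop ξ (f n) x‖ ≤ ‖fderiv ℂ (f n) x‖ * ‖ξ x‖ := ContinuousLinearMap.le_opNorm _ _
    _ ≤ (C * s n) * (‖ξ x0‖ + 1) := by
      apply mul_le_mul h3 hx2.le (norm_nonneg _) ((norm_nonneg _).trans h3)
    _ = _ := by ring

lemma isoVop_diff [FiniteDimensional ℂ E] {U : Set E} (hU : IsOpen U) {ξ : E → E} {g : E → ℂ}
    (hξ : DifferentiableOn ℂ ξ U) (hg : DifferentiableOn ℂ g U) :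
    DifferentiableOn ℂ (isoVop ξ g) U :=
  (iso_diff_fderiv hU hg).clm_apply hξ

lemma isoVops_diff [FiniteDimensional ℂ E] {U : Set E} (hU : IsOpen U) {ξs : List (E → E)}
    {g : E → ℂ} (hξ : ∀ ξ ∈ ξs, DifferentiableOn ℂ ξ U) (hg : DifferentiableOn ℂ g U) :
    DifferentiableOn ℂ (isoVops ξs g) U := by
  induction ξs with
  | nil => exact hg
  | cons ξ ξs ih =>
    exact isoVop_diff hU (hξ ξ (by simp)) (ih fun ξ h => hξ ξ (by simp [h]))

lemma IsoUB.vops [FiniteDimensional ℂ E] {l : Filter ℕ} {s : ℕ → ℝ} {f : ℕ → E → ℂ} {x0 : E}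
    {U : Set E} (hU : IsOpen U) (hx : x0 ∈ U) {ξs : List (E → E)}
    (hξ : ∀ ξ ∈ ξs, DifferentiableOn ℂ ξ U)
    (hd : ∀ᶠ n in l, DifferentiableOn ℂ (f n) U) (h : IsoUB l s f x0) :
    IsoUB l s (fun n => isoVops ξs (f n)) x0 := by
  induction ξs with
  | nil => exact h
  | cons ξ ξs ih =>
    have hξ' : ∀ ξ ∈ ξs, DifferentiableOn ℂ ξ U := fun ξ h => hξ ξ (by simp [h])
    refine (ih hξ').vop (hU.mem_nhds hx) ?_
      ((hξ ξ (by simp)).continuousOn.continuousAt (hU.mem_nhds hx))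
    filter_upwards [hd] with n hn
    exact isoVops_diff hU hξ' hn

lemma isoVop_congr {U : Set E} (hU : IsOpen U) {ξ : E → E} {g g' : E → ℂ} (h : EqOn g g' U) :
    EqOn (isoVop ξ g) (isoVop ξ g') U := by
  intro x hx
  have : g =ᶠ[𝓝 x] g' := h.eventuallyEq_of_mem (hU.mem_nhds hx)
  simp only [isoVop, this.fderiv_eq]

lemma isoVops_congr {U : Set E} (hU : IsOpen U) {ξs : List (E → E)} {g g' : E → ℂ}
    (h : EqOn g g' U) : EqOn (isoVops ξs g) (isoVops ξs g') U := by
  induction ξs with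
  | nil => exact h
  | cons ξ ξs ih => exact isoVop_congr hU ih

lemma isoVops_zero {U : Set E} (hU : IsOpen U) {ξs : List (E → E)} {g : E → ℂ}
    (h : EqOn g (fun _ => 0) U) : EqOn (isoVops ξs g) (fun _ => 0) U := by
  induction ξs with
  | nil => exact h
  | cons ξ ξs ih =>
    intro x hx
    have h1 := isoVop_congr (ξ := ξ) hU ih hx
    rw [isoVops_cons, h1]
    simp [isoVop]

lemma isoVops_sub [FiniteDimensional ℂ E] {U : Set E} (hU : IsOpen U) {ξs : List (E → E)}
    {f g : E → ℂ} (hξ : ∀ ξ ∈ ξs, DifferentiableOn ℂ ξ U) (hf : DifferentiableOn ℂ f U)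
    (hg : DifferentiableOn ℂ g U) :
    EqOn (isoVops ξs (fun x => f x - g x)) (fun x => isoVops ξs f x - isoVops ξs g x) U := by
  induction ξs with
  | nil => intro x _; rfl
  | cons ξ ξs ih =>
    have hξ' : ∀ ξ ∈ ξs, DifferentiableOn ℂ ξ U := fun ξ h => hξ ξ (by simp [h])
    intro x hx
    rw [isoVops_cons, isoVop_congr hU (ih hξ') hx]
    have h1 := (isoVops_diff hU hξ' hf).differentiableAt (hU.mem_nhds hx)
    have h2 := (isoVops_diff hU hξ' hg).differentiableAt (hU.mem_nhds hx)
    simp only [isoVop, isoVops_cons]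
    rw [fderiv_fun_sub h1 h2]; rfl

lemma isoVops_comp [FiniteDimensional ℂ E] [FiniteDimensional ℂ W] {U : Set E} {U' : Set W}
    (hU : IsOpen U) (hU' : IsOpen U') {γ : E → W} (hγ : DifferentiableOn ℂ γ U)
    (hm : MapsTo γ U U') {ξs : List (E → E)} (T : (E → E) → (W → W))
    (hT : ∀ ξ ∈ ξs, ∀ x ∈ U, fderiv ℂ γ x (ξ x) = T ξ (γ x))
    (hTd : ∀ ξ ∈ ξs, DifferentiableOn ℂ (T ξ) U')
    {g : W → ℂ} (hg : DifferentiableOn ℂ g U') :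
    EqOn (isoVops ξs (fun x => g (γ x))) (fun x => isoVops (ξs.map T) g (γ x)) U := by
  induction ξs with
  | nil => intro x _; rfl
  | cons ξ ξs ih =>
    have ih' := ih (fun ξ h => hT ξ (by simp [h])) (fun ξ h => hTd ξ (by simp [h]))
    intro x hx
    rw [isoVops_cons, isoVop_congr hU ih' hx]
    simp only [List.map_cons, isoVops_cons]
    have h1 : DifferentiableAt ℂ (isoVops (ξs.map T) g) (γ x) := by
      refine (isoVops_diff hU' ?_ hg).differentiableAt (hU'.mem_nhds (hm hx))
      intro η hη
      obtain ⟨ζ, hζ, rfl⟩ := List.mem_map.1 hη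
      exact hTd ζ (by simp [hζ])
    have h2 := hγ.differentiableAt (hU.mem_nhds hx)
    have h3 : fderiv ℂ (fun x => isoVops (ξs.map T) g (γ x)) x
        = (fderiv ℂ (isoVops (ξs.map T) g) (γ x)).comp (fderiv ℂ γ x) :=
      fderiv_comp x h1 h2
    simp only [isoVop]
    rw [h3, ContinuousLinearMap.comp_apply, hT ξ (by simp) x hx]

/-- Lift of a vector field to a product. -/
def isoLift (W : Type*) [Zero W] (ξ : E → E) : E × W → E × W := fun y => (ξ y.1, 0)

lemma isoLift_diff {U : Set E} {ξ : E → E} (hξ : DifferentiableOn ℂ ξ U) {V : Set (E × W)}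
    (hV : ∀ y ∈ V, y.1 ∈ U) : DifferentiableOn ℂ (isoLift W ξ) V := by
  refine DifferentiableOn.prodMk ?_ (differentiableOn_const _)
  exact hξ.comp differentiableOn_fst hV

lemma isoLift_fderiv {U : Set E} (hU : IsOpen U) {ξ : E → E} (hξ : DifferentiableOn ℂ ξ U)
    {y : E × W} (hy : y.1 ∈ U) (e : W) : fderiv ℂ (isoLift W ξ) y (0, e) = 0 := by
  have h1 : HasFDerivAt ξ (fderiv ℂ ξ y.1) y.1 :=
    (hξ.differentiableAt (hU.mem_nhds hy)).hasFDerivAt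
  have h2 : HasFDerivAt (fun y : E × W => ξ y.1)
      ((fderiv ℂ ξ y.1).comp (ContinuousLinearMap.fst ℂ E W)) y := h1.comp y hasFDerivAt_fst
  have h3 : HasFDerivAt (isoLift W ξ) (((fderiv ℂ ξ y.1).comp
      (ContinuousLinearMap.fst ℂ E W)).prod 0) y := h2.prodMk (hasFDerivAt_const (0 : W) y)
  rw [h3.fderiv]
  simp

lemma isoVops_dw [FiniteDimensional ℂ E] [FiniteDimensional ℂ W] {U : Set E} (hU : IsOpen U)
    {V : Set (E × W)} (hV : IsOpen V) (hVU : ∀ y ∈ V, y.1 ∈ U) {ξs : List (E → E)}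
    (hξ : ∀ ξ ∈ ξs, DifferentiableOn ℂ ξ U) {f : E × W → ℂ} (hf : DifferentiableOn ℂ f V)
    (e : W) :
    EqOn (isoVops (ξs.map (isoLift W)) (fun y => fderiv ℂ f y (0, e)))
      (fun y => fderiv ℂ (isoVops (ξs.map (isoLift W)) f) y (0, e)) V := by
  induction ξs with
  | nil => intro x _; rfl
  | cons ξ ξs ih =>
    have hξ' : ∀ ξ ∈ ξs, DifferentiableOn ℂ ξ U := fun ξ h => hξ ξ (by simp [h])
    intro y hy
    simp only [List.map_cons, isoVops_cons]
    rw [isoVop_congr hV (ih hξ') hy]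
    set g := isoVops (ξs.map (isoLift W)) f with hgdef
    have hg : DifferentiableOn ℂ g V := by
      refine isoVops_diff hV ?_ hf
      intro η hη
      obtain ⟨ζ, hζ, rfl⟩ := List.mem_map.1 hη
      exact isoLift_diff (hξ' ζ hζ) hVU
    have hg2 := (iso_diff_fderiv hV hg).differentiableAt (hV.mem_nhds hy)
    have hl := (isoLift_diff (W := W) (hξ ξ (by simp)) hVU).differentiableAt (hV.mem_nhds hy)
    have hs : IsSymmSndFDerivAt ℂ g y := by
      refine ((iso_contDiffOn_nat 2 hV hg).contDiffAt (hV.mem_nhds hy)).isSymmSndFDerivAt ?_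
      simp
    have e1 : fderiv ℂ (fun y => fderiv ℂ g y (0, e)) y (isoLift W ξ y)
        = fderiv ℂ (fderiv ℂ g) y (isoLift W ξ y) (0, e) := by
      rw [fderiv_clm_apply hg2 (differentiableAt_const _)]
      simp
    have e2 : fderiv ℂ (fun y => fderiv ℂ g y (isoLift W ξ y)) y (0, e)
        = fderiv ℂ (fderiv ℂ g) y (0, e) (isoLift W ξ y) := by
      rw [fderiv_clm_apply hg2 hl]
      simp [isoLift_fderiv hU (hξ ξ (by simp)) (hVU y hy) e]
    unfold isoVop
    rw [e1, e2]
    exact hs.eq _ _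

end VecOps

section Cplxify
open Filter Metric Set

/-- The inclusion of real points. -/
def isoC (ι : Type*) : (ι → ℝ) →L[ℝ] (ι → ℂ) :=
  ContinuousLinearMap.pi fun j => Complex.ofRealCLM.comp (ContinuousLinearMap.proj j)

@[simp] lemma isoC_apply {ι : Type*} (x : ι → ℝ) (j : ι) : isoC ι x j = (x j : ℂ) := rfl

variable {ι : Type*} [Fintype ι]
variable {F : Type*} [NormedAddCommGroup F] [NormedSpace ℂ F]

/-- Complexification of a formal power series. -/
def isoCSeries [DecidableEq ι] (p : FormalMultilinearSeries ℝ (ι → ℝ) F) :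
    FormalMultilinearSeries ℂ (ι → ℂ) F := fun n =>
  ∑ i : Fin n → ι, ((ContinuousMultilinearMap.mkPiAlgebra ℂ (Fin n) ℂ).compContinuousLinearMap
    (fun k => (ContinuousLinearMap.proj (i k) : (ι → ℂ) →L[ℂ] ℂ))).smulRight
      (p n (fun k => Pi.single (i k) 1))

lemma isoCSeries_real [DecidableEq ι] (p : FormalMultilinearSeries ℝ (ι → ℝ) F) (n : ℕ)
    (y : ι → ℝ) : isoCSeries p n (fun _ => isoC ι y) = p n (fun _ => y) := by
  have hy : y = ∑ j, y j • (Pi.single j (1 : ℝ) : ι → ℝ) := by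
    ext k
    simp [Finset.sum_apply, Pi.single_apply]
  have h1 : p n (fun _ => y) = ∑ i : Fin n → ι, (∏ k, y (i k)) • p n
      (fun k => Pi.single (i k) 1) := by
    conv_lhs => rw [show (fun _ : Fin n => y) = fun _ : Fin n => ∑ j, y j • (Pi.single j (1 : ℝ) : ι → ℝ)
      from funext fun _ => hy]
    have := (p n).toMultilinearMap.map_sum
      (fun (_ : Fin n) (j : ι) => y j • (Pi.single j (1 : ℝ) : ι → ℝ))
    refine this.trans ?_
    refine Finset.sum_congr rfl fun i _ => ?_
    exact (p n).toMultilinearMap.map_smul_univ (fun k => y (i k)) (fun k => Pi.single (i k) 1)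
  rw [h1]
  simp only [isoCSeries, _root_.sum_apply]
  refine Finset.sum_congr rfl fun i _ => ?_
  simp only [ContinuousMultilinearMap.smulRight_apply,
    ContinuousMultilinearMap.compContinuousLinearMap_apply,
    ContinuousMultilinearMap.mkPiAlgebra_apply, ContinuousLinearMap.proj_apply, isoC_apply]
  rw [← Complex.coe_smul]
  push_cast
  rfl

lemma isoCSeries_norm [DecidableEq ι] (p : FormalMultilinearSeries ℝ (ι → ℝ) F) (n : ℕ) :
    ‖isoCSeries p n‖ ≤ (Fintype.card ι : ℝ) ^ n * ‖p n‖ := by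
  refine (norm_sum_le _ _).trans ?_
  have : ∀ i ∈ (Finset.univ : Finset (Fin n → ι)),
      ‖((ContinuousMultilinearMap.mkPiAlgebra ℂ (Fin n) ℂ).compContinuousLinearMap
    (fun k => (ContinuousLinearMap.proj (i k) : (ι → ℂ) →L[ℂ] ℂ))).smulRight
      (p n (fun k => Pi.single (i k) 1))‖ ≤ ‖p n‖ := by
    intro i _
    rw [ContinuousMultilinearMap.norm_smulRight]
    have h1 := ContinuousMultilinearMap.norm_compContinuousLinearMap_le
      (ContinuousMultilinearMap.mkPiAlgebra ℂ (Fin n) ℂ)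
      (fun k => (ContinuousLinearMap.proj (i k) : (ι → ℂ) →L[ℂ] ℂ))
    rw [ContinuousMultilinearMap.norm_mkPiAlgebra, one_mul] at h1
    have h2 : ∏ k, ‖(ContinuousLinearMap.proj (i k) : (ι → ℂ) →L[ℂ] ℂ)‖ ≤ 1 := by
      refine Finset.prod_le_one (fun _ _ => norm_nonneg _) fun k _ => ?_
      refine ContinuousLinearMap.opNorm_le_bound _ zero_le_one fun z => ?_
      simpa using norm_le_pi_norm z (i k)
    have h3 : ‖p n (fun k => Pi.single (i k) 1)‖ ≤ ‖p n‖ := by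
      refine ((p n).le_opNorm _).trans ?_
      refine mul_le_of_le_one_right (norm_nonneg _) ?_
      refine Finset.prod_le_one (fun _ _ => norm_nonneg _) fun k _ => ?_
      rw [pi_norm_le_iff_of_nonneg zero_le_one]
      intro j
      by_cases h : j = i k
      · subst h; simp
      · simp [Pi.single_apply, h]
    calc _ ≤ 1 * ‖p n‖ := mul_le_mul (h1.trans h2) h3 (norm_nonneg _) zero_le_one
      _ = _ := one_mul _
  refine (Finset.sum_le_card_nsmul _ _ _ this).trans ?_
  simp

lemma iso_complexify [CompleteSpace F] {f : (ι → ℝ) → F} {x0 : ι → ℝ} (hf : AnalyticAt ℝ f x0) :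
    ∃ g : (ι → ℂ) → F, AnalyticAt ℂ g (isoC ι x0) ∧ ∀ᶠ x in 𝓝 x0, g (isoC ι x) = f x := by
  classical
  obtain ⟨p, r, hp⟩ := hf
  have hr : 0 < p.radius := hp.r_pos.trans_le hp.r_le
  set q := isoCSeries p with hq
  have hqr : 0 < q.radius := by
    obtain ⟨C, a, hC, ha, hb⟩ := p.le_mul_pow_of_radius_pos hr
    set c : ℝ := (Fintype.card ι : ℝ) with hc
    have hc0 : 0 ≤ c := by positivity
    set t : ℝ := (a * (c + 1))⁻¹ with ht
    have htp : 0 < t := by positivity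
    have := q.le_radius_of_bound (r := ⟨t, htp.le⟩) C (by
      intro n
      change ‖q n‖ * t ^ n ≤ C
      calc ‖q n‖ * t ^ n ≤ (c ^ n * (C * a ^ n)) * t ^ n := by
            gcongr
            exact (isoCSeries_norm p n).trans (by gcongr; exact hb n)
        _ = C * (c * a * t) ^ n := by rw [mul_pow, mul_pow]; ring
        _ ≤ C * 1 := by
            gcongr
            apply pow_le_one₀ (by positivity)
            rw [ht, mul_inv_le_iff₀ (by positivity)]
            nlinarith
        _ = C := mul_one C)
    refine lt_of_lt_of_le ?_ this
    exact ENNReal.coe_pos.2 (show (0 : NNReal) < ⟨t, htp.le⟩ from htp)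
  have hQ := q.hasFPowerSeriesOnBall hqr
  have hQa : AnalyticAt ℂ q.sum 0 := hQ.analyticAt
  refine ⟨fun z => q.sum (z - isoC ι x0), ?_, ?_⟩
  · have h1 : AnalyticAt ℂ (fun z : ι → ℂ => z - isoC ι x0) (isoC ι x0) :=
      analyticAt_id.sub analyticAt_const
    refine AnalyticAt.fun_comp (g := q.sum) ?_ h1
    simpa using hQa
  · have h1 : ∀ᶠ x in 𝓝 x0, x ∈ Metric.eball x0 r := Metric.eball_mem_nhds _ hp.r_pos
    filter_upwards [h1] with x hx
    have h3 := hp.hasSum_sub hx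
    rw [← map_sub]
    have h4 : q.sum (isoC ι (x - x0)) = ∑' n, q n (fun _ => isoC ι (x - x0)) := rfl
    rw [h4]
    have h5 : ∀ n, q n (fun _ => isoC ι (x - x0)) = p n (fun _ => x - x0) := fun n =>
      isoCSeries_real p n (x - x0)
    rw [tsum_congr h5]
    exact h3.tsum_eq

/-- A holomorphic map on a ball vanishing at the real points vanishes. -/
lemma iso_real_identity [CompleteSpace F] {f : (ι → ℂ) → F} {r : ℝ}
    (hd : DifferentiableOn ℂ f (ball 0 r))
    (h0 : ∀ x : ι → ℝ, isoC ι x ∈ ball (0 : ι → ℂ) r → f (isoC ι x) = 0) :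
    ∀ z ∈ ball (0 : ι → ℂ) r, f z = 0 := by
  intro z hz
  set x : ι → ℝ := fun j => (z j).re
  set y : ι → ℝ := fun j => (z j).im
  set γ : ℂ → (ι → ℂ) := fun lam => isoC ι x + lam • isoC ι y with hγ
  have hγd : Differentiable ℂ γ := by
    intro lam; exact (differentiableAt_id.smul_const _).const_add _
  set S : Set ℂ := γ ⁻¹' (ball 0 r) with hS
  have hSo : IsOpen S := isOpen_ball.preimage hγd.continuous
  have hSc : Convex ℝ S := by
    intro a ha b hb s t hs ht hst
    have h1 := (convex_ball (0 : ι → ℂ) r) ha hb hs ht hst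
    have : γ (s • a + t • b) = s • γ a + t • γ b := by
      ext j
      simp only [hγ, Pi.add_apply, Pi.smul_apply, isoC_apply, smul_eq_mul, Complex.real_smul]
      have hst' : (s : ℂ) + t = 1 := by exact_mod_cast hst
      linear_combination (-(x j : ℂ)) * hst'
    change γ _ ∈ ball (0 : ι → ℂ) r
    rw [this]; exact h1
  have hI : γ Complex.I = z := by
    ext j
    simp only [hγ, Pi.add_apply, Pi.smul_apply, isoC_apply, smul_eq_mul]
    rw [mul_comm]; exact Complex.re_add_im (z j)
  have hIS : Complex.I ∈ S := by change γ _ ∈ ball (0 : ι → ℂ) r; rw [hI]; exact hz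
  have hr : 0 < r := (norm_nonneg _).trans_lt (mem_ball_zero_iff.1 hz)
  have h0S : (0 : ℂ) ∈ S := by
    change γ 0 ∈ ball (0 : ι → ℂ) r
    have : γ 0 = isoC ι x := by simp [hγ]
    rw [this, mem_ball_zero_iff, pi_norm_lt_iff hr]
    intro j
    have h2 := (pi_norm_lt_iff hr).1 (mem_ball_zero_iff.1 hz) j
    refine lt_of_le_of_lt ?_ h2
    simp only [isoC_apply, Complex.norm_real]
    exact Complex.abs_re_le_norm (z j)
  have hcd : DifferentiableOn ℂ (fun lam => f (γ lam)) S :=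
    hd.comp hγd.differentiableOn fun lam h => h
  have han : AnalyticOnNhd ℂ (fun lam => f (γ lam)) S := hcd.analyticOnNhd hSo
  have hfr : ∃ᶠ lam in 𝓝[≠] (0 : ℂ), f (γ lam) = 0 := by
    have hev : ∀ᶠ t : ℝ in 𝓝[≠] 0, f (γ (t : ℂ)) = 0 := by
      have h1 : ∀ᶠ t : ℝ in 𝓝 0, ((t : ℂ)) ∈ S := by
        have : Tendsto (fun t : ℝ => (t : ℂ)) (𝓝 0) (𝓝 0) := by
          simpa using Complex.continuous_ofReal.tendsto 0
        exact this.eventually (hSo.mem_nhds h0S)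
      filter_upwards [nhdsWithin_le_nhds h1] with t ht
      have : γ (t : ℂ) = isoC ι (x + t • y) := by
        ext j; simp [hγ]
      rw [this]
      apply h0
      rw [← this]; exact ht
    have htd : Tendsto (fun t : ℝ => (t : ℂ)) (𝓝[≠] 0) (𝓝[≠] 0) := by
      refine tendsto_nhdsWithin_iff.2 ⟨?_, ?_⟩
      · have : Tendsto (fun t : ℝ => (t : ℂ)) (𝓝 0) (𝓝 0) := by
          simpa using Complex.continuous_ofReal.tendsto 0
        exact this.mono_left nhdsWithin_le_nhds
      · filter_upwards [self_mem_nhdsWithin] with t ht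
        simpa using ht
    exact htd.frequently hev.frequently
  have := han.eqOn_zero_of_preconnected_of_frequently_eq_zero hSc.isPreconnected h0S hfr hIS
  simpa [hI] using this

lemma iso_conj_hasFDerivAt {E : Type*} [NormedAddCommGroup E] [NormedSpace ℂ E] {f : E → F}
    {f' : E →L[ℂ] F} (σ : E →L⋆[ℂ] E) (τ : F →L⋆[ℂ] F) {x : E} (h : HasFDerivAt f f' (σ x)) :
    HasFDerivAt (fun y => τ (f (σ y))) (τ.comp (f'.comp σ) : E →L[ℂ] F) x := by
  rw [hasFDerivAt_iff_isLittleO] at h ⊢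
  have h1 := h.comp_tendsto (σ.continuous.tendsto x)
  have h2 : (fun y => τ (f (σ y) - f (σ x) - f' (σ y - σ x))) =O[𝓝 x]
      fun y => f (σ y) - f (σ x) - f' (σ y - σ x) := τ.isBigO_comp _ _
  have h3 : (fun y => σ y - σ x) =O[𝓝 x] fun y => y - x := by
    have := σ.isBigO_comp (fun y => y - x) (𝓝 x)
    simpa using this
  have h4 := (h2.trans_isLittleO h1).trans_isBigO h3
  refine h4.congr_left fun y => ?_
  simp

/-- conj-linear involution on functions -/
def isoStar (ι : Type*) [Fintype ι] : (ι → ℂ) →L⋆[ℂ] (ι → ℂ) := (starL ℂ : (ι → ℂ) ≃L⋆[ℂ] (ι → ℂ))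

@[simp] lemma isoStar_apply (x : ι → ℂ) (j : ι) : isoStar ι x j = (starRingEnd ℂ) (x j) := rfl
@[simp] lemma isoStar_real (x : ι → ℝ) : isoStar ι (isoC ι x) = isoC ι x := by
  ext j; simp
@[simp] lemma isoStar_isoStar (x : ι → ℂ) : isoStar ι (isoStar ι x) = x := by
  ext j; simp
@[simp] lemma isoStar_norm (x : ι → ℂ) : ‖isoStar ι x‖ = ‖x‖ := norm_star x

lemma isoStar_mem_ball {x : ι → ℂ} {r : ℝ} : isoStar ι x ∈ ball (0 : ι → ℂ) r ↔ x ∈ ball (0 : ι → ℂ) r := by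
  simp

lemma iso_conj_differentiableOn {f : (ι → ℂ) → F} (τ : F →L⋆[ℂ] F) {r : ℝ}
    (h : DifferentiableOn ℂ f (ball 0 r)) :
    DifferentiableOn ℂ (fun y => τ (f (isoStar ι y))) (ball 0 r) := by
  intro x hx
  have := (h.differentiableAt (isOpen_ball.mem_nhds (isoStar_mem_ball.2 hx))).hasFDerivAt
  exact (iso_conj_hasFDerivAt (isoStar ι) τ this).differentiableAt.differentiableWithinAt

lemma iso_analytic_ball {E G : Type*} [NormedAddCommGroup E] [NormedSpace ℂ E]
    [NormedAddCommGroup G] [NormedSpace ℂ G] [CompleteSpace G] {f : E → G} {x : E}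
    (hf : AnalyticAt ℂ f x) : ∃ r > 0, ∀ y ∈ ball x r, AnalyticAt ℂ f y :=
  Metric.eventually_nhds_iff_ball.1 hf.eventually_analyticAt

lemma iso_eventually_real {P : (ι → ℂ) → Prop} (h : ∀ᶠ z in 𝓝 (0 : ι → ℂ), P z) :
    ∀ᶠ x in 𝓝 (0 : ι → ℝ), P (isoC ι x) := by
  have : Tendsto (isoC ι) (𝓝 0) (𝓝 0) := by simpa using (isoC ι).continuous.tendsto 0
  exact this.eventually h

lemma isoC_norm (x : ι → ℝ) : ‖isoC ι x‖ = ‖x‖ := by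
  simp [Pi.norm_def, nnnorm, isoC]
  

/-- two germs of holomorphic maps which agree at the real points agree -/
lemma iso_identity_germ [CompleteSpace F] {f g : (ι → ℂ) → F} (hf : ∀ᶠ z in 𝓝 0, DifferentiableAt ℂ f z)
    (hg : ∀ᶠ z in 𝓝 0, DifferentiableAt ℂ g z)
    (h : ∀ᶠ x in 𝓝 (0 : ι → ℝ), f (isoC ι x) = g (isoC ι x)) : f =ᶠ[𝓝 0] g := by
  obtain ⟨r1, hr1, h1⟩ := Metric.eventually_nhds_iff_ball.1 (hf.and hg)
  obtain ⟨r2, hr2, h2⟩ := Metric.eventually_nhds_iff_ball.1 h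
  have := iso_real_identity (f := fun z => f z - g z) (r := min r1 r2) (by
    intro z hz
    have := h1 z (ball_subset_ball (min_le_left _ _) hz)
    exact (this.1.sub this.2).differentiableWithinAt) (by
    intro x hx
    rw [sub_eq_zero]
    apply h2
    rw [mem_ball_zero_iff] at hx ⊢
    rw [isoC_norm] at hx
    exact hx.trans_le (min_le_right _ _))
  filter_upwards [ball_mem_nhds (0 : ι → ℂ) (lt_min hr1 hr2)] with z hz
  exact sub_eq_zero.1 (this z hz)

lemma AnalyticAt.iso_diff {E G : Type*} [NormedAddCommGroup E] [NormedSpace ℂ E]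
    [NormedAddCommGroup G] [NormedSpace ℂ G] [CompleteSpace G] {f : E → G} {x : E}
    (hf : AnalyticAt ℂ f x) : ∀ᶠ z in 𝓝 x, DifferentiableAt ℂ f z :=
  hf.eventually_analyticAt.mono fun _ h => h.differentiableAt

lemma iso_star_analytic [CompleteSpace F] {f : (ι → ℂ) → F} (τ : F →L⋆[ℂ] F)
    (hf : AnalyticAt ℂ f 0) : AnalyticAt ℂ (fun y => τ (f (isoStar ι y))) 0 := by
  let τR : F →L[ℝ] F :=
    { toFun := τ, map_add' := map_add τ, map_smul' := by
        intro c x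
        have := τ.map_smulₛₗ (c : ℂ) x
        simpa using this
      cont := τ.continuous }
  have h1 : AnalyticAt ℝ (fun x : ι → ℝ => τR (f (isoC ι x))) 0 := by
    have e : AnalyticAt ℝ f (isoC ι 0) := by
      rw [map_zero]; exact hf.restrictScalars
    have e2 : AnalyticAt ℝ (fun x : ι → ℝ => f (isoC ι x)) 0 :=
      AnalyticAt.fun_comp e ((isoC ι).analyticAt 0)
    exact (τR.analyticAt _).fun_comp e2
  obtain ⟨g, hg, hgx⟩ := iso_complexify h1
  rw [map_zero] at hg
  refine hg.congr ?_
  refine iso_identity_germ hg.iso_diff ?_ ?_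
  · obtain ⟨r, hr, hrb⟩ := iso_analytic_ball hf
    have := iso_conj_differentiableOn (ι := ι) τ (fun y hy => (hrb y hy).differentiableAt.differentiableWithinAt)
    filter_upwards [ball_mem_nhds (0 : ι → ℂ) hr] with z hz
    exact this.differentiableAt (isOpen_ball.mem_nhds hz)
  · filter_upwards [hgx] with x hx
    rw [hx, isoStar_real]; rfl

end Cplxify

section LocInv
open Filter Metric Set
variable {𝕜 : Type*} [RCLike 𝕜]
variable {E F : Type*} [NormedAddCommGroup E] [NormedSpace 𝕜 E] [NormedAddCommGroup F]
  [NormedSpace 𝕜 F]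

lemma iso_local_inverse [FiniteDimensional 𝕜 E] {f : E → F} {a : E} [FiniteDimensional 𝕜 F]
    (hf : AnalyticAt 𝕜 f a) (hb : Function.Bijective (fderiv 𝕜 f a)) :
    ∃ g : F → E, AnalyticAt 𝕜 g (f a) ∧ g (f a) = a ∧ (∀ᶠ x in 𝓝 a, g (f x) = x) ∧
      ∀ᶠ y in 𝓝 (f a), f (g y) = y := by
  have : CompleteSpace E := FiniteDimensional.complete 𝕜 E
  have : CompleteSpace F := FiniteDimensional.complete 𝕜 F
  let i : E ≃L[𝕜] F := (LinearEquiv.ofBijective (fderiv 𝕜 f a : E →ₗ[𝕜] F) hb).toContinuousLinearEquiv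
  have hi : fderiv 𝕜 f a = (i : E →L[𝕜] F) := by ext; rfl
  have hs : HasStrictFDerivAt f (i : E →L[𝕜] F) a := by
    rw [← hi]; exact hf.hasStrictFDerivAt
  let h := hs.toOpenPartialHomeomorph f
  have hsrc : a ∈ h.source := hs.mem_toOpenPartialHomeomorph_source
  have hcoe : (h : E → F) = f := hs.toOpenPartialHomeomorph_coe
  refine ⟨h.symm, ?_, ?_, ?_, ?_⟩
  · have := h.analyticAt_symm' (𝕜 := 𝕜) (i := i) hsrc (by rw [hcoe]; exact hf) (by rw [hcoe]; exact hi)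
    rwa [hcoe] at this
  · have := h.left_inv hsrc
    rwa [hcoe] at this
  · filter_upwards [h.open_source.mem_nhds hsrc] with x hx
    have := h.left_inv hx
    rwa [hcoe] at this
  · have ht : f a ∈ h.target := by
      have := h.map_source hsrc
      rwa [hcoe] at this
    filter_upwards [h.open_target.mem_nhds ht] with y hy
    have := h.right_inv hy
    rwa [hcoe] at this

lemma iso_complement [FiniteDimensional 𝕜 E] [FiniteDimensional 𝕜 F] (A : E →L[𝕜] F)
    (hA : Function.Surjective A) (k : ℕ)
    (hk : Module.finrank 𝕜 E = Module.finrank 𝕜 F + k) :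
    ∃ κ : E →L[𝕜] (Fin k → 𝕜), Function.Bijective (A.prod κ) := by
  have hker : Module.finrank 𝕜 (LinearMap.ker (A : E →ₗ[𝕜] F)) = k := by
    have h1 := LinearMap.finrank_range_add_finrank_ker (A : E →ₗ[𝕜] F)
    have h2 : LinearMap.range (A : E →ₗ[𝕜] F) = ⊤ := LinearMap.range_eq_top.2 hA
    rw [h2, finrank_top] at h1
    omega
  obtain ⟨π, hπ⟩ := (LinearMap.ker (A : E →ₗ[𝕜] F)).subtype.exists_leftInverse_of_injective
    (Submodule.ker_subtype _)
  let e : LinearMap.ker (A : E →ₗ[𝕜] F) ≃ₗ[𝕜] (Fin k → 𝕜) :=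
    LinearEquiv.ofFinrankEq _ _ (by rw [hker]; simp)
  let κ : E →ₗ[𝕜] (Fin k → 𝕜) := e.toLinearMap ∘ₗ π
  have hdim : Module.finrank 𝕜 E = Module.finrank 𝕜 (F × (Fin k → 𝕜)) := by
    rw [hk, Module.finrank_prod]; simp
  refine ⟨LinearMap.toContinuousLinearMap κ, ?_⟩
  have hinj : Function.Injective (A.prod (LinearMap.toContinuousLinearMap κ)) := by
    rw [injective_iff_map_eq_zero]
    intro x hx
    have h1 : A x = 0 := congrArg Prod.fst hx
    have h2 : e (π x) = 0 := congrArg Prod.snd hx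
    have h3 : π x = 0 := by simpa using h2
    have h4 := LinearMap.congr_fun hπ ⟨x, h1⟩
    simp only [LinearMap.comp_apply, Submodule.subtype_apply, LinearMap.id_apply] at h4
    rw [h3] at h4
    exact (congrArg Subtype.val h4).symm
  exact ⟨hinj, (LinearMap.injective_iff_surjective_of_finrank_eq_finrank
    (f := ((A.prod (LinearMap.toContinuousLinearMap κ) : E →L[𝕜] F × (Fin k → 𝕜)) :
      E →ₗ[𝕜] F × (Fin k → 𝕜))) hdim).1 hinj⟩

end LocInv

section Geo1
open Filter Metric Set

lemma iso_comp_id {𝕜 E F : Type*} [NontriviallyNormedField 𝕜] [NormedAddCommGroup E]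
    [NormedSpace 𝕜 E] [NormedAddCommGroup F] [NormedSpace 𝕜 F] {f : E → F} {g : F → E} {a : F}
    (h : ∀ᶠ y in 𝓝 a, f (g y) = y) (hg : DifferentiableAt 𝕜 g a)
    (hf : DifferentiableAt 𝕜 f (g a)) (v : F) : fderiv 𝕜 f (g a) (fderiv 𝕜 g a v) = v := by
  have h1 : HasFDerivAt (fun y => f (g y)) ((fderiv 𝕜 f (g a)).comp (fderiv 𝕜 g a)) a :=
    hf.hasFDerivAt.comp a hg.hasFDerivAt
  have h2 : HasFDerivAt (fun y => f (g y)) (ContinuousLinearMap.id 𝕜 F) a :=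
    (hasFDerivAt_id a).congr_of_eventuallyEq h
  have := h1.unique h2
  exact DFunLike.congr_fun this v

variable {Z Y : Type*} [NormedAddCommGroup Z] [NormedSpace ℂ Z] [FiniteDimensional ℂ Z]
  [NormedAddCommGroup Y] [NormedSpace ℂ Y] [FiniteDimensional ℂ Y]

lemma iso_rank {S : Type*} [NormedAddCommGroup S] [NormedSpace ℂ S] [FiniteDimensional ℂ S]
    {T : Z × S → S × Y} (hT : AnalyticAt ℂ T 0)
    (h0 : ∀ᶠ s in 𝓝 (0 : S), T (0, s) = (s, 0))
    (hr : ∀ᶠ a in 𝓝 (0 : Z × S),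
      Module.finrank ℂ (LinearMap.range (fderiv ℂ T a : Z × S →ₗ[ℂ] S × Y)) ≤
        Module.finrank ℂ S) :
    ∀ᶠ a in 𝓝 (0 : Z × S), (T a).2 = 0 := by
  have : CompleteSpace S := FiniteDimensional.complete ℂ S
  have : CompleteSpace Z := FiniteDimensional.complete ℂ Z
  have : CompleteSpace Y := FiniteDimensional.complete ℂ Y
  have hT00 : T 0 = 0 := h0.self_of_nhds
  set Φ : Z × S → Z × S := fun a => (a.1, (T a).1) with hΦ
  have hT1 : AnalyticAt ℂ (fun a => (T a).1) 0 := analyticAt_fst.fun_comp hT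
  have hΦa : AnalyticAt ℂ Φ 0 := analyticAt_fst.prod hT1
  have hΦ0 : Φ 0 = 0 := by simp [hΦ, hT00]
  have hdT1 : ∀ v : S, fderiv ℂ (fun a => (T a).1) 0 ((0 : Z), v) = v := by
    intro v
    have h1 : HasFDerivAt (fun s : S => (T ((0 : Z), s)).1)
        ((fderiv ℂ (fun a => (T a).1) 0).comp (ContinuousLinearMap.inr ℂ Z S)) 0 := by
      have h2 : HasFDerivAt (fun a => (T a).1) (fderiv ℂ (fun a => (T a).1) 0)
        ((ContinuousLinearMap.inr ℂ Z S) 0) := by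
          rw [map_zero]; exact hT1.differentiableAt.hasFDerivAt
      exact h2.comp 0 (ContinuousLinearMap.inr ℂ Z S).hasFDerivAt
    have h2 : HasFDerivAt (fun s : S => (T ((0 : Z), s)).1) (ContinuousLinearMap.id ℂ S) 0 := by
      refine (hasFDerivAt_id 0).congr_of_eventuallyEq ?_
      filter_upwards [h0] with s hs
      rw [hs]; rfl
    have := DFunLike.congr_fun (h1.unique h2) v
    simpa using this
  have hdΦ : ∀ v, fderiv ℂ Φ 0 v = (v.1, fderiv ℂ (fun a => (T a).1) 0 v) := by
    intro v
    have : HasFDerivAt Φ ((ContinuousLinearMap.fst ℂ Z S).prod (fderiv ℂ (fun a => (T a).1) 0)) 0 :=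
      hasFDerivAt_fst.prodMk hT1.differentiableAt.hasFDerivAt
    rw [this.fderiv]; rfl
  have hinj : Function.Injective (fderiv ℂ Φ 0) := by
    rw [injective_iff_map_eq_zero]
    rintro ⟨u, s⟩ hv
    rw [hdΦ] at hv
    have h1 : u = 0 := congrArg Prod.fst hv
    subst h1
    have h2 : fderiv ℂ (fun a => (T a).1) 0 ((0 : Z), s) = 0 := congrArg Prod.snd hv
    rw [hdT1] at h2
    rw [h2]; rfl
  have hbij : Function.Bijective (fderiv ℂ Φ 0) :=
    ⟨hinj, (LinearMap.injective_iff_surjective (f := (fderiv ℂ Φ 0 : Z × S →ₗ[ℂ] Z × S))).1 hinj⟩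
  obtain ⟨Ψ, hΨa, hΨ0, hΨΦ, hΦΨ⟩ := iso_local_inverse hΦa hbij
  rw [hΦ0] at hΨa hΨ0 hΦΨ
  set Γ : Z × S → S × Y := fun a => T (Ψ a) with hΓ
  have hTΨ : AnalyticAt ℂ T (Ψ 0) := by rw [hΨ0]; exact hT
  have hΓa : AnalyticAt ℂ Γ 0 := hTΨ.fun_comp hΨa
  have hΨc : Tendsto Ψ (𝓝 0) (𝓝 0) := by
    have := hΨa.continuousAt.tendsto
    rwa [hΨ0] at this
  have hG1 : ∀ᶠ a in 𝓝 (0 : Z × S), (Γ a).1 = a.2 := by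
    filter_upwards [hΦΨ] with a ha
    exact congrArg Prod.snd ha
  -- derivative of the second component in the `Z` direction vanishes
  have hG2 : ∀ᶠ a in 𝓝 (0 : Z × S), DifferentiableAt ℂ Γ a ∧
      ∀ u : Z, (fderiv ℂ Γ a (u, 0)).2 = 0 := by
    filter_upwards [hG1.eventually_nhds, hΨc.eventually hr, hΨa.iso_diff,
      hΨc.eventually hT.iso_diff, hΓa.iso_diff] with a h1 h2 h3 h4 h5
    refine ⟨h5, fun u => ?_⟩
    have e1 : fderiv ℂ Γ a = (fderiv ℂ T (Ψ a)).comp (fderiv ℂ Ψ a) := fderiv_comp a h4 h3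
    have e2 : ∀ v, (fderiv ℂ Γ a v).1 = v.2 := by
      intro v
      have k1 : HasFDerivAt (fun a => (Γ a).1) ((ContinuousLinearMap.fst ℂ S Y).comp (fderiv ℂ Γ a)) a :=
        (ContinuousLinearMap.fst ℂ S Y).hasFDerivAt.comp a h5.hasFDerivAt
      have k2 : HasFDerivAt (fun a => (Γ a).1) (ContinuousLinearMap.snd ℂ Z S) a :=
        hasFDerivAt_snd.congr_of_eventuallyEq h1
      exact DFunLike.congr_fun (k1.unique k2) v
    set R := LinearMap.range (fderiv ℂ Γ a : Z × S →ₗ[ℂ] S × Y) with hR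
    have hRle : Module.finrank ℂ R ≤ Module.finrank ℂ S := by
      refine le_trans (Submodule.finrank_mono ?_) h2
      rintro _ ⟨v, rfl⟩
      exact ⟨fderiv ℂ Ψ a v, by simp [e1]⟩
    let π : R →ₗ[ℂ] S := (LinearMap.fst ℂ S Y).comp R.subtype
    have hπs : Function.Surjective π := by
      intro s
      refine ⟨⟨fderiv ℂ Γ a (0, s), ⟨(0, s), rfl⟩⟩, ?_⟩
      exact e2 (0, s)
    have hfr : Module.finrank ℂ R = Module.finrank ℂ S := by
      have h7 := LinearMap.finrank_le_finrank_of_surjective (f := π) hπs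
      omega
    have hπi : Function.Injective π :=
      (LinearMap.injective_iff_surjective_of_finrank_eq_finrank hfr).2 hπs
    have h8 : (⟨fderiv ℂ Γ a (u, 0), ⟨(u, 0), rfl⟩⟩ : R) = 0 := by
      apply hπi
      rw [map_zero]
      exact e2 (u, 0)
    have h9 := congrArg Subtype.val h8
    exact congrArg Prod.snd h9
  have hG0 : ∀ᶠ a in 𝓝 (0 : Z × S), (Γ ((0 : Z), a.2)).2 = 0 := by
    have t1 : Tendsto (fun a : Z × S => a.2) (𝓝 0) (𝓝 0) := by
      simpa using (continuous_snd (X := Z) (Y := S)).tendsto 0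
    have t2 : Tendsto (fun a : Z × S => ((0 : Z), a.2)) (𝓝 0) (𝓝 0) := by
      have : Continuous fun a : Z × S => ((0 : Z), a.2) := by fun_prop
      exact this.tendsto' _ _ rfl
    filter_upwards [t1.eventually h0, t2.eventually hΨΦ] with a h1 h2
    have : Φ ((0 : Z), a.2) = (0, a.2) := by simp [hΦ, h1]
    rw [this] at h2
    simp [hΓ, h2, h1]
  obtain ⟨ε, hε, hb⟩ := Metric.eventually_nhds_iff_ball.1 (hG2.and hG0)
  have hGz : ∀ a ∈ ball (0 : Z × S) ε, (Γ a).2 = 0 := by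
    rintro ⟨u, s⟩ ha
    have hmem : ∀ u' ∈ ball (0 : Z) ε, (u', s) ∈ ball (0 : Z × S) ε := by
      intro u' hu'
      rw [mem_ball_zero_iff] at *
      rw [Prod.norm_def] at *
      exact max_lt hu' (lt_of_le_of_lt (le_max_right _ _) ha)
    have hu : u ∈ ball (0 : Z) ε := by
      rw [mem_ball_zero_iff] at *
      rw [Prod.norm_def] at ha
      exact lt_of_le_of_lt (le_max_left _ _) ha
    have hd : ∀ u' ∈ ball (0 : Z) ε, HasFDerivAt (fun u' => (Γ (u', s)).2) (0 : Z →L[ℂ] Y) u' := by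
      intro u' hu'
      have h1 := (hb _ (hmem u' hu')).1
      have k1 : HasFDerivAt (fun u' : Z => (u', s)) (ContinuousLinearMap.inl ℂ Z S) u' :=
        hasFDerivAt_prodMk_left u' s
      have k2 : HasFDerivAt (fun u' : Z => Γ (u', s))
          ((fderiv ℂ Γ (u', s)).comp (ContinuousLinearMap.inl ℂ Z S)) u' :=
        HasFDerivAt.comp (g := Γ) u' h1.1.hasFDerivAt k1
      have k3 : HasFDerivAt (fun u' : Z => (Γ (u', s)).2) ((ContinuousLinearMap.snd ℂ S Y).comp
          ((fderiv ℂ Γ (u', s)).comp (ContinuousLinearMap.inl ℂ Z S))) u' :=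
        (ContinuousLinearMap.snd ℂ S Y).hasFDerivAt.comp u' k2
      convert k3 using 1
      ext v
      simp [h1.2 v]
    have hc := (convex_ball (0 : Z) ε).norm_image_sub_le_of_norm_hasFDerivWithin_le (𝕜 := ℂ)
      (f := fun u' => (Γ (u', s)).2) (f' := fun _ => 0) (C := 0)
      (fun u' hu' => (hd u' hu').hasFDerivWithinAt) (by simp) (mem_ball_self hε) hu
    have h3 := (hb _ ha).2
    have h4 : (Γ (u, s)).2 - (Γ (0, s)).2 = 0 := by
      rw [zero_mul] at hc
      exact norm_le_zero_iff.1 hc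
    simp only at h3
    rw [h3, sub_zero] at h4
    exact h4
  have hΦc : Tendsto Φ (𝓝 0) (𝓝 0) := by
    have := hΦa.continuousAt.tendsto
    rwa [hΦ0] at this
  filter_upwards [hΨΦ, hΦc.eventually (ball_mem_nhds 0 hε)] with a h1 h2
  have := hGz _ h2
  simpa [hΓ, h1] using this

lemma iso_lift_inj {E F : Type*} [NormedAddCommGroup E] [NormedSpace ℂ E] [FiniteDimensional ℂ E]
    [NormedAddCommGroup F] [NormedSpace ℂ F] [FiniteDimensional ℂ F] (A : E →L[ℂ] F) (n : ℕ)
    (hn : n ≤ Module.finrank ℂ (LinearMap.range (A : E →ₗ[ℂ] F))) :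
    ∃ B : (Fin n → ℂ) →L[ℂ] E, Function.Injective (A.comp B) := by
  obtain ⟨f, hf⟩ := exists_linearIndependent_of_le_finrank hn
  choose v hv using fun i => (f i).2
  refine ⟨LinearMap.toContinuousLinearMap (Fintype.linearCombination ℂ v), ?_⟩
  rw [injective_iff_map_eq_zero]
  intro c hc
  have h1 : ∑ i, c i • (A (v i)) = 0 := by
    have : A (∑ i, c i • v i) = 0 := by
      simpa [Fintype.linearCombination_apply] using hc
    simpa using this
  have h2 : ∑ i, c i • f i = 0 := by
    apply Subtype.ext
    rw [AddSubmonoidClass.coe_finsetSum]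
    rw [← ZeroMemClass.coe_zero (LinearMap.range (A : E →ₗ[ℂ] F))] at h1
    simpa [← hv] using h1
  exact funext (Fintype.linearIndependent_iff.1 hf c h2)

lemma iso_coprod {E : Type*} [NormedAddCommGroup E] [NormedSpace ℂ E] [FiniteDimensional ℂ E]
    {r k : ℕ} (A : (Fin r → ℂ) →L[ℂ] E) (hA : Function.Injective A)
    (hk : Module.finrank ℂ E = r + k) :
    ∃ B : (Fin k → ℂ) →L[ℂ] E, Function.Bijective (A.coprod B) := by
  obtain ⟨q, hq⟩ := Submodule.exists_isCompl (LinearMap.range (A : (Fin r → ℂ) →ₗ[ℂ] E))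
  have h1 := Submodule.finrank_add_eq_of_isCompl hq
  have h2 : Module.finrank ℂ (LinearMap.range (A : (Fin r → ℂ) →ₗ[ℂ] E)) = r := by
    rw [LinearMap.finrank_range_of_inj hA]; simp
  let e : (Fin k → ℂ) ≃ₗ[ℂ] q := LinearEquiv.ofFinrankEq _ _ (by simp; omega)
  refine ⟨LinearMap.toContinuousLinearMap (q.subtype ∘ₗ e.toLinearMap), ?_⟩
  have hinj : Function.Injective (A.coprod (LinearMap.toContinuousLinearMap
      (q.subtype ∘ₗ e.toLinearMap))) := by
    rw [injective_iff_map_eq_zero]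
    rintro ⟨s, y⟩ h
    have h3 : A s + (e y : E) = 0 := h
    have h4 : A s ∈ LinearMap.range (A : (Fin r → ℂ) →ₗ[ℂ] E) ⊓ q := by
      refine ⟨⟨s, rfl⟩, ?_⟩
      rw [eq_neg_of_add_eq_zero_left h3]
      exact q.neg_mem (e y).2
    rw [hq.inf_eq_bot] at h4
    have h5 : A s = 0 := h4
    have h6 : s = 0 := (injective_iff_map_eq_zero A).1 hA s h5
    rw [h5, zero_add] at h3
    have h7 : e y = 0 := Subtype.ext h3
    have h8 : y = 0 := by simpa using h7
    rw [h6, h8]; rfl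
  refine ⟨hinj, (LinearMap.injective_iff_surjective_of_finrank_eq_finrank
    (f := (A.coprod (LinearMap.toContinuousLinearMap (q.subtype ∘ₗ e.toLinearMap)) :
      (Fin r → ℂ) × (Fin k → ℂ) →ₗ[ℂ] E)) ?_).1 hinj⟩
  rw [hk]; simp [Module.finrank_prod]

end Geo1

set_option linter.unusedSectionVars false
section Geo2
open Filter Metric Set

variable {E V : Type*} [NormedAddCommGroup E] [NormedSpace ℂ E] [FiniteDimensional ℂ E]
  [NormedAddCommGroup V] [NormedSpace ℂ V] [FiniteDimensional ℂ V]

/-- Local data of two transversal analytic submersions. -/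
structure IsoGeo {k : ℕ} (φ : Bool → E → V) (κ : Bool → E →L[ℂ] (Fin k → ℂ)) (R : ℝ) : Prop where
  pos : 0 < R
  an : ∀ b, ∀ x ∈ ball (0 : E) R, AnalyticAt ℂ (φ b) x
  bij : ∀ b, ∀ x ∈ ball (0 : E) R, Function.Bijective ((fderiv ℂ (φ b) x).prod (κ b))

/-- Orbit of the origin. -/
inductive IsoOrb (φ : Bool → E → V) (η : ℝ) : E → Prop
  | zero : IsoOrb φ η 0
  | step (b : Bool) (x y : E) : IsoOrb φ η x → y ∈ ball (0 : E) η → φ b y = φ b x → IsoOrb φ η y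


lemma IsoOrb.mem_ball {φ : Bool → E → V} {η : ℝ} (hη : 0 < η) {x : E} (h : IsoOrb φ η x) :
    x ∈ ball (0 : E) η := by
  cases h with
  | zero => exact mem_ball_self hη
  | step b x y h1 h2 h3 => exact h2

lemma IsoOrb.mono {φ : Bool → E → V} {η η' : ℝ} (hη : η ≤ η') {x : E} (h : IsoOrb φ η x) :
    IsoOrb φ η' x := by
  induction h with
  | zero => exact IsoOrb.zero
  | step b x y h1 h2 h3 ih => exact IsoOrb.step b x y ih (ball_subset_ball hη h2) h3

lemma IsoGeo.mono {k : ℕ} {φ : Bool → E → V} {κ : Bool → E →L[ℂ] (Fin k → ℂ)} {R R' : ℝ}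
    (h : IsoGeo φ κ R) (h0 : 0 < R') (hR : R' ≤ R) : IsoGeo φ κ R' :=
  ⟨h0, fun b x hx => h.an b x (ball_subset_ball hR hx),
    fun b x hx => h.bij b x (ball_subset_ball hR hx)⟩

lemma iso_geo_exists {k : ℕ} {φ : Bool → E → V} (ha : ∀ b, AnalyticAt ℂ (φ b) 0)
    (hs : ∀ b, Function.Surjective (fderiv ℂ (φ b) 0))
    (hk : Module.finrank ℂ E = Module.finrank ℂ V + k) :
    ∃ κ : Bool → E →L[ℂ] (Fin k → ℂ), ∃ R, IsoGeo φ κ R := by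
  have : CompleteSpace E := FiniteDimensional.complete ℂ E
  have : CompleteSpace V := FiniteDimensional.complete ℂ V
  choose κ hκ using fun b => iso_complement (fderiv ℂ (φ b) 0) (hs b) k hk
  have h1 : ∀ b, ∀ᶠ x in 𝓝 (0 : E), AnalyticAt ℂ (φ b) x ∧
      Function.Bijective ((fderiv ℂ (φ b) x).prod (κ b)) := by
    intro b
    refine (ha b).eventually_analyticAt.and ?_
    let e : E ≃L[ℂ] V × (Fin k → ℂ) := ContinuousLinearEquiv.ofBijective
      ((fderiv ℂ (φ b) 0).prod (κ b)) (LinearMap.ker_eq_bot.2 (hκ b).1)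
      (LinearMap.range_eq_top.2 (hκ b).2)
    have hn := ContinuousLinearEquiv.nhds e
    have hc : ContinuousAt (fun x => (fderiv ℂ (φ b) x).prod (κ b)) 0 := by
      have h2 : ContinuousAt (fderiv ℂ (φ b)) 0 := (ha b).fderiv.continuousAt
      have h3 : Continuous fun A : E →L[ℂ] V => A.prod (κ b) := by
        have : (fun A : E →L[ℂ] V => A.prod (κ b)) = fun A =>
          (ContinuousLinearMap.inl ℂ V (Fin k → ℂ)).comp A +
            (ContinuousLinearMap.inr ℂ V (Fin k → ℂ)).comp (κ b) := by
          ext A x <;> simp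
        rw [this]; fun_prop
      exact h3.continuousAt.comp h2
    have h4 := hc.tendsto.eventually hn
    filter_upwards [h4] with x hx
    obtain ⟨e', he'⟩ := hx
    rw [← he']
    exact e'.bijective
  obtain ⟨R, hR, hb⟩ := Metric.eventually_nhds_iff_ball.1 (eventually_all.2 h1)
  exact ⟨κ, R, hR, fun b x hx => (hb x hx b).1, fun b x hx => (hb x hx b).2⟩

lemma IsoGeo.inv {k : ℕ} {φ : Bool → E → V} {κ : Bool → E →L[ℂ] (Fin k → ℂ)} {R : ℝ}
    (h : IsoGeo φ κ R) (b : Bool) {x : E} (hx : x ∈ ball (0 : E) R) :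
    HasFDerivAt (fun z => (φ b z, κ b z)) ((fderiv ℂ (φ b) x).prod (κ b)) x ∧
    ∃ g : V × (Fin k → ℂ) → E, AnalyticAt ℂ g (φ b x, κ b x) ∧ g (φ b x, κ b x) = x ∧
      (∀ᶠ z in 𝓝 x, g (φ b z, κ b z) = z) ∧
      (∀ᶠ q in 𝓝 (φ b x, κ b x), φ b (g q) = q.1 ∧ κ b (g q) = q.2) := by
  have : CompleteSpace E := FiniteDimensional.complete ℂ E
  have : CompleteSpace V := FiniteDimensional.complete ℂ V
  have hd : HasFDerivAt (fun z => (φ b z, κ b z)) ((fderiv ℂ (φ b) x).prod (κ b)) x :=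
    (h.an b x hx).differentiableAt.hasFDerivAt.prodMk (κ b).hasFDerivAt
  refine ⟨hd, ?_⟩
  have ha : AnalyticAt ℂ (fun z => (φ b z, κ b z)) x :=
    (h.an b x hx).prod ((κ b).analyticAt x)
  obtain ⟨g, h1, h2, h3, h4⟩ := iso_local_inverse ha (by rw [hd.fderiv]; exact h.bij b x hx)
  refine ⟨g, h1, h2, h3, ?_⟩
  filter_upwards [h4] with q hq
  exact ⟨congrArg Prod.fst hq, congrArg Prod.snd hq⟩

lemma IsoGeo.slide {k : ℕ} {φ : Bool → E → V} {κ : Bool → E →L[ℂ] (Fin k → ℂ)} {R : ℝ}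
    (h : IsoGeo φ κ R) (b : Bool) {x y : E} (hx : x ∈ ball (0 : E) R) (hy : y ∈ ball (0 : E) R)
    (hxy : φ b y = φ b x) :
    ∃ ψ : E → E, AnalyticAt ℂ ψ y ∧ ψ y = x ∧ Function.Injective (fderiv ℂ ψ y) ∧
      ∀ᶠ z in 𝓝 y, φ b (ψ z) = φ b z := by
  obtain ⟨hdx, g, h1, h2, h3, h4⟩ := h.inv b hx
  obtain ⟨hdy, -⟩ := h.inv b hy
  set q : E → V × (Fin k → ℂ) := fun z => (φ b z, κ b z + (κ b x - κ b y)) with hq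
  have hqy : q y = (φ b x, κ b x) := by simp [hq, hxy]
  have hqa : AnalyticAt ℂ q y :=
    (h.an b y hy).prod (((κ b).analyticAt y).add analyticAt_const)
  have hqd : HasFDerivAt q ((fderiv ℂ (φ b) y).prod (κ b)) y :=
    (h.an b y hy).differentiableAt.hasFDerivAt.prodMk ((κ b).hasFDerivAt.add_const _)
  rw [← hqy] at h1 h2 h4
  have hψ : AnalyticAt ℂ (fun z => g (q z)) y := h1.fun_comp hqa
  have hev := hqa.continuousAt.tendsto.eventually h4
  refine ⟨fun z => g (q z), hψ, h2, ?_, ?_⟩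
  · have e1 : HasFDerivAt (fun z => (φ b (g (q z)), κ b (g (q z))))
        (((fderiv ℂ (φ b) x).prod (κ b)).comp (fderiv ℂ (fun z => g (q z)) y)) y := by
      have hdx' : HasFDerivAt (fun z => (φ b z, κ b z)) ((fderiv ℂ (φ b) x).prod (κ b))
        ((fun z => g (q z)) y) := by simpa only [h2] using hdx
      exact HasFDerivAt.comp (g := fun z => (φ b z, κ b z)) y hdx' hψ.differentiableAt.hasFDerivAt
    have e2 : HasFDerivAt (fun z => (φ b (g (q z)), κ b (g (q z))))
        ((fderiv ℂ (φ b) y).prod (κ b)) y := by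
      refine hqd.congr_of_eventuallyEq ?_
      filter_upwards [hev] with z hz
      exact Prod.ext hz.1 hz.2
    have e3 := e1.unique e2
    have e4 := (h.bij b y hy).1
    rw [← e3] at e4
    rw [ContinuousLinearMap.coe_comp] at e4
    exact Function.Injective.of_comp e4
  · filter_upwards [hev] with z hz
    exact hz.1

lemma IsoGeo.transport {k : ℕ} {φ : Bool → E → V} {κ : Bool → E →L[ℂ] (Fin k → ℂ)} {R : ℝ}
    (h : IsoGeo φ κ R) {x : E} (hx : IsoOrb φ R x) :
    ∃ τ : E → E, AnalyticAt ℂ τ x ∧ τ x = 0 ∧ Function.Injective (fderiv ℂ τ x) ∧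
      ∀ᶠ z in 𝓝 x, IsoOrb φ R z → IsoOrb φ R (τ z) := by
  induction hx with
  | zero => exact ⟨id, analyticAt_id, rfl, by simp [Function.injective_id], by simp⟩
  | step b x y h1 h2 h3 ih =>
    obtain ⟨τ, a1, a2, a3, a4⟩ := ih
    have hx := h1.mem_ball h.pos
    obtain ⟨ψ, b1, b2, b3, b4⟩ := h.slide b hx h2 h3
    rw [← b2] at a1 a2 a3 a4
    refine ⟨fun z => τ (ψ z), a1.fun_comp b1, a2, ?_, ?_⟩
    · have : fderiv ℂ (fun z => τ (ψ z)) y = (fderiv ℂ τ (ψ y)).comp (fderiv ℂ ψ y) :=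
        fderiv_comp (g := τ) y a1.differentiableAt b1.differentiableAt
      rw [this]
      exact a3.comp b3
    · have hc := b1.continuousAt.tendsto
      have hm : ∀ᶠ z in 𝓝 y, ψ z ∈ ball (0 : E) R :=
        hc.eventually (isOpen_ball.mem_nhds (by rw [b2]; exact hx))
      filter_upwards [hm, hc.eventually a4, b4] with z k1 k2 k3 hz
      exact k2 (IsoOrb.step b z (ψ z) hz k1 k3)

/-- the orbit contains an analytic disc of dimension `r`. -/
def IsoP (φ : Bool → E → V) (η : ℝ) (r : ℕ) : Prop :=
  ∃ θ : (Fin r → ℂ) → E, AnalyticAt ℂ θ 0 ∧ Function.Injective (fderiv ℂ θ 0) ∧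
    ∀ᶠ s in 𝓝 0, IsoOrb φ η (θ s)

lemma IsoP.zero (φ : Bool → E → V) (η : ℝ) : IsoP φ η 0 :=
  ⟨fun _ => 0, analyticAt_const, Function.injective_of_subsingleton _,
    Eventually.of_forall fun _ => IsoOrb.zero⟩

lemma IsoP.le {φ : Bool → E → V} {η : ℝ} {r : ℕ} (h : IsoP φ η r) : r ≤ Module.finrank ℂ E := by
  obtain ⟨θ, -, h2, -⟩ := h
  have := LinearMap.finrank_le_finrank_of_injective
    (f := (fderiv ℂ θ 0 : (Fin r → ℂ) →ₗ[ℂ] E)) h2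
  simpa using this

lemma IsoP.mono {φ : Bool → E → V} {η η' : ℝ} {r : ℕ} (h : IsoP φ η r) (hη : η ≤ η') :
    IsoP φ η' r := by
  obtain ⟨θ, h1, h2, h3⟩ := h
  exact ⟨θ, h1, h2, h3.mono fun s hs => hs.mono hη⟩

lemma IsoP.center {k : ℕ} {φ : Bool → E → V} {κ : Bool → E →L[ℂ] (Fin k → ℂ)} {R : ℝ}
    (h : IsoGeo φ κ R) {r : ℕ} (hP : IsoP φ R r) :
    ∃ θ : (Fin r → ℂ) → E, AnalyticAt ℂ θ 0 ∧ θ 0 = 0 ∧ Function.Injective (fderiv ℂ θ 0) ∧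
    ∀ᶠ s in 𝓝 0, IsoOrb φ R (θ s) := by
  obtain ⟨θ, h1, h2, h3⟩ := hP
  obtain ⟨τ, a1, a2, a3, a4⟩ := h.transport h3.self_of_nhds
  refine ⟨fun s => τ (θ s), a1.fun_comp h1, a2, ?_, ?_⟩
  · have : fderiv ℂ (fun z => τ (θ z)) 0 = (fderiv ℂ τ (θ 0)).comp (fderiv ℂ θ 0) :=
      fderiv_comp (g := τ) 0 a1.differentiableAt h1.differentiableAt
    rw [this]
    exact a3.comp h2
  · filter_upwards [h3, h1.continuousAt.tendsto.eventually a4] with s k1 k2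
    exact k2 k1

lemma iso_maximal (φ : Bool → E → V) : ∃ r, (∀ η > 0, IsoP φ η r) ∧ ∃ η > 0, ¬ IsoP φ η (r + 1) := by
  classical
  by_contra! hcon
  have h1 : ∀ r, ∀ η > 0, IsoP φ η r := by
    intro r
    induction r with
    | zero => exact fun η _ => IsoP.zero φ η
    | succ r ih => exact hcon r ih
  have := (h1 (Module.finrank ℂ E + 1) 1 one_pos).le
  omega

lemma IsoP.full {φ : Bool → E → V} {k : ℕ} {κ : Bool → E →L[ℂ] (Fin k → ℂ)} {R : ℝ}
    (h : IsoGeo φ κ R) (hP : IsoP φ R (Module.finrank ℂ E)) : ∀ᶠ x in 𝓝 0, IsoOrb φ R x := by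
  have : CompleteSpace E := FiniteDimensional.complete ℂ E
  obtain ⟨θ, h1, h0, h2, h3⟩ := hP.center h
  have hs : Function.Surjective (fderiv ℂ θ 0) :=
    (LinearMap.injective_iff_surjective_of_finrank_eq_finrank
      (f := (fderiv ℂ θ 0 : (Fin (Module.finrank ℂ E) → ℂ) →ₗ[ℂ] E)) (by simp)).1 h2
  have h4 := HasStrictFDerivAt.map_nhds_eq_of_surj h1.hasStrictFDerivAt
    (LinearMap.range_eq_top.2 hs)
  rw [← h0, ← h4]
  exact h3

end Geo2

set_option linter.unusedSectionVars false
section Geo3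
open Filter Metric Set

variable {E V : Type*} [NormedAddCommGroup E] [NormedSpace ℂ E] [FiniteDimensional ℂ E]
  [NormedAddCommGroup V] [NormedSpace ℂ V] [FiniteDimensional ℂ V]

lemma iso_G4 {φ : Bool → E → V} {k : ℕ} {κ : Bool → E →L[ℂ] (Fin k → ℂ)} {R : ℝ}
    (h : IsoGeo φ κ R) {r k' : ℕ} (hP : IsoP φ R r) (hnP : ¬ IsoP φ R (r + 1))
    (hk' : Module.finrank ℂ E = r + k') :
    ∃ f : E → (Fin k' → ℂ), AnalyticAt ℂ f 0 ∧ f 0 = 0 ∧ Function.Surjective (fderiv ℂ f 0) ∧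
      ∃ η > 0, ∀ b, ∀ x ∈ ball (0 : E) η, ∀ y ∈ ball (0 : E) η, f x = 0 → φ b y = φ b x →
        f y = 0 := by
  have : CompleteSpace E := FiniteDimensional.complete ℂ E
  have : CompleteSpace V := FiniteDimensional.complete ℂ V
  obtain ⟨θ, t1, t2, t3, t4⟩ := hP.center h
  obtain ⟨B, hB⟩ := iso_coprod (fderiv ℂ θ 0) t3 hk'
  obtain ⟨Θ, hΘ⟩ : ∃ Θ : (Fin r → ℂ) × (Fin k' → ℂ) → E, ∀ a, Θ a = θ a.1 + B a.2 :=
    ⟨_, fun _ => rfl⟩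
  have hΘ' : Θ = fun a => θ a.1 + B a.2 := funext hΘ
  have hΘ0 : Θ 0 = 0 := by rw [hΘ]; simp [t2]
  have hΘd : HasFDerivAt Θ ((fderiv ℂ θ 0).coprod B) 0 := by
    rw [hΘ']
    have k1 : HasFDerivAt θ (fderiv ℂ θ 0) (Prod.fst (0 : (Fin r → ℂ) × (Fin k' → ℂ))) :=
      t1.differentiableAt.hasFDerivAt
    have k2 := (k1.comp (0 : (Fin r → ℂ) × (Fin k' → ℂ)) hasFDerivAt_fst).add
      (B.hasFDerivAt.comp (0 : (Fin r → ℂ) × (Fin k' → ℂ)) hasFDerivAt_snd)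
    have e : (fderiv ℂ θ 0).coprod B = (fderiv ℂ θ 0).comp (ContinuousLinearMap.fst ℂ _ _) +
        B.comp (ContinuousLinearMap.snd ℂ _ _) := by
      ext <;> simp
    rw [e]
    exact k2
  have hΘa : AnalyticAt ℂ Θ 0 := by
    rw [hΘ']
    have k1 : AnalyticAt ℂ θ (Prod.fst (0 : (Fin r → ℂ) × (Fin k' → ℂ))) := t1
    exact (k1.fun_comp analyticAt_fst).add ((B.analyticAt _).fun_comp analyticAt_snd)
  obtain ⟨G, g1, g2, g3, g4⟩ := iso_local_inverse hΘa (by rw [hΘd.fderiv]; exact hB)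
  rw [hΘ0] at g1 g2 g4
  have hGc : Tendsto G (𝓝 0) (𝓝 0) := by
    have := g1.continuousAt.tendsto
    rwa [g2] at this
  have hf : AnalyticAt ℂ (fun x => (G x).2) 0 := analyticAt_snd.fun_comp g1
  have hfd : HasFDerivAt (fun x => (G x).2) ((ContinuousLinearMap.snd ℂ _ _).comp (fderiv ℂ G 0)) 0 :=
    (ContinuousLinearMap.snd ℂ (Fin r → ℂ) (Fin k' → ℂ)).hasFDerivAt.comp (0 : E)
      g1.differentiableAt.hasFDerivAt
  refine ⟨fun x => (G x).2, hf, by simp [g2], ?_, ?_⟩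
  · rw [hfd.fderiv]
    intro y
    have hd : DifferentiableAt ℂ G (Θ 0) := by rw [hΘ0]; exact g1.differentiableAt
    have := iso_comp_id g3 hΘa.differentiableAt hd (0, y)
    rw [hΘ0] at this
    refine ⟨_, congrArg Prod.snd this⟩
  -- the key vanishing
  have key : ∀ b, ∀ᶠ q in 𝓝 (0 : E × E), (G q.1).2 = 0 → φ b q.2 = φ b q.1 → (G q.2).2 = 0 := by
    intro b
    have h0m : (0 : E) ∈ ball (0 : E) R := mem_ball_self h.pos
    obtain ⟨-, g, i1, i2, i3, i4⟩ := h.inv b h0m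
    rw [map_zero] at i1 i2 i4
    obtain ⟨Q, hQ⟩ : ∃ Q : (Fin k → ℂ) × (Fin r → ℂ) → V × (Fin k → ℂ),
      ∀ a, Q a = (φ b (θ a.2), κ b (θ a.2) + a.1) := ⟨_, fun _ => rfl⟩
    have hQ0 : Q 0 = (φ b 0, 0) := by rw [hQ]; simp [t2]
    have hθa : AnalyticAt ℂ (fun a : (Fin k → ℂ) × (Fin r → ℂ) => θ a.2) 0 := by
      have k1 : AnalyticAt ℂ θ (Prod.snd (0 : (Fin k → ℂ) × (Fin r → ℂ))) := t1
      exact k1.fun_comp analyticAt_snd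
    have hφa : AnalyticAt ℂ (φ b) ((fun a : (Fin k → ℂ) × (Fin r → ℂ) => θ a.2) 0) := by
      have := h.an b 0 h0m
      simpa [t2] using this
    have hQa : AnalyticAt ℂ Q 0 := by
      rw [funext hQ]
      exact (AnalyticAt.fun_comp (f := fun a : (Fin k → ℂ) × (Fin r → ℂ) => θ a.2) hφa hθa).prod ((((κ b).analyticAt _).fun_comp hθa).add analyticAt_fst)
    obtain ⟨T, hT⟩ : ∃ T : (Fin k → ℂ) × (Fin r → ℂ) → E, ∀ a, T a = g (Q a) := ⟨_, fun _ => rfl⟩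
    rw [← hQ0] at i1 i2 i4
    have hTa : AnalyticAt ℂ T 0 := by rw [funext hT]; exact i1.fun_comp hQa
    have hT0 : T 0 = 0 := by rw [hT, i2]
    have hTc : Tendsto T (𝓝 0) (𝓝 0) := by
      have := hTa.continuousAt.tendsto
      rwa [hT0] at this
    have hsnd : Tendsto (fun a : (Fin k → ℂ) × (Fin r → ℂ) => a.2) (𝓝 0) (𝓝 0) :=
      continuous_snd.tendsto' _ _ rfl
    have hOrb : ∀ᶠ a in 𝓝 0, IsoOrb φ R (T a) := by
      filter_upwards [hsnd.eventually t4, hTc.eventually (ball_mem_nhds 0 h.pos),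
        hQa.continuousAt.tendsto.eventually i4] with a k1 k2 k3
      refine IsoOrb.step b _ _ k1 k2 ?_
      rw [hT, k3.1, hQ]
    have hrank : ∀ᶠ a in 𝓝 0, Module.finrank ℂ (LinearMap.range
        (fderiv ℂ (fun a => G (T a)) a :
          (Fin k → ℂ) × (Fin r → ℂ) →ₗ[ℂ] (Fin r → ℂ) × (Fin k' → ℂ))) ≤
          Module.finrank ℂ (Fin r → ℂ) := by
      filter_upwards [hOrb.eventually_nhds, hTa.eventually_analyticAt,
        hTc.eventually g1.eventually_analyticAt] with a k1 k2 k3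
      by_contra hcon
      apply hnP
      have hcon' : r + 1 ≤ Module.finrank ℂ (LinearMap.range
        (fderiv ℂ (fun a => G (T a)) a :
          (Fin k → ℂ) × (Fin r → ℂ) →ₗ[ℂ] (Fin r → ℂ) × (Fin k' → ℂ))) := by
        rw [Module.finrank_fin_fun] at hcon
        omega
      obtain ⟨B', hB'⟩ := iso_lift_inj _ _ hcon'
      have hl : AnalyticAt ℂ (fun σ : Fin (r + 1) → ℂ => a + B' σ) 0 :=
        analyticAt_const.add (B'.analyticAt _)
      have hl0 : (fun σ : Fin (r + 1) → ℂ => a + B' σ) 0 = a := by simp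
      have k2' : AnalyticAt ℂ T ((fun σ : Fin (r + 1) → ℂ => a + B' σ) 0) := by rwa [hl0]
      refine ⟨fun σ => T (a + B' σ), AnalyticAt.fun_comp (f := fun σ : Fin (r + 1) → ℂ => a + B' σ) k2' hl, ?_, ?_⟩
      · have hd1 : HasFDerivAt (fun σ : Fin (r + 1) → ℂ => a + B' σ) B' 0 :=
          B'.hasFDerivAt.const_add _
        have hd2 : HasFDerivAt (fun σ => T (a + B' σ)) ((fderiv ℂ T a).comp B') 0 := by
          have := k2'.differentiableAt.hasFDerivAt.comp (0 : Fin (r + 1) → ℂ) hd1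
          rw [hl0] at this
          exact this
        rw [hd2.fderiv]
        have hd3 : fderiv ℂ (fun a => G (T a)) a = (fderiv ℂ G (T a)).comp (fderiv ℂ T a) :=
          fderiv_comp a k3.differentiableAt k2.differentiableAt
        rw [hd3] at hB'
        have hB'' : Function.Injective (⇑(fderiv ℂ G (T a)) ∘ ⇑((fderiv ℂ T a).comp B')) := hB'
        exact Function.Injective.of_comp hB''
      · have hc := hl.continuousAt.tendsto
        rw [show a + B' 0 = a by simp] at hc
        exact hc.eventually k1
    have hGTa : AnalyticAt ℂ (fun a => G (T a)) 0 := by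
      have : AnalyticAt ℂ G (T 0) := by rw [hT0]; exact g1
      exact this.fun_comp hTa
    have hTs : ∀ᶠ s in 𝓝 (0 : Fin r → ℂ), G (T (0, s)) = (s, 0) := by
      have c1 : Tendsto (fun s : Fin r → ℂ => (s, (0 : Fin k' → ℂ))) (𝓝 0) (𝓝 0) :=
        (by fun_prop : Continuous fun s : Fin r → ℂ => (s, (0 : Fin k' → ℂ))).tendsto' _ _ rfl
      have c2 : Tendsto θ (𝓝 0) (𝓝 0) := by
        have := t1.continuousAt.tendsto
        rwa [t2] at this
      filter_upwards [c1.eventually g3, c2.eventually i3] with s k1 k2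
      have : T (0, s) = θ s := by rw [hT, hQ]; simpa using k2
      rw [this]
      rw [hΘ] at k1
      simpa using k1
    have hvan := iso_rank hGTa hTs hrank
    -- conclude
    have c1 : Tendsto (fun q : E × E => q.1) (𝓝 0) (𝓝 0) := continuous_fst.tendsto' _ _ rfl
    have c2 : Tendsto (fun q : E × E => q.2) (𝓝 0) (𝓝 0) := continuous_snd.tendsto' _ _ rfl
    have c3 : Tendsto (fun q : E × E => (κ b q.2 - κ b q.1, (G q.1).1)) (𝓝 0) (𝓝 0) := by
      have d1 : Tendsto (fun q : E × E => κ b q.2 - κ b q.1) (𝓝 0) (𝓝 0) :=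
        (by fun_prop : Continuous (fun q : E × E => κ b q.2 - κ b q.1)).tendsto' _ _ (by simp)
      have d2 : Tendsto (fun q : E × E => (G q.1).1) (𝓝 0) (𝓝 0) :=
        (continuous_fst.tendsto' (0 : (Fin r → ℂ) × (Fin k' → ℂ)) _ rfl).comp (hGc.comp c1)
      exact d1.prodMk_nhds d2
    filter_upwards [c1.eventually g4, c2.eventually i3, c3.eventually hvan] with q k1 k2 k3 e1 e2
    have hx : θ (G q.1).1 = q.1 := by
      rw [hΘ, e1] at k1
      simpa using k1
    have hy : T (κ b q.2 - κ b q.1, (G q.1).1) = q.2 := by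
      rw [hT, hQ]
      simp only [hx]
      rw [← e2, add_sub_cancel]
      exact k2
    rw [hy] at k3
    exact k3
  obtain ⟨η, hη, hb⟩ := Metric.eventually_nhds_iff_ball.1 (eventually_all.2 key)
  refine ⟨η, hη, fun b x hx y hy => hb (x, y) ?_ b⟩
  rw [mem_ball_zero_iff] at *
  rw [Prod.norm_def]
  exact max_lt hx hy

lemma IsoOrb.sub_zero {φ : Bool → E → V} {W : Type*} [Zero W] {η : ℝ} (hη : 0 < η) {f : E → W}
    (f0 : f 0 = 0)
    (h : ∀ b, ∀ x ∈ ball (0 : E) η, ∀ y ∈ ball (0 : E) η, f x = 0 → φ b y = φ b x → f y = 0)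
    {x : E} (hx : IsoOrb φ η x) : f x = 0 := by
  induction hx with
  | zero => exact f0
  | step b x y h1 h2 h3 ih => exact h b x (h1.mem_ball hη) y h2 ih h3

end Geo3

set_option linter.unusedSectionVars false
section Geo4
open Filter Metric Set

lemma iso_pi_surj {𝕜 E : Type*} [Field 𝕜] [AddCommGroup E] [Module 𝕜 E] {n : ℕ}
    (l : Fin n → E →ₗ[𝕜] 𝕜) :
    LinearIndependent 𝕜 l ↔ Function.Surjective (LinearMap.pi l : E →ₗ[𝕜] (Fin n → 𝕜)) := by
  constructor
  · intro h
    by_contra hns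
    rw [← LinearMap.range_eq_top] at hns
    obtain ⟨f, f0, hf⟩ := Submodule.exists_le_ker_of_lt_top _ (lt_top_iff_ne_top.2 hns)
    apply f0
    have h1 : ∑ j, f (Pi.single j 1) • l j = 0 := by
      ext v
      have h2 : f (LinearMap.pi l v) = 0 := hf ⟨v, rfl⟩
      rw [LinearMap.pi_apply_eq_sum_univ f] at h2
      have h4 : ∀ i : Fin n, (fun j => if i = j then (1 : 𝕜) else 0) = Pi.single i 1 := by
        intro i; funext j; simp [Pi.single_apply, eq_comm]
      simp only [h4] at h2
      simpa [mul_comm] using h2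
    have h3 := Fintype.linearIndependent_iff.1 h _ h1
    apply LinearMap.pi_ext'
    intro j
    ext
    simpa using h3 j
  · intro h
    rw [Fintype.linearIndependent_iff]
    intro c hc j
    obtain ⟨v, hv⟩ := h (Pi.single j 1)
    have h1 := LinearMap.congr_fun hc v
    have h2 : ∀ i, l i v = (Pi.single j 1 : Fin n → 𝕜) i := fun i => congrFun hv i
    simpa [h2, Pi.single_apply] using h1

lemma iso_subfamily {𝕜 E : Type*} [Field 𝕜] [AddCommGroup E] [Module 𝕜 E] {ι : Type} [Finite ι]
    (l : ι → E →ₗ[𝕜] 𝕜) : ∃ (k : ℕ) (e : Fin k → ι), LinearIndependent 𝕜 (fun j => l (e j)) ∧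
      ∀ v, (∀ j, l (e j) v = 0) → ∀ i, l i v = 0 := by
  obtain ⟨κ, a, ha, hs, hl⟩ := exists_linearIndependent' 𝕜 l
  have : Finite κ := Finite.of_injective a ha
  obtain ⟨k, ⟨e⟩⟩ := Finite.exists_equiv_fin κ
  refine ⟨k, fun j => a (e.symm j), hl.comp _ e.symm.injective, fun v hv i => ?_⟩
  have h1 : l i ∈ Submodule.span 𝕜 (Set.range (l ∘ a)) := by
    rw [hs]; exact Submodule.subset_span ⟨i, rfl⟩
  have h2 : Submodule.span 𝕜 (Set.range (l ∘ a)) ≤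
      LinearMap.ker (LinearMap.applyₗ (R := 𝕜) (M₂ := 𝕜) v) := by
    rw [Submodule.span_le]
    rintro _ ⟨x, rfl⟩
    have := hv (e x)
    simpa using this
  simpa using h2 h1

variable {V : Type*} [NormedAddCommGroup V] [NormedSpace ℂ V] [FiniteDimensional ℂ V] {D : ℕ}

/-- the pair of an analytic map and its conjugate. -/
def isoPair (φ : (Fin D → ℂ) → V) (τ : V →L⋆[ℂ] V) (b : Bool) (x : Fin D → ℂ) : V :=
  if b then φ x else τ (φ (isoStar (Fin D) x))

lemma isoPair_star {φ : (Fin D → ℂ) → V} {τ : V →L⋆[ℂ] V} (hτ : ∀ v, τ (τ v) = v) (b : Bool)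
    (x : Fin D → ℂ) : isoPair φ τ (!b) (isoStar (Fin D) x) = τ (isoPair φ τ b x) := by
  cases b <;> simp [isoPair, hτ]

lemma isoOrb_star {φ : (Fin D → ℂ) → V} {τ : V →L⋆[ℂ] V} (hτ : ∀ v, τ (τ v) = v) {η : ℝ}
    {x : Fin D → ℂ} (h : IsoOrb (isoPair φ τ) η x) : IsoOrb (isoPair φ τ) η (isoStar (Fin D) x) := by
  induction h with
  | zero => rw [map_zero]; exact IsoOrb.zero
  | step b x y h1 h2 h3 ih =>
    refine IsoOrb.step (!b) _ _ ih (isoStar_mem_ball.2 h2) ?_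
    rw [isoPair_star hτ, isoPair_star hτ, h3]

lemma isoPair_analytic {φ : (Fin D → ℂ) → V} (τ : V →L⋆[ℂ] V) (ha : AnalyticAt ℂ φ 0) (b : Bool) :
    AnalyticAt ℂ (isoPair φ τ b) 0 := by
  have : CompleteSpace V := FiniteDimensional.complete ℂ V
  cases b
  · exact iso_star_analytic τ ha
  · exact ha

lemma isoPair_surj {φ : (Fin D → ℂ) → V} {τ : V →L⋆[ℂ] V} (hτ : ∀ v, τ (τ v) = v)
    (ha : AnalyticAt ℂ φ 0) (hs : Function.Surjective (fderiv ℂ φ 0)) (b : Bool) :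
    Function.Surjective (fderiv ℂ (isoPair φ τ b) 0) := by
  cases b
  · have h0 : HasFDerivAt φ (fderiv ℂ φ 0) (isoStar (Fin D) 0) := by
      rw [map_zero]; exact ha.differentiableAt.hasFDerivAt
    have h1 : HasFDerivAt (isoPair φ τ false) _ 0 := iso_conj_hasFDerivAt (isoStar (Fin D)) τ h0
    rw [h1.fderiv]
    intro v
    obtain ⟨w, hw⟩ := hs (τ v)
    refine ⟨isoStar (Fin D) w, ?_⟩
    change τ (fderiv ℂ φ 0 (isoStar (Fin D) (isoStar (Fin D) w))) = v
    rw [isoStar_isoStar, hw, hτ]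
  · exact hs

lemma iso_geo {φ : (Fin D → ℂ) → V} {τ : V →L⋆[ℂ] V} (hτ : ∀ v, τ (τ v) = v)
    (ha : AnalyticAt ℂ φ 0) (hs : Function.Surjective (fderiv ℂ φ 0)) :
    (∀ η > 0, ∀ᶠ x in 𝓝 0, IsoOrb (isoPair φ τ) η x) ∨
    ∃ k > 0, ∃ f : (Fin D → ℂ) → (Fin k → ℂ), AnalyticAt ℂ f 0 ∧ f 0 = 0 ∧
      Function.Surjective (fderiv ℂ f 0) ∧
      (∀ x, f (isoStar (Fin D) x) = isoStar (Fin k) (f x)) ∧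
      ∀ᶠ y in 𝓝 0, f y = 0 → ∀ w, fderiv ℂ φ y w = 0 → fderiv ℂ f y w = 0 := by
  have hfin : Module.finrank ℂ V ≤ D := by
    have := LinearMap.finrank_le_finrank_of_surjective
      (f := (fderiv ℂ φ 0 : (Fin D → ℂ) →ₗ[ℂ] V)) hs
    simpa using this
  obtain ⟨κ, R, hG⟩ := iso_geo_exists (k := D - Module.finrank ℂ V)
    (fun b => isoPair_analytic τ ha b) (fun b => isoPair_surj hτ ha hs b) (by simp; omega)
  obtain ⟨r, hr1, η0, hη0, hr2⟩ := iso_maximal (isoPair φ τ)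
  have hrD : r ≤ D := by simpa using (hr1 1 one_pos).le
  rcases eq_or_lt_of_le hrD with hrD | hrD
  · left
    intro η hη
    have hm : 0 < min η R := lt_min hη hG.pos
    have h1 : IsoP (isoPair φ τ) (min η R) (Module.finrank ℂ (Fin D → ℂ)) := by
      rw [Module.finrank_fin_fun]
      have := hr1 _ hm
      rwa [show r = D from hrD] at this
    filter_upwards [h1.full (hG.mono hm (min_le_right _ _))] with x hx
    exact hx.mono (min_le_left _ _)
  right
  have hη1 : 0 < min η0 R := lt_min hη0 hG.pos
  obtain ⟨h, ha1, h0, hsurj, η', hη', hinv⟩ := iso_G4 (k' := D - r) (hG.mono hη1 (min_le_right _ _))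
    (hr1 _ hη1) (fun hP => hr2 (hP.mono (min_le_left _ _))) (by simp; omega)
  obtain ⟨η, hηdef⟩ : ∃ η, η = min η' R := ⟨_, rfl⟩
  have hη : 0 < η := hηdef ▸ lt_min hη' hG.pos
  have hηη' : η ≤ η' := hηdef ▸ min_le_left _ _
  have hGη := hG.mono hη (hηdef ▸ min_le_right _ _)
  have hvan : ∀ x, IsoOrb (isoPair φ τ) η x → h x = 0 := fun x hx =>
    IsoOrb.sub_zero hη' h0 hinv (hx.mono hηη')
  obtain ⟨θ, t1, t2, t3, t4⟩ := (hr1 _ hη).center hGη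
  obtain ⟨F, hF1, hF2⟩ : ∃ F : Fin (D - r) ⊕ Fin (D - r) → (Fin D → ℂ) → ℂ,
      (∀ i x, F (Sum.inl i) x = (1 / 2) * (h x i + (starRingEnd ℂ) (h (isoStar _ x) i))) ∧
      (∀ i x, F (Sum.inr i) x = (1 / (2 * I)) * (h x i - (starRingEnd ℂ) (h (isoStar _ x) i))) :=
    ⟨fun s x => Sum.elim (fun i => (1 / 2) * (h x i + (starRingEnd ℂ) (h (isoStar _ x) i)))
      (fun i => (1 / (2 * I)) * (h x i - (starRingEnd ℂ) (h (isoStar _ x) i))) s,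
      fun _ _ => rfl, fun _ _ => rfl⟩
  have hia : ∀ i, AnalyticAt ℂ (fun x => h x i) 0 := fun i =>
    ((ContinuousLinearMap.proj i : (Fin (D - r) → ℂ) →L[ℂ] ℂ).analyticAt _).fun_comp ha1
  have hisa : ∀ i, AnalyticAt ℂ (fun x => (starRingEnd ℂ) (h (isoStar _ x) i)) 0 := fun i =>
    ((ContinuousLinearMap.proj i : (Fin (D - r) → ℂ) →L[ℂ] ℂ).analyticAt _).fun_comp
      (iso_star_analytic (isoStar (Fin (D - r))) ha1)
  have hFa : ∀ s, AnalyticAt ℂ (F s) 0 := by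
    rintro (i | i)
    · rw [funext (hF1 i)]
      exact analyticAt_const.mul ((hia i).add (hisa i))
    · rw [funext (hF2 i)]
      exact analyticAt_const.mul ((hia i).sub (hisa i))
  have hFO : ∀ x, IsoOrb (isoPair φ τ) η x → ∀ s, F s x = 0 := by
    intro x hx
    have e1 := hvan x hx
    have e2 := hvan _ (isoOrb_star hτ hx)
    rintro (i | i)
    · simp [hF1, e1, e2]
    · simp [hF2, e1, e2]
  have h2c : (starRingEnd ℂ) 2 = 2 := Complex.conj_ofNat 2
  have hFs : ∀ s x, F s (isoStar _ x) = (starRingEnd ℂ) (F s x) := by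
    rintro (i | i) x
    · simp [hF1, h2c]; ring
    · simp [hF2, h2c]; ring
  have hFh : ∀ i x, h x i = F (Sum.inl i) x + I * F (Sum.inr i) x := by
    intro i x
    rw [hF1, hF2]
    field_simp
    ring
  obtain ⟨k, e, hli, hker⟩ := iso_subfamily
    (fun s => ((fderiv ℂ (F s) 0 : (Fin D → ℂ) →L[ℂ] ℂ) : (Fin D → ℂ) →ₗ[ℂ] ℂ))
  rw [iso_pi_surj] at hli
  obtain ⟨f, hf⟩ : ∃ f : (Fin D → ℂ) → Fin k → ℂ, ∀ x, f x = fun j => F (e j) x := ⟨_, fun _ => rfl⟩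
  have hfa : AnalyticAt ℂ f 0 := by
    rw [funext hf]
    exact AnalyticAt.pi fun j => hFa _
  have hfd : ∀ v j, fderiv ℂ f 0 v j = fderiv ℂ (F (e j)) 0 v := by
    intro v j
    have : HasFDerivAt f (ContinuousLinearMap.pi fun j => fderiv ℂ (F (e j)) 0) 0 := by
      rw [funext hf]
      exact hasFDerivAt_pi.2 fun j => (hFa _).differentiableAt.hasFDerivAt
    rw [this.fderiv]; rfl
  have hfO : ∀ x, IsoOrb (isoPair φ τ) η x → f x = 0 := by
    intro x hx
    rw [hf]; funext j; exact hFO x hx _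
  have hfsurj : Function.Surjective (fderiv ℂ f 0) := by
    intro a
    obtain ⟨v, hv⟩ := hli a
    refine ⟨v, ?_⟩
    funext j
    rw [hfd]
    exact congrFun hv j
  -- kernels
  have hhθ : ∀ s, fderiv ℂ h 0 (fderiv ℂ θ 0 s) = 0 := by
    intro s
    have e0 : HasFDerivAt h (fderiv ℂ h 0) (θ 0) := by rw [t2]; exact ha1.differentiableAt.hasFDerivAt
    have e1 : HasFDerivAt (fun s => h (θ s)) ((fderiv ℂ h 0).comp (fderiv ℂ θ 0)) 0 :=
      e0.comp 0 t1.differentiableAt.hasFDerivAt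
    have e2 : HasFDerivAt (fun s => h (θ s)) (0 : (Fin r → ℂ) →L[ℂ] _) 0 := by
      refine (hasFDerivAt_const (0 : Fin (D - r) → ℂ) _).congr_of_eventuallyEq ?_
      filter_upwards [t4] with s hs using hvan _ hs
    exact DFunLike.congr_fun (e1.unique e2) s
  have hkr : ∀ v, fderiv ℂ h 0 v = 0 → ∃ s, fderiv ℂ θ 0 s = v := by
    have e1 : LinearMap.range (fderiv ℂ θ 0 : (Fin r → ℂ) →ₗ[ℂ] (Fin D → ℂ)) =
        LinearMap.ker (fderiv ℂ h 0 : (Fin D → ℂ) →ₗ[ℂ] (Fin (D - r) → ℂ)) := by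
      apply Submodule.eq_of_le_of_finrank_eq
      · rintro _ ⟨s, rfl⟩
        exact hhθ s
      · rw [LinearMap.finrank_range_of_inj t3]
        have := LinearMap.finrank_range_add_finrank_ker
          (fderiv ℂ h 0 : (Fin D → ℂ) →ₗ[ℂ] (Fin (D - r) → ℂ))
        rw [LinearMap.range_eq_top.2 hsurj] at this
        simp at this
        simp
        omega
    intro v hv
    have : v ∈ LinearMap.range (fderiv ℂ θ 0 : (Fin r → ℂ) →ₗ[ℂ] (Fin D → ℂ)) := by
      rw [e1]; exact hv
    exact this
  have hfk : ∀ v, fderiv ℂ f 0 v = 0 → ∃ s, fderiv ℂ θ 0 s = v := by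
    intro v hv
    apply hkr
    have e1 := hker v (fun j => by
      have := congrFun hv j
      rw [hfd] at this
      exact this)
    have e2 : ∀ s, fderiv ℂ (F s) 0 v = 0 := e1
    funext i
    have e3 : HasFDerivAt (fun x => h x i) ((ContinuousLinearMap.proj i : (Fin (D - r) → ℂ) →L[ℂ] ℂ).comp
        (fderiv ℂ h 0)) 0 :=
      (ContinuousLinearMap.proj i : (Fin (D - r) → ℂ) →L[ℂ] ℂ).hasFDerivAt.comp (0 : Fin D → ℂ)
        ha1.differentiableAt.hasFDerivAt
    have e4 : HasFDerivAt (fun x => h x i) (fderiv ℂ (F (Sum.inl i)) 0 +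
        I • fderiv ℂ (F (Sum.inr i)) 0) 0 := by
      rw [funext (hFh i)]
      exact (hFa _).differentiableAt.hasFDerivAt.add
        ((hFa _).differentiableAt.hasFDerivAt.const_mul I)
    have e5 := DFunLike.congr_fun (e3.unique e4) v
    simpa [e2] using e5
  have hfθ : ∀ s, fderiv ℂ f 0 (fderiv ℂ θ 0 s) = 0 := by
    intro s
    have e0 : HasFDerivAt f (fderiv ℂ f 0) (θ 0) := by rw [t2]; exact hfa.differentiableAt.hasFDerivAt
    have e1 : HasFDerivAt (fun s => f (θ s)) ((fderiv ℂ f 0).comp (fderiv ℂ θ 0)) 0 :=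
      e0.comp 0 t1.differentiableAt.hasFDerivAt
    have e2 : HasFDerivAt (fun s => f (θ s)) (0 : (Fin r → ℂ) →L[ℂ] _) 0 := by
      refine (hasFDerivAt_const (0 : Fin k → ℂ) _).congr_of_eventuallyEq ?_
      filter_upwards [t4] with s hs using hfO _ hs
    exact DFunLike.congr_fun (e1.unique e2) s
  obtain ⟨lam0, hlam0⟩ := LinearMap.exists_leftInverse_of_injective
    (fderiv ℂ θ 0 : (Fin r → ℂ) →ₗ[ℂ] (Fin D → ℂ)) (LinearMap.ker_eq_bot.2 t3)
  obtain ⟨lam, hlam⟩ : ∃ lam : (Fin D → ℂ) →L[ℂ] (Fin r → ℂ), ∀ s, lam (fderiv ℂ θ 0 s) = s :=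
    ⟨LinearMap.toContinuousLinearMap lam0, fun s => LinearMap.congr_fun hlam0 s⟩
  have hkpos : 0 < k := by
    rcases Nat.eq_zero_or_pos k with rfl | hk
    · exfalso
      have hsu : Function.Surjective (fderiv ℂ θ 0 : (Fin r → ℂ) →ₗ[ℂ] (Fin D → ℂ)) := fun v =>
        hfk v (Subsingleton.elim _ _)
      have := LinearMap.finrank_le_finrank_of_surjective hsu
      simp at this
      omega
    · exact hk
  -- the map (f, lam)
  have hΨa : AnalyticAt ℂ (fun x => (f x, lam x)) 0 := hfa.prod (lam.analyticAt _)
  have hΨd : HasFDerivAt (fun x => (f x, lam x)) ((fderiv ℂ f 0).prod lam) 0 :=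
    hfa.differentiableAt.hasFDerivAt.prodMk lam.hasFDerivAt
  have hΨb : Function.Bijective ((fderiv ℂ f 0).prod lam) := by
    constructor
    · rw [injective_iff_map_eq_zero]
      intro v hv
      obtain ⟨s, rfl⟩ := hfk v (congrArg Prod.fst hv)
      have : lam (fderiv ℂ θ 0 s) = 0 := congrArg Prod.snd hv
      rw [hlam] at this
      rw [this, map_zero]
    · rintro ⟨a, s⟩
      obtain ⟨v, hv⟩ := hfsurj a
      refine ⟨v + fderiv ℂ θ 0 (s - lam v), ?_⟩
      refine Prod.ext ?_ ?_
      · change fderiv ℂ f 0 (v + fderiv ℂ θ 0 (s - lam v)) = a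
        rw [map_add, hfθ, hv, add_zero]
      · change lam (v + fderiv ℂ θ 0 (s - lam v)) = s
        rw [map_add, hlam]; simp
  obtain ⟨GΨ, -, -, gΨ, -⟩ := iso_local_inverse hΨa (by rw [hΨd.fderiv]; exact hΨb)
  have hσa : AnalyticAt ℂ (fun s => lam (θ s)) 0 := (lam.analyticAt _).fun_comp t1
  have hσd : HasFDerivAt (fun s => lam (θ s)) (ContinuousLinearMap.id ℂ _) 0 := by
    have e1 : HasFDerivAt (fun s => lam (θ s)) (lam.comp (fderiv ℂ θ 0)) 0 :=
      lam.hasFDerivAt.comp 0 t1.differentiableAt.hasFDerivAt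
    convert e1 using 1
    ext s : 1
    exact (hlam s).symm
  obtain ⟨σ, s1, s2, -, s4⟩ := iso_local_inverse hσa (by rw [hσd.fderiv]; exact Function.bijective_id)
  rw [t2, map_zero] at s1 s2 s4
  have hθc : Tendsto θ (𝓝 0) (𝓝 0) := by
    have := t1.continuousAt.tendsto
    rwa [t2] at this
  have hσc : Tendsto (fun y => σ (lam y)) (𝓝 0) (𝓝 0) := by
    have := s1.continuousAt.tendsto
    rw [s2] at this
    exact this.comp (lam.continuous.tendsto' _ _ (map_zero _))
  have hOrb : ∀ᶠ y in 𝓝 0, f y = 0 → IsoOrb (isoPair φ τ) η y := by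
    filter_upwards [gΨ, (hθc.comp hσc).eventually gΨ, hσc.eventually t4,
      (lam.continuous.tendsto' 0 0 (map_zero _)).eventually s4] with y k1 k2 k3 k4 hy
    have : y = θ (σ (lam y)) := by
      rw [← k1]
      simp only [Function.comp] at k2
      rw [hfO _ k3, k4] at k2
      rw [hy]
      exact k2.trans (by rw [← hy, k1])
    rw [this]; exact k3
  refine ⟨k, hkpos, f, hfa, ?_, hfsurj, ?_, ?_⟩
  · exact hfO 0 IsoOrb.zero
  · intro x
    funext j
    rw [isoStar_apply, hf, hf]
    exact hFs _ _
  · filter_upwards [hOrb, ball_mem_nhds 0 hη, hfa.eventually_analyticAt] with y k1 k2 k3 hy w hw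
    have ho := k1 hy
    obtain ⟨hd, g, i1, i2, i3, i4⟩ := hGη.inv true k2
    obtain ⟨q, hq⟩ : ∃ q : ℂ → V × (Fin (D - Module.finrank ℂ V) → ℂ), ∀ t,
      q t = (isoPair φ τ true y, κ true y) + t • ((0 : V), κ true w) := ⟨_, fun _ => rfl⟩
    have hq0 : q 0 = (isoPair φ τ true y, κ true y) := by rw [hq]; simp
    have hqd : HasDerivAt q ((0 : V), κ true w) 0 := by
      rw [funext hq]
      have := ((hasDerivAt_id (0 : ℂ)).smul_const ((0 : V), κ true w)).const_add
        (isoPair φ τ true y, κ true y)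
      simpa using this
    rw [← hq0] at i1 i2 i4
    have hgd : HasDerivAt (fun t => g (q t)) (fderiv ℂ g (q 0) ((0 : V), κ true w)) 0 :=
      i1.differentiableAt.hasFDerivAt.comp_hasDerivAt 0 hqd
    have hgw : fderiv ℂ g (q 0) ((0 : V), κ true w) = w := by
      have i1' := i1.differentiableAt
      rw [hq0] at i1' ⊢
      have := iso_comp_id (g := fun z => (isoPair φ τ true z, κ true z)) i3 hd.differentiableAt i1' w
      rw [hd.fderiv] at this
      have hz : fderiv ℂ (isoPair φ τ true) y w = 0 := hw
      have e : ((fderiv ℂ (isoPair φ τ true) y).prod (κ true)) w = ((0 : V), κ true w) := by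
        change (fderiv ℂ (isoPair φ τ true) y w, κ true w) = _
        rw [hz]
      rw [e] at this
      exact this
    rw [hgw] at hgd
    have k3' : HasFDerivAt f (fderiv ℂ f y) (g (q 0)) := by
      rw [i2]; exact k3.differentiableAt.hasFDerivAt
    have hcd : HasDerivAt (fun t => f (g (q t))) (fderiv ℂ f y w) 0 :=
      k3'.comp_hasDerivAt 0 hgd
    have hc0 : HasDerivAt (fun t => f (g (q t))) 0 0 := by
      refine (hasDerivAt_const (0 : ℂ) (0 : Fin k → ℂ)).congr_of_eventuallyEq ?_
      have hcc : ∀ᶠ t in 𝓝 (0 : ℂ), g (q t) ∈ ball (0 : Fin D → ℂ) η :=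
        hgd.continuousAt.tendsto.eventually (isOpen_ball.mem_nhds (by rw [i2]; exact k2))
      filter_upwards [hcc, hqd.continuousAt.tendsto.eventually i4] with t c1 c2
      apply hfO
      refine IsoOrb.step true y _ ho c1 ?_
      rw [c2.1, hq]; simp
    exact hcd.unique hc0

end Geo4

set_option linter.unusedSectionVars false
section Par
open Filter Metric Set

lemma iso_decomp {n : ℕ} (v : Cn n) :
    v = ∑ j, ((v j).re • cbasis j 1 + (v j).im • cbasis j Complex.I) := by
  ext i
  simp [cbasis, Pi.single_apply, Finset.sum_add_distrib]

lemma iso_clm_decomp {n : ℕ} {F : Type*} [NormedAddCommGroup F] [NormedSpace ℝ F]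
    (A : Cn n →L[ℝ] F) (v : Cn n) :
    A v = ∑ j, ((v j).re • A (cbasis j 1) + (v j).im • A (cbasis j Complex.I)) := by
  conv_lhs => rw [iso_decomp v]
  simp

lemma iso_wirt {n : ℕ} (f : Cn n → ℝ) (q v : Cn n) :
    2 * (∑ j, wirtD f q j * v j).re = fderiv ℝ f q v := by
  rw [iso_clm_decomp (fderiv ℝ f q) v, Complex.re_sum, Finset.mul_sum]
  refine Finset.sum_congr rfl fun j _ => ?_
  simp [wirtD]
  ring

/-- conjugate coefficient vector -/
def isoBar {n : ℕ} (a : Fin n → ℂ) : Cn n := WithLp.toLp 2 fun j => (starRingEnd ℂ) (a j)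

lemma iso_wirtbar {n : ℕ} (g : Cn n → ℂ) (q : Cn n) (a : Fin n → ℂ) :
    ∑ j, a j * wirtDBar g q j = (1 / 2 : ℂ) * (fderiv ℝ g q (isoBar a) +
      Complex.I * fderiv ℝ g q (Complex.I • isoBar a)) := by
  rw [iso_clm_decomp (fderiv ℝ g q) (isoBar a), iso_clm_decomp (fderiv ℝ g q) (Complex.I • isoBar a),
    Finset.mul_sum, ← Finset.sum_add_distrib, Finset.mul_sum]
  refine Finset.sum_congr rfl fun j _ => ?_
  simp only [wirtDBar, isoBar, PiLp.smul_apply, smul_eq_mul, Complex.real_smul]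
  have h1 : (I * (starRingEnd ℂ) (a j)).re = (a j).im := by simp
  have h2 : (I * (starRingEnd ℂ) (a j)).im = (a j).re := by simp
  rw [h1, h2, Complex.conj_re, Complex.conj_im]
  have h3 : a j = (a j).re + (a j).im * I := (Complex.re_add_im _).symm
  rw [h3]
  simp only [Complex.add_re, Complex.add_im, Complex.ofReal_re, Complex.ofReal_im, Complex.mul_re,
    Complex.mul_im, Complex.I_re, Complex.I_im]
  push_cast
  linear_combination ((1 / 2 : ℂ) * (a j).im * fderiv ℝ g q (cbasis j I)) * Complex.I_sq

lemma iso_wirtbarR {n : ℕ} (g : Cn n → ℝ) (q : Cn n) (a : Fin n → ℂ)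
    (h : ∑ j, a j * wirtDBarR g q j = 0) : fderiv ℝ g q (isoBar a) = 0 ∧
      fderiv ℝ g q (Complex.I • isoBar a) = 0 := by
  have key : ∑ j, a j * wirtDBarR g q j = (1 / 2 : ℂ) * ((fderiv ℝ g q (isoBar a) : ℝ) +
      Complex.I * (fderiv ℝ g q (Complex.I • isoBar a) : ℝ)) := by
    rw [iso_clm_decomp (fderiv ℝ g q) (isoBar a),
      iso_clm_decomp (fderiv ℝ g q) (Complex.I • isoBar a)]
    push_cast
    rw [Finset.mul_sum, ← Finset.sum_add_distrib, Finset.mul_sum]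
    refine Finset.sum_congr rfl fun j _ => ?_
    simp only [wirtDBarR, isoBar, PiLp.smul_apply, smul_eq_mul]
    have h1 : (I * (starRingEnd ℂ) (a j)).re = (a j).im := by simp
    have h2 : (I * (starRingEnd ℂ) (a j)).im = (a j).re := by simp
    rw [h1, h2, Complex.conj_re, Complex.conj_im]
    have h3 : a j = (a j).re + (a j).im * I := (Complex.re_add_im _).symm
    rw [h3]
    simp only [Complex.add_re, Complex.add_im, Complex.ofReal_re, Complex.ofReal_im, Complex.mul_re,
      Complex.mul_im, Complex.I_re, Complex.I_im]
    push_cast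
    linear_combination ((1 / 2 : ℂ) * (a j).im * fderiv ℝ g q (cbasis j I)) * Complex.I_sq
  rw [key] at h
  have h4 : ((fderiv ℝ g q (isoBar a) : ℝ) : ℂ) +
      Complex.I * (fderiv ℝ g q (Complex.I • isoBar a) : ℝ) = 0 := by
    rcases mul_eq_zero.1 h with h | h
    · norm_num at h
    · exact h
  have h5 := congrArg Complex.re h4
  have h6 := congrArg Complex.im h4
  simp at h5 h6
  exact ⟨h5, h6⟩

/-- surjectivity from independence of Wirtinger gradients. -/
lemma iso_wirt_solve {n d : ℕ} {ρ : Cn n → Fin d → ℝ} {q : Cn n}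
    (h : LinearIndependent ℂ (fun k : Fin d => wirtD (fun z => ρ z k) q)) (c : Fin d → ℂ) :
    ∃ v : Cn n, ∀ k, fderiv ℝ (fun z => ρ z k) q v = (c k).re ∧
      fderiv ℝ (fun z => ρ z k) q (Complex.I • v) = - (c k).im := by
  obtain ⟨l, hl⟩ : ∃ l : Fin d → (Fin n → ℂ) →ₗ[ℂ] ℂ, ∀ k v,
    l k v = ∑ j, wirtD (fun z => ρ z k) q j * v j :=
    ⟨fun k => ∑ j, wirtD (fun z => ρ z k) q j • LinearMap.proj j, fun k v => by simp⟩
  have hli : LinearIndependent ℂ l := by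
    rw [Fintype.linearIndependent_iff] at h ⊢
    intro g hg
    apply h g
    funext j
    have := LinearMap.congr_fun hg (Pi.single j 1)
    simpa [hl, Pi.single_apply] using this
  obtain ⟨v, hv⟩ := (iso_pi_surj l).1 hli (fun k => c k / 2)
  refine ⟨WithLp.toLp 2 v, fun k => ?_⟩
  have h1 : ∑ j, wirtD (fun z => ρ z k) q j * v j = c k / 2 := by
    rw [← hl]; exact congrFun hv k
  constructor
  · rw [← iso_wirt]
    simp only
    rw [h1]; simp; ring
  · rw [← iso_wirt]
    have h2 : ∑ j, wirtD (fun z => ρ z k) q j * (I • (WithLp.toLp 2 v : Cn n)) j = I * (c k / 2) := by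
      rw [← h1, Finset.mul_sum]
      refine Finset.sum_congr rfl fun j _ => ?_
      simp; ring
    rw [h2]; simp; ring

lemma iso_surj_open {𝕜 E F : Type*} [RCLike 𝕜] [NormedAddCommGroup E] [NormedSpace 𝕜 E]
    [FiniteDimensional 𝕜 E] [NormedAddCommGroup F] [NormedSpace 𝕜 F] [FiniteDimensional 𝕜 F]
    {k : ℕ} (κ : E →L[𝕜] (Fin k → 𝕜)) {f : E → F} {a : E} (ha : AnalyticAt 𝕜 f a)
    (hb : Function.Bijective ((fderiv 𝕜 f a).prod κ)) :
    ∀ᶠ x in 𝓝 a, Function.Bijective ((fderiv 𝕜 f x).prod κ) := by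
  have : CompleteSpace E := FiniteDimensional.complete 𝕜 E
  have : CompleteSpace F := FiniteDimensional.complete 𝕜 F
  let e : E ≃L[𝕜] F × (Fin k → 𝕜) := ContinuousLinearEquiv.ofBijective
    ((fderiv 𝕜 f a).prod κ) (LinearMap.ker_eq_bot.2 hb.1) (LinearMap.range_eq_top.2 hb.2)
  have hn := ContinuousLinearEquiv.nhds e
  have hc : ContinuousAt (fun x => (fderiv 𝕜 f x).prod κ) a := by
    have h2 : ContinuousAt (fderiv 𝕜 f) a := ha.fderiv.continuousAt
    have h3 : Continuous fun A : E →L[𝕜] F => A.prod κ := by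
      have : (fun A : E →L[𝕜] F => A.prod κ) = fun A =>
        (ContinuousLinearMap.inl 𝕜 F (Fin k → 𝕜)).comp A +
          (ContinuousLinearMap.inr 𝕜 F (Fin k → 𝕜)).comp κ := by
        ext A x <;> simp
      rw [this]; fun_prop
    exact h3.continuousAt.comp h2
  filter_upwards [hc.tendsto.eventually hn] with x hx
  obtain ⟨e', he'⟩ := hx
  rw [← he']
  exact e'.bijective

lemma iso_tangent_ker {E F : Type*} [NormedAddCommGroup E] [NormedSpace ℝ E]
    [FiniteDimensional ℝ E] [NormedAddCommGroup F] [NormedSpace ℝ F] [FiniteDimensional ℝ F]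
    {G : E → F} {q : E} (hG : AnalyticAt ℝ G q) (hs : Function.Surjective (fderiv ℝ G q))
    (h0 : G q = 0) {S : Set E} (hS : ∀ᶠ z in 𝓝 q, G z = 0 → z ∈ S) {v : E}
    (hv : fderiv ℝ G q v = 0) : v ∈ tangentConeAt ℝ S q := by
  have : CompleteSpace E := FiniteDimensional.complete ℝ E
  have : CompleteSpace F := FiniteDimensional.complete ℝ F
  have hle : Module.finrank ℝ F ≤ Module.finrank ℝ E :=
    LinearMap.finrank_le_finrank_of_surjective (f := (fderiv ℝ G q : E →ₗ[ℝ] F)) hs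
  obtain ⟨κ, hκ⟩ := iso_complement (fderiv ℝ G q) hs (Module.finrank ℝ E - Module.finrank ℝ F)
    (by omega)
  have ha : AnalyticAt ℝ (fun z => (G z, κ z)) q := hG.prod (κ.analyticAt _)
  have hd : HasFDerivAt (fun z => (G z, κ z)) ((fderiv ℝ G q).prod κ) q :=
    hG.differentiableAt.hasFDerivAt.prodMk κ.hasFDerivAt
  obtain ⟨g, i1, i2, i3, i4⟩ := iso_local_inverse ha (by rw [hd.fderiv]; exact hκ)
  obtain ⟨c, hc⟩ : ∃ c : ℝ → F × (Fin (Module.finrank ℝ E - Module.finrank ℝ F) → ℝ), ∀ t,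
    c t = (G q, κ q) + t • ((0 : F), κ v) := ⟨_, fun _ => rfl⟩
  have hc0 : c 0 = (G q, κ q) := by rw [hc]; simp
  have hcd : HasDerivAt c ((0 : F), κ v) 0 := by
    rw [funext hc]
    have := ((hasDerivAt_id (0 : ℝ)).smul_const ((0 : F), κ v)).const_add (G q, κ q)
    simpa using this
  have hgw : fderiv ℝ g (c 0) ((0 : F), κ v) = v := by
    have i1' := i1.differentiableAt
    rw [hc0]
    have := iso_comp_id (g := fun z => (G z, κ z)) i3 hd.differentiableAt i1' v
    rw [hd.fderiv] at this
    have e : ((fderiv ℝ G q).prod κ) v = ((0 : F), κ v) := by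
      change (fderiv ℝ G q v, κ v) = _
      rw [hv]
    rw [e] at this
    exact this
  rw [← hc0] at i1 i2 i4
  have hgd : HasDerivAt (fun t => g (c t)) (fderiv ℝ g (c 0) ((0 : F), κ v)) 0 :=
    i1.differentiableAt.hasFDerivAt.comp_hasDerivAt 0 hcd
  rw [hgw] at hgd
  have hS' : ∀ᶠ z in 𝓝 (g (c 0)), G z = 0 → z ∈ S := by rw [i2]; exact hS
  have hmem : ∀ᶠ t in 𝓝 (0 : ℝ), g (c t) ∈ S := by
    filter_upwards [hgd.continuousAt.tendsto.eventually hS',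
      hcd.continuousAt.tendsto.eventually i4] with t k1 k2
    apply k1
    have := congrArg Prod.fst k2
    simp only [hc, h0] at this
    rw [hc, h0]
    simpa using this
  have h1 := hgd.hasFDerivAt.hasFDerivWithinAt (s := {t | g (c t) ∈ S})
  have h0 : (1 : ℝ) ∈ tangentConeAt ℝ {t | g (c t) ∈ S} 0 := by
    rw [tangentConeAt_of_mem_nhds hmem]; trivial
  have h2 := HasFDerivWithinAt.mapsTo_tangent_cone h1 h0
  have h3 : ((fun t => g (c t)) '' {t | g (c t) ∈ S}) ⊆ S := by
    rintro _ ⟨t, ht, rfl⟩; exact ht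
  have h4 := tangentConeAt_mono h3 h2
  simp only [i2] at h4
  simpa using h4

end Par

set_option linter.unusedSectionVars false
section Par2
open Filter Metric Set

/-- Complexified local parametrization of a generic submanifold. -/
structure IsoPar {N : ℕ} (M : Set (Cn N)) (dM : ℕ) (p : Cn N) (D : ℕ) (U : Set (Cn N))
    (ρ : Cn N → Fin dM → ℝ) (κ : Cn N →L[ℝ] (Fin D → ℝ)) (φ : (Fin D → ℂ) → Cn N) : Prop where
  hU : IsOpen U
  hp : p ∈ U
  hpM : p ∈ M
  hρ : AnalyticOnNhd ℝ ρ U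
  hM : M ∩ U = {z | z ∈ U ∧ ∀ k, ρ z k = 0}
  hD : D + dM = 2 * N
  hbij : ∀ᶠ q in 𝓝 p, Function.Bijective ((fderiv ℝ ρ q).prod κ)
  hφ : AnalyticAt ℂ φ 0
  hφ0 : φ 0 = p
  hsurj : Function.Surjective (fderiv ℂ φ 0)
  hMφ : ∀ᶠ x in 𝓝 (0 : Fin D → ℝ), φ (isoC _ x) ∈ M ∧ κ (φ (isoC _ x) - p) = x
  hφM : ∀ᶠ q in 𝓝 p, q ∈ M → φ (isoC _ (κ (q - p))) = q
  hker : ∀ᶠ x in 𝓝 (0 : Fin D → ℝ), ∀ v, fderiv ℝ ρ (φ (isoC _ x)) v = 0 →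
    fderiv ℂ φ (isoC _ x) (isoC _ (κ v)) = v

lemma iso_finrank (N : ℕ) : Module.finrank ℝ (Cn N) = 2 * N := by
  rw [← Module.finrank_mul_finrank ℝ ℂ (Cn N), Complex.finrank_real_complex]
  simp

lemma iso_fderiv_pi {E : Type*} [NormedAddCommGroup E] [NormedSpace ℝ E] {d : ℕ}
    {ρ : E → Fin d → ℝ} {q : E} (h : DifferentiableAt ℝ ρ q) (k : Fin d) (v : E) :
    fderiv ℝ (fun z => ρ z k) q v = fderiv ℝ ρ q v k := by
  have := (hasFDerivAt_pi'.1 h.hasFDerivAt) k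
  rw [this.fderiv]; rfl

lemma iso_real_fderiv {D : ℕ} {F : Type*} [NormedAddCommGroup F] [NormedSpace ℂ F]
    {φ : (Fin D → ℂ) → F} {x : Fin D → ℝ} (h : DifferentiableAt ℂ φ (isoC _ x)) :
    HasFDerivAt (fun y => φ (isoC _ y)) (((fderiv ℂ φ (isoC _ x)).restrictScalars ℝ).comp (isoC _)) x :=
  HasFDerivAt.comp (g := φ) x (h.hasFDerivAt.restrictScalars ℝ) (isoC (Fin D)).hasFDerivAt

lemma iso_param {N : ℕ} {M : Set (Cn N)} {dM : ℕ} {p : Cn N} (hM : IsGenericAt M dM p) :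
    ∃ D U ρ κ φ, IsoPar M dM p D U ρ κ φ := by
  obtain ⟨hpM, U, ρ, hU, hpU, hρ', hMU, hli⟩ := hM
  have hρ : AnalyticOnNhd ℝ ρ U := fun z hz => AnalyticAt.pi fun k => hρ' k z hz
  have hρp : ρ p = 0 := by
    have : p ∈ M ∩ U := ⟨hpM, hpU⟩
    rw [hMU] at this
    exact funext this.2
  have hsolve : ∀ c : Fin dM → ℂ, ∃ v, ∀ k, fderiv ℝ ρ p v k = (c k).re ∧
      fderiv ℝ ρ p (I • v) k = -(c k).im := by
    intro c
    obtain ⟨v, hv⟩ := iso_wirt_solve (hli p ⟨hpM, hpU⟩) c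
    refine ⟨v, fun k => ?_⟩
    rw [← iso_fderiv_pi (hρ p hpU).differentiableAt, ← iso_fderiv_pi (hρ p hpU).differentiableAt]
    exact hv k
  have hs : Function.Surjective (fderiv ℝ ρ p) := by
    intro c
    obtain ⟨v, hv⟩ := hsolve (fun k => c k)
    exact ⟨v, funext fun k => by simpa using (hv k).1⟩
  have hle : dM ≤ 2 * N := by
    have := LinearMap.finrank_le_finrank_of_surjective (f := (fderiv ℝ ρ p).toLinearMap) hs
    rw [iso_finrank] at this
    simpa using this
  obtain ⟨D, hD⟩ : ∃ D, D + dM = 2 * N := ⟨2 * N - dM, by omega⟩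
  obtain ⟨κ, hκ⟩ := iso_complement (fderiv ℝ ρ p) hs D (by rw [iso_finrank]; simp; omega)
  obtain ⟨Φ, hΦ⟩ : ∃ Φ : Cn N → (Fin dM → ℝ) × (Fin D → ℝ), ∀ z, Φ z = (ρ z, κ (z - p)) :=
    ⟨_, fun _ => rfl⟩
  have hΦa : ∀ z ∈ U, AnalyticAt ℝ Φ z := by
    intro z hz
    rw [funext hΦ]
    refine (hρ z hz).prod ?_
    exact AnalyticAt.fun_comp (g := κ) (f := fun z => z - p) (κ.analyticAt _) (analyticAt_id.sub analyticAt_const)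
  have hΦd : ∀ z ∈ U, HasFDerivAt Φ ((fderiv ℝ ρ z).prod κ) z := by
    intro z hz
    rw [funext hΦ]
    refine (hρ z hz).differentiableAt.hasFDerivAt.prodMk ?_
    exact HasFDerivAt.comp (g := κ) z κ.hasFDerivAt ((hasFDerivAt_id z).sub_const p)
  have hΦp : Φ p = 0 := by rw [hΦ, hρp]; simp
  obtain ⟨ψ, i1, i2, i3, i4⟩ := iso_local_inverse (hΦa p hpU) (by rw [(hΦd p hpU).fderiv]; exact hκ)
  rw [hΦp] at i1 i2 i4
  have hψa : AnalyticAt ℝ (fun x : Fin D → ℝ => ψ (0, x)) 0 :=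
    AnalyticAt.fun_comp (g := ψ) (f := fun x : Fin D → ℝ => ((0 : Fin dM → ℝ), x)) i1
      (analyticAt_const.prod analyticAt_id)
  obtain ⟨φ, hφ, hφr⟩ := iso_complexify hψa
  simp only [map_zero] at hφ
  have hφ0 : φ 0 = p := by
    have := hφr.self_of_nhds
    simp only [map_zero] at this
    rw [this]; exact i2
  have tφ : Tendsto (fun x : Fin D → ℝ => φ (isoC _ x)) (𝓝 0) (𝓝 p) := by
    have h1 : ContinuousAt φ (isoC _ (0 : Fin D → ℝ)) := by rw [map_zero]; exact hφ.continuousAt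
    have h2 : ContinuousAt (fun x : Fin D → ℝ => φ (isoC _ x)) 0 :=
      ContinuousAt.comp h1 (isoC (Fin D)).continuous.continuousAt
    have := h2.tendsto
    simpa [hφ0] using this
  have tz : Tendsto (fun x : Fin D → ℝ => ((0 : Fin dM → ℝ), x)) (𝓝 0) (𝓝 0) :=
    (Continuous.prodMk continuous_const continuous_id).tendsto' _ _ rfl
  have hUp : ∀ᶠ q in 𝓝 p, q ∈ U := hU.mem_nhds hpU
  have hk : ∀ᶠ x in 𝓝 (0 : Fin D → ℝ), φ (isoC _ x) ∈ U ∧ Φ (φ (isoC _ x)) = (0, x) := by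
    filter_upwards [hφr, tφ.eventually hUp, tz.eventually i4] with x h1 h2 h3
    refine ⟨h2, ?_⟩
    rw [h1]; exact h3
  have hker : ∀ᶠ x in 𝓝 (0 : Fin D → ℝ), ∀ v, fderiv ℝ ρ (φ (isoC _ x)) v = 0 →
      fderiv ℂ φ (isoC _ x) (isoC _ (κ v)) = v := by
    filter_upwards [hφr.eventually_nhds, hk, tφ.eventually i3.eventually_nhds,
      tz.eventually i1.eventually_analyticAt, iso_eventually_real hφ.iso_diff] with x h1 h2 h3 h4 h5 v hv
    have e1 := iso_comp_id h3 (hΦd _ h2.1).differentiableAt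
      (by rw [h2.2]; exact h4.differentiableAt) v
    rw [h2.2, (hΦd _ h2.1).fderiv] at e1
    have e2 : ((fderiv ℝ ρ (φ (isoC _ x))).prod κ) v = (0, κ v) := by
      change (fderiv ℝ ρ (φ (isoC _ x)) v, κ v) = _
      rw [hv]
    rw [e2] at e1
    have e3 : HasFDerivAt (fun y : Fin D → ℝ => ψ (0, y))
        ((fderiv ℝ ψ (0, x)).comp ((0 : (Fin D → ℝ) →L[ℝ] (Fin dM → ℝ)).prod (ContinuousLinearMap.id ℝ _))) x :=
      HasFDerivAt.comp (g := ψ) x h4.differentiableAt.hasFDerivAt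
        ((hasFDerivAt_const (0 : Fin dM → ℝ) x).prodMk (hasFDerivAt_id x))
    have e4 := (iso_real_fderiv h5).congr_of_eventuallyEq (f₁ := fun y => ψ (0, y))
      (h1.mono fun y hy => hy.symm)
    have e5 := congrArg (fun A => A (κ v)) (e3.unique e4)
    simp only [ContinuousLinearMap.comp_apply, ContinuousLinearMap.prod_apply,
      ContinuousLinearMap.coe_restrictScalars', _root_.zero_apply,
      ContinuousLinearMap.id_apply] at e5
    rw [← e5]; exact e1
  refine ⟨D, U, ρ, κ, φ, ⟨hU, hpU, hpM, hρ, hMU, hD, iso_surj_open κ (hρ p hpU) hκ, hφ, hφ0, ?_, ?_, ?_,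
    hker⟩⟩
  · intro v
    have hk0 := hker.self_of_nhds
    simp only [map_zero, hφ0] at hk0
    obtain ⟨t, ht⟩ := hsolve (fun k => ((-(fderiv ℝ ρ p (I • v) k) : ℝ) : ℂ) * I)
    have ht1 : fderiv ℝ ρ p t = 0 := funext fun k => by simpa using (ht k).1
    have ht2 : fderiv ℝ ρ p (I • t) = fderiv ℝ ρ p (I • v) := funext fun k => by
      simpa using (ht k).2
    have ht3 : fderiv ℝ ρ p (-(I • v) + I • t) = 0 := by
      rw [map_add, map_neg, ht2]; simp
    refine ⟨isoC _ (κ t) + I • isoC _ (κ (-(I • v) + I • t)), ?_⟩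
    rw [map_add, map_smul, hk0 _ ht1, hk0 _ ht3, smul_add, smul_neg, smul_smul, smul_smul,
      Complex.I_mul_I]
    simp
  · filter_upwards [hk] with x hx
    have h1 := hx.2
    rw [hΦ] at h1
    have h2 : φ (isoC _ x) ∈ M ∩ U := by
      rw [hMU]; exact ⟨hx.1, fun k => congrFun (congrArg Prod.fst h1) k⟩
    exact ⟨h2.1, congrArg Prod.snd h1⟩
  · have tκ : Tendsto (fun q : Cn N => κ (q - p)) (𝓝 p) (𝓝 0) :=
      (κ.continuous.comp (continuous_id.sub continuous_const)).tendsto' _ _ (by simp)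
    filter_upwards [i3, hUp, tκ.eventually hφr] with q h1 h2 h3 hq
    rw [h3]
    have : q ∈ M ∩ U := ⟨hq, h2⟩
    rw [hMU] at this
    rw [hΦ, show ρ q = 0 from funext this.2] at h1
    exact h1

end Par2

set_option linter.unusedSectionVars false
section Orb3
open Filter Metric Set

/-- coordinatewise conjugation on `ℂ^n`. -/
def isoCj (n : ℕ) : Cn n →L⋆[ℂ] Cn n where
  toFun v := WithLp.toLp 2 fun j => (starRingEnd ℂ) (v j)
  map_add' v w := by ext j; simp
  map_smul' c v := by ext j; simp
  cont := by
    refine (PiLp.continuous_toLp 2 _).comp ?_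
    refine continuous_pi fun j => Complex.continuous_conj.comp ?_
    fun_prop

lemma isoCj_apply {n : ℕ} (v : Cn n) (j : Fin n) : isoCj n v j = (starRingEnd ℂ) (v j) := rfl

lemma isoCj_isoCj {n : ℕ} (v : Cn n) : isoCj n (isoCj n v) = v := by
  ext j; simp [isoCj_apply]

lemma isoC_re_im {k : ℕ} {a b : Fin k → ℝ} (c : Fin k → ℝ)
    (h : isoC (Fin k) c = isoC _ a + I • isoC _ b) : c = a ∧ b = 0 := by
  constructor
  · funext i
    have := congrArg Complex.re (congrFun h i)
    simpa [isoC_apply] using this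
  · funext i
    have := congrArg Complex.im (congrFun h i)
    simpa [isoC_apply] using this.symm

lemma iso_real_part {D k : ℕ} {f : (Fin D → ℂ) → (Fin k → ℂ)}
    (hst : ∀ x, f (isoStar (Fin D) x) = isoStar (Fin k) (f x)) :
    ∃ fR : (Fin D → ℝ) → (Fin k → ℝ), (∀ x, isoC _ (fR x) = f (isoC _ x)) ∧
      ∀ x, AnalyticAt ℂ f (isoC _ x) → AnalyticAt ℝ fR x ∧
        ∀ w, isoC _ (fderiv ℝ fR x w) = fderiv ℂ f (isoC _ x) (isoC _ w) := by
  obtain ⟨rp, hrp⟩ : ∃ rp : (Fin k → ℂ) →L[ℝ] (Fin k → ℝ), ∀ v i, rp v i = (v i).re :=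
    ⟨ContinuousLinearMap.pi fun i => Complex.reCLM.comp (ContinuousLinearMap.proj i),
      fun v i => by simp⟩
  have h1 : ∀ x, isoC _ (rp (f (isoC _ x))) = f (isoC _ x) := by
    intro x
    funext i
    have h2 := congrFun (hst (isoC _ x)) i
    rw [isoStar_real, isoStar_apply] at h2
    rw [isoC_apply, hrp]
    exact Complex.conj_eq_iff_re.1 h2.symm
  refine ⟨fun x => rp (f (isoC _ x)), h1, fun x hx => ⟨?_, fun w => ?_⟩⟩
  · have h3 : AnalyticAt ℝ (fun x => f (isoC _ x)) x :=
      AnalyticAt.fun_comp (g := f) (f := fun x => isoC _ x) hx.restrictScalars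
        (ContinuousLinearMap.analyticAt (isoC (Fin D)) x)
    exact AnalyticAt.fun_comp (g := rp) (rp.analyticAt _) h3
  · have h3 := iso_real_fderiv hx.differentiableAt
    have h4 : HasFDerivAt (fun x => rp (f (isoC _ x))) _ x :=
      HasFDerivAt.comp (g := rp) x rp.hasFDerivAt h3
    have h5 : HasFDerivAt (fun x => isoC (Fin k) (rp (f (isoC _ x)))) _ x :=
      HasFDerivAt.comp (g := isoC (Fin k)) x (isoC (Fin k)).hasFDerivAt h4
    rw [funext h1] at h5
    have h6 := congrArg (fun A => A w) (h5.unique h3)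
    rw [h4.fderiv]
    exact h6

lemma iso_tangent_le {N d : ℕ} {M U : Set (Cn N)} {ρ : Cn N → Fin d → ℝ} {q : Cn N} (hU : IsOpen U)
    (hq : q ∈ U) (hρ : AnalyticAt ℝ ρ q) (hM : M ∩ U = {z | z ∈ U ∧ ∀ k, ρ z k = 0})
    (hqM : q ∈ M) {v : Cn N} (hv : v ∈ tangentSpaceAt M q) : fderiv ℝ ρ q v = 0 := by
  have h1 : tangentSpaceAt M q ≤ LinearMap.ker (fderiv ℝ ρ q).toLinearMap := by
    refine Submodule.span_le.2 fun u hu => ?_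
    have e1 := hρ.differentiableAt.hasFDerivAt.hasFDerivWithinAt (s := M)
    have e2 : HasFDerivWithinAt ρ (0 : Cn N →L[ℝ] (Fin d → ℝ)) M q := by
      refine (hasFDerivWithinAt_const (0 : Fin d → ℝ) q M).congr_of_eventuallyEq ?_ ?_
      · filter_upwards [self_mem_nhdsWithin, mem_nhdsWithin_of_mem_nhds (hU.mem_nhds hq)] with z h1 h2
        have : z ∈ M ∩ U := ⟨h1, h2⟩
        rw [hM] at this
        exact funext this.2
      · have : q ∈ M ∩ U := ⟨hqM, hq⟩
        rw [hM] at this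
        exact funext this.2
    exact e1.unique_on e2 hu
  exact h1 hv

lemma iso_orb {N : ℕ} {M : Set (Cn N)} {dM : ℕ} {p : Cn N} {D U ρ κ φ}
    (hP : IsoPar M dM p D U ρ κ φ) (hmin : IsMinimalAt M dM p) :
    ∀ η > 0, ∀ᶠ x in 𝓝 0, IsoOrb (isoPair φ (isoCj N)) η x := by
  rcases iso_geo (φ := φ) (τ := isoCj N) isoCj_isoCj hP.hφ hP.hsurj with h | h
  · exact h
  exfalso
  obtain ⟨k, hk, f, fa, f0, fs, fst, ft⟩ := h
  obtain ⟨fR, hfR, hfRa⟩ := iso_real_part fst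
  have fa' : AnalyticAt ℂ f (isoC _ (0 : Fin D → ℝ)) := by rw [map_zero]; exact fa
  have hs0 : Function.Surjective (fderiv ℝ fR 0) := by
    intro c
    obtain ⟨w, hw⟩ := fs (isoC _ c)
    have hw' : w = isoC _ (fun i => (w i).re) + I • isoC _ (fun i => (w i).im) := by
      funext i
      simp [isoC_apply, mul_comm I]
    rw [hw', map_add, map_smul] at hw
    have h0 := (hfRa 0 fa').2
    simp only [map_zero] at h0
    rw [← h0, ← h0] at hw
    exact ⟨_, (isoC_re_im _ hw.symm).1.symm⟩
  have hkD : k ≤ D := by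
    have := LinearMap.finrank_le_finrank_of_surjective (f := (fderiv ℝ fR 0).toLinearMap) hs0
    simpa using this
  obtain ⟨G, hG⟩ : ∃ G : Cn N → (Fin dM → ℝ) × (Fin k → ℝ), ∀ z, G z = (ρ z, fR (κ (z - p))) :=
    ⟨_, fun _ => rfl⟩
  have hGa : ∀ z ∈ U, AnalyticAt ℂ f (isoC _ (κ (z - p))) → AnalyticAt ℝ G z ∧
      (AnalyticAt ℝ (fun z => fR (κ (z - p))) z) ∧
      HasFDerivAt (fun z => fR (κ (z - p))) ((fderiv ℝ fR (κ (z - p))).comp κ) z ∧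
      HasFDerivAt G ((fderiv ℝ ρ z).prod ((fderiv ℝ fR (κ (z - p))).comp κ)) z := by
    intro z hz hf
    have h1 : AnalyticAt ℝ (fun z => fR (κ (z - p))) z := by
      refine AnalyticAt.fun_comp (g := fR) (f := fun z => κ (z - p)) (hfRa _ hf).1 ?_
      exact AnalyticAt.fun_comp (g := κ) (f := fun z => z - p) (κ.analyticAt _)
        (analyticAt_id.sub analyticAt_const)
    have h2 : HasFDerivAt (fun z => fR (κ (z - p))) ((fderiv ℝ fR (κ (z - p))).comp κ) z := by
      refine HasFDerivAt.comp (g := fR) z (hfRa _ hf).1.differentiableAt.hasFDerivAt ?_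
      exact HasFDerivAt.comp (g := κ) z κ.hasFDerivAt ((hasFDerivAt_id z).sub_const p)
    rw [funext hG]
    exact ⟨(hP.hρ z hz).prod h1, h1, h2,
      (hP.hρ z hz).differentiableAt.hasFDerivAt.prodMk h2⟩
  have tκ : Tendsto (fun q : Cn N => κ (q - p)) (𝓝 p) (𝓝 0) :=
    (κ.continuous.comp (continuous_id.sub continuous_const)).tendsto' _ _ (by simp)
  have hGp := hGa p hP.hp (by simpa using fa)
  have hGs : Function.Surjective (fderiv ℝ G p) := by
    rw [hGp.2.2.2.fderiv]
    rintro ⟨a, b⟩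
    obtain ⟨x, hx⟩ := hs0 b
    obtain ⟨v, hv⟩ := hP.hbij.self_of_nhds.2 (a, x)
    refine ⟨v, ?_⟩
    have e1 : fderiv ℝ ρ p v = a := congrArg Prod.fst hv
    have e2 : κ v = x := congrArg Prod.snd hv
    change (fderiv ℝ ρ p v, fderiv ℝ fR (κ (p - p)) (κ v)) = _
    rw [e1, e2, sub_self, map_zero, hx]
  have hGs' : ∀ᶠ z in 𝓝 p, Function.Surjective (fderiv ℝ G z) := by
    obtain ⟨κ', hκ'⟩ := iso_complement (fderiv ℝ G p) hGs (D - k) (by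
      rw [iso_finrank]; simp; have := hP.hD; omega)
    filter_upwards [iso_surj_open κ' hGp.1 hκ'] with z hz a
    obtain ⟨v, hv⟩ := hz.2 (a, 0)
    exact ⟨v, congrArg Prod.fst hv⟩
  have hev0 : ∀ᶠ z in 𝓝 p, z ∈ U := hP.hU.mem_nhds hP.hp
  have hev := hev0.and (hGs'.and (hP.hφM.and
    ((tκ.eventually hP.hker).and ((tκ.eventually (iso_eventually_real ft)).and
      (tκ.eventually (iso_eventually_real fa.eventually_analyticAt))))))
  obtain ⟨U0, hU0, hU0o, hpU0⟩ := _root_.eventually_nhds_iff.1 hev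
  have hSM : ∀ q ∈ U0, ρ q = 0 → q ∈ M := by
    intro q hq h0
    have : q ∈ M ∩ U := by
      rw [hP.hM]; exact ⟨(hU0 q hq).1, fun k => congrFun h0 k⟩
    exact this.1
  have hMρ : ∀ q ∈ U0, q ∈ M → ρ q = 0 := by
    intro q hq h0
    have : q ∈ M ∩ U := ⟨h0, (hU0 q hq).1⟩
    rw [hP.hM] at this
    exact funext this.2
  refine hmin ⟨{q | q ∈ U0 ∧ ρ q = 0 ∧ fR (κ (q - p)) = 0}, D - k, fun q hq => hSM q hq.1 hq.2.1,
    ⟨hpU0, hMρ p hpU0 hP.hpM, ?_⟩, ?_, ?_, ?_⟩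
  · have := hfR 0
    rw [map_zero, f0] at this
    rw [sub_self, map_zero]
    funext i
    have := congrFun this i
    rw [isoC_apply] at this
    simpa using this
  · have := hP.hD; omega
  · intro q hq
    obtain ⟨g, hg⟩ : ∃ g : Cn N → Fin (dM + k) → ℝ, ∀ z i, g z i =
      Fin.append (ρ z) (fR (κ (z - p))) i := ⟨_, fun _ _ => rfl⟩
    have hgl : ∀ i : Fin dM, (fun z => g z (Fin.castAdd k i)) = fun z => ρ z i := by
      intro i; funext z; rw [hg, Fin.append_left]
    have hgr : ∀ i : Fin k, (fun z => g z (Fin.natAdd dM i)) = fun z => fR (κ (z - p)) i := by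
      intro i; funext z; rw [hg, Fin.append_right]
    refine ⟨dM + k, U0, g, hU0o, hq.1, ?_, ?_, ?_, ?_⟩
    · rw [iso_finrank]; have := hP.hD; omega
    · intro i z hz
      have hz' := hGa z (hU0 z hz).1 (hU0 z hz).2.2.2.2.2
      refine Fin.addCases (fun i => ?_) (fun i => ?_) i
      · rw [hgl]; exact (analyticAt_pi_iff.1 (hP.hρ z (hU0 z hz).1)) i
      · rw [hgr]; exact (analyticAt_pi_iff.1 hz'.2.1) i
    · ext z
      constructor
      · rintro ⟨hz, hz0⟩
        refine ⟨hz0, fun i => ?_⟩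
        refine Fin.addCases (fun i => ?_) (fun i => ?_) i
        · rw [hg, Fin.append_left, hz.2.1]; rfl
        · rw [hg, Fin.append_right, hz.2.2]; rfl
      · rintro ⟨hz0, hz⟩
        refine ⟨⟨hz0, funext fun i => ?_, funext fun i => ?_⟩, hz0⟩
        · have := hz (Fin.castAdd k i); rwa [hg, Fin.append_left] at this
        · have := hz (Fin.natAdd dM i); rwa [hg, Fin.append_right] at this
    · rintro z ⟨-, hz⟩
      have hz' := hGa z (hU0 z hz).1 (hU0 z hz).2.2.2.2.2
      refine LinearIndependent.of_comp (ContinuousLinearMap.coeLM ℝ) ?_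
      refine (iso_pi_surj _).2 fun t => ?_
      obtain ⟨v, hv⟩ := (hU0 z hz).2.1 (fun i => t (Fin.castAdd k i), fun i => t (Fin.natAdd dM i))
      rw [hz'.2.2.2.fderiv] at hv
      refine ⟨v, funext fun i => ?_⟩
      change fderiv ℝ (fun z => g z i) z v = t i
      refine Fin.addCases (fun i => ?_) (fun i => ?_) i
      · rw [hgl, iso_fderiv_pi (hP.hρ z (hU0 z hz).1).differentiableAt]
        exact congrFun (congrArg Prod.fst hv) i
      · rw [hgr, iso_fderiv_pi hz'.2.1.differentiableAt, hz'.2.2.1.fderiv]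
        exact congrFun (congrArg Prod.snd hv) i
  · rintro q hq v ⟨hv, hv2⟩
    obtain ⟨u, hu, huv⟩ := hv2
    have huv' : I • u = v := huv
    obtain ⟨k1, k2, k3, k4, k5, k6⟩ := hU0 q hq.1
    have hqM := hSM q hq.1 hq.2.1
    have hq' := hGa q k1 k6
    have d1 : fderiv ℝ ρ q v = 0 := iso_tangent_le hP.hU k1 (hP.hρ q k1) hP.hM hqM hv
    have d2 : fderiv ℝ ρ q (I • v) = 0 := by
      have : I • v = -u := by rw [← huv', smul_smul, Complex.I_mul_I]; simp
      rw [this, map_neg, iso_tangent_le hP.hU k1 (hP.hρ q k1) hP.hM hqM hu, neg_zero]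
    have hx := k3 hqM
    rw [hx] at k4
    have e1 := k5 (by rw [← hfR, hq.2.2, map_zero])
      (isoC _ (κ v) + I • isoC _ (κ (I • v))) (by
        rw [map_add, map_smul, k4 v d1, k4 _ d2, smul_smul, Complex.I_mul_I]; simp)
    rw [map_add, map_smul, ← (hfRa _ k6).2, ← (hfRa _ k6).2] at e1
    have e2 := isoC_re_im (a := fderiv ℝ fR (κ (q - p)) (κ v))
      (b := fderiv ℝ fR (κ (q - p)) (κ (I • v))) 0 (by
        rw [map_zero (isoC (Fin k))]; exact e1.symm)
    refine Submodule.subset_span (iso_tangent_ker hq'.1 k2 ?_ ?_ ?_)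
    · rw [hG, hq.2.1, hq.2.2]; rfl
    · filter_upwards [hU0o.mem_nhds hq.1] with z hz hz0
      rw [hG] at hz0
      exact ⟨hz, congrArg Prod.fst hz0, congrArg Prod.snd hz0⟩
    · rw [hq'.2.2.2.fderiv]
      change (fderiv ℝ ρ q v, fderiv ℝ fR (κ (q - p)) (κ v)) = 0
      rw [d1, ← e2.1]; rfl

end Orb3

set_option linter.unusedSectionVars false
section CR4
open Filter Metric Set

lemma IsoPar.tendsto_real {N : ℕ} {M : Set (Cn N)} {dM : ℕ} {p : Cn N} {D U ρ κ φ}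
    (hP : IsoPar M dM p D U ρ κ φ) :
    Tendsto (fun x : Fin D → ℝ => φ (isoC _ x)) (𝓝 0) (𝓝 p) := by
  have h1 : ContinuousAt φ (isoC _ (0 : Fin D → ℝ)) := by rw [map_zero]; exact hP.hφ.continuousAt
  have h2 : ContinuousAt (fun x : Fin D → ℝ => φ (isoC _ x)) 0 :=
    ContinuousAt.comp h1 (isoC (Fin D)).continuous.continuousAt
  have := h2.tendsto
  simpa [hP.hφ0] using this

lemma iso_cr_field {N : ℕ} {M : Set (Cn N)} {dM : ℕ} {p : Cn N} {D U ρ κ φ}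
    (hP : IsoPar M dM p D U ρ κ φ) (L : CRVectorField M p) :
    ∃ ξ : (Fin D → ℂ) → (Fin D → ℂ), AnalyticAt ℂ ξ 0 ∧
      (∀ᶠ x in 𝓝 0, fderiv ℂ φ x (ξ x) = 0) ∧
      ∀ᶠ x in 𝓝 (0 : Fin D → ℝ), ∀ (g : Cn N → ℂ) (g' : (Fin D → ℂ) → ℂ),
        DifferentiableAt ℝ g (φ (isoC _ x)) → DifferentiableAt ℂ g' (isoC _ x) →
        (∀ᶠ y in 𝓝 x, g' (isoC _ y) = g (φ (isoC _ y))) →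
        fderiv ℂ g' (isoC _ x) (ξ (isoC _ x)) = L.apply g (φ (isoC _ x)) := by
  obtain ⟨ζ, hζ⟩ : ∃ ζ : Cn N → Cn N, ∀ z, ζ z = isoBar (L.coeff z) := ⟨_, fun _ => rfl⟩
  have hζa : AnalyticAt ℝ ζ p := by
    have h1 : AnalyticAt ℝ (fun z => L.coeff z) p := AnalyticAt.pi fun j => L.analytic j p L.mem
    obtain ⟨b, hb⟩ : ∃ b : (Fin N → ℂ) →ₗ[ℝ] Cn N, ∀ a, b a = isoBar a :=
      ⟨{ toFun := isoBar
         map_add' := fun a c => by ext j; simp [isoBar]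
         map_smul' := fun a c => by ext j; simp [isoBar] }, fun _ => rfl⟩
    have h2 : ζ = fun z => b.toContinuousLinearMap (L.coeff z) := by
      funext z; rw [hζ, ← hb]; rfl
    rw [h2]
    exact AnalyticAt.fun_comp (g := b.toContinuousLinearMap) (ContinuousLinearMap.analyticAt _ _) h1
  obtain ⟨B, hB⟩ : ∃ B : Cn N →L[ℝ] (Fin D → ℂ), ∀ v, B v = (1 / 2 : ℂ) • (isoC _ (κ v) +
      I • isoC _ (κ (I • v))) := by
    refine ⟨LinearMap.toContinuousLinearMap
      { toFun := fun v => (1 / 2 : ℂ) • (isoC _ (κ v) + I • isoC _ (κ (I • v)))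
        map_add' := fun a c => by simp only [smul_add, map_add]; abel
        map_smul' := fun a c => ?_ }, fun _ => rfl⟩
    have : I • a • c = a • I • c := smul_comm _ _ _
    simp only [this, map_smul, smul_add, RingHom.id_apply]
    congr 1
    · exact smul_comm _ _ _
    · rw [smul_comm I a, smul_comm (1 / 2 : ℂ) a]
  have hra : AnalyticAt ℝ (fun x : Fin D → ℝ => B (ζ (φ (isoC _ x)))) 0 := by
    have h1 : AnalyticAt ℝ (fun x : Fin D → ℝ => φ (isoC _ x)) 0 := by
      refine AnalyticAt.fun_comp (g := φ) (f := fun x => isoC (Fin D) x) ?_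
        (ContinuousLinearMap.analyticAt (isoC (Fin D)) 0)
      rw [map_zero]; exact hP.hφ.restrictScalars
    have h2 : AnalyticAt ℝ (fun x : Fin D → ℝ => ζ (φ (isoC _ x))) 0 := by
      refine AnalyticAt.fun_comp (g := ζ) (f := fun x : Fin D → ℝ => φ (isoC _ x)) ?_ h1
      rw [map_zero, hP.hφ0]; exact hζa
    exact AnalyticAt.fun_comp (g := B) (B.analyticAt _) h2
  obtain ⟨ξ, ξa, ξr⟩ := iso_complexify hra
  rw [map_zero] at ξa
  have hker : ∀ᶠ z in 𝓝 p, z ∈ M → fderiv ℝ ρ z (ζ z) = 0 ∧ fderiv ℝ ρ z (I • ζ z) = 0 := by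
    have h1 : ∀ k, ∀ᶠ z in 𝓝 p, z ∈ M → (∑ j, L.coeff z j * wirtDBarR (fun w => ρ w k) z j) = 0 := by
      intro k
      obtain ⟨V, hV, hpV, h⟩ := L.tangent (fun w => ρ w k) U hP.hU hP.hp
        (fun z hz => (analyticAt_pi_iff.1 (hP.hρ z hz)) k) (by
          intro z hz
          rw [hP.hM] at hz
          exact hz.2 k)
      filter_upwards [hV.mem_nhds hpV] with z hz hzM
      exact h z ⟨hzM, hz⟩
    have h0 : ∀ᶠ z in 𝓝 p, z ∈ U := hP.hU.mem_nhds hP.hp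
    filter_upwards [eventually_all.2 h1, h0] with z hz hzU hzM
    have h2 := (hP.hρ z hzU).differentiableAt
    rw [hζ]
    constructor
    · funext k
      rw [← iso_fderiv_pi h2]
      exact (iso_wirtbarR _ _ _ (hz k hzM)).1
    · funext k
      rw [← iso_fderiv_pi h2]
      exact (iso_wirtbarR _ _ _ (hz k hzM)).2
  have hreal : ∀ᶠ x in 𝓝 (0 : Fin D → ℝ),
      fderiv ℂ φ (isoC _ x) (isoC _ (κ (ζ (φ (isoC _ x))))) = ζ (φ (isoC _ x)) ∧
      fderiv ℂ φ (isoC _ x) (isoC _ (κ (I • ζ (φ (isoC _ x))))) = I • ζ (φ (isoC _ x)) := by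
    filter_upwards [hP.hker, hP.hMφ, hP.tendsto_real.eventually hker] with x h1 h2 h3
    exact ⟨h1 _ (h3 h2.1).1, h1 _ (h3 h2.1).2⟩
  refine ⟨ξ, ξa, ?_, ?_⟩
  · refine iso_identity_germ (f := fun x => fderiv ℂ φ x (ξ x)) (g := fun _ => 0) ?_ ?_ ?_
    · filter_upwards [hP.hφ.fderiv.iso_diff, ξa.iso_diff] with x h1 h2
      exact h1.clm_apply h2
    · exact Eventually.of_forall fun x => differentiableAt_const _
    · filter_upwards [hreal, ξr] with x h1 h2
      rw [h2, hB, map_smul, map_add, map_smul, h1.1, h1.2, smul_smul I, Complex.I_mul_I]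
      simp
  · filter_upwards [hreal, ξr, iso_eventually_real hP.hφ.iso_diff] with x h1 h2 h3 g g' hg hg' he
    have key : ∀ w : Fin D → ℝ, fderiv ℂ g' (isoC _ x) (isoC _ w) =
        fderiv ℝ g (φ (isoC _ x)) (fderiv ℂ φ (isoC _ x) (isoC _ w)) := by
      intro w
      have e1 := iso_real_fderiv hg'
      have e2 : HasFDerivAt (fun y => g (φ (isoC _ y))) _ x :=
        HasFDerivAt.comp (g := g) x hg.hasFDerivAt (iso_real_fderiv h3)
      exact congrArg (fun A => A w) (e1.unique (e2.congr_of_eventuallyEq he))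
    rw [h2, hB, map_smul, map_add, map_smul, key, key, h1.1, h1.2]
    rw [CRVectorField.apply, iso_wirtbar, ← hζ]
    rfl

lemma iso_cr_smooth {N : ℕ} {M : Set (Cn N)} {p : Cn N} (L : CRVectorField M p) {g : Cn N → ℂ}
    (hg : ∀ᶠ z in 𝓝 p, ContDiffAt ℝ (⊤ : ℕ∞) g z) :
    ∀ᶠ z in 𝓝 p, ContDiffAt ℝ (⊤ : ℕ∞) (L.apply g) z := by
  have h0 : ∀ᶠ z in 𝓝 p, z ∈ L.dom := L.isOpen.mem_nhds L.mem
  filter_upwards [hg, h0] with z h1 h2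
  unfold CRVectorField.apply
  refine ContDiffAt.sum fun j _ => ?_
  have h3 : ContDiffAt ℝ (⊤ : ℕ∞) (fderiv ℝ g) z := h1.fderiv_right (by simp)
  refine (L.analytic j z h2).contDiffAt.mul ?_
  unfold wirtDBar
  refine contDiffAt_const.mul (ContDiffAt.add ?_ (contDiffAt_const.mul ?_))
  · exact h3.clm_apply contDiffAt_const
  · exact h3.clm_apply contDiffAt_const

lemma iso_cr_list {N : ℕ} {M : Set (Cn N)} {dM : ℕ} {p : Cn N} {D U ρ κ φ}
    (hP : IsoPar M dM p D U ρ κ φ) (Ls : List (CRVectorField M p)) :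
    ∃ ξs : List ((Fin D → ℂ) → (Fin D → ℂ)), (∀ ξ ∈ ξs, AnalyticAt ℂ ξ 0 ∧
      ∀ᶠ x in 𝓝 0, fderiv ℂ φ x (ξ x) = 0) ∧
      ∀ (g : Cn N → ℂ) (g' : (Fin D → ℂ) → ℂ), (∀ᶠ z in 𝓝 p, ContDiffAt ℝ (⊤ : ℕ∞) g z) →
        (∀ᶠ x in 𝓝 0, DifferentiableAt ℂ g' x) →
        (∀ᶠ x in 𝓝 (0 : Fin D → ℝ), g' (isoC _ x) = g (φ (isoC _ x))) →
        (∀ᶠ z in 𝓝 p, ContDiffAt ℝ (⊤ : ℕ∞) (CRApplyList Ls g) z) ∧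
        (∀ᶠ x in 𝓝 0, DifferentiableAt ℂ (isoVops ξs g') x) ∧
        (∀ᶠ x in 𝓝 (0 : Fin D → ℝ), isoVops ξs g' (isoC _ x) = CRApplyList Ls g (φ (isoC _ x))) := by
  induction Ls with
  | nil => exact ⟨[], by simp, fun g g' h1 h2 h3 => ⟨h1, h2, h3⟩⟩
  | cons L Ls ih =>
    obtain ⟨ξs, h1, h2⟩ := ih
    obtain ⟨ξ, a1, a2, a3⟩ := iso_cr_field hP L
    refine ⟨ξ :: ξs, ?_, fun g g' k1 k2 k3 => ?_⟩
    · intro η hη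
      rcases List.mem_cons.1 hη with rfl | h
      · exact ⟨a1, a2⟩
      · exact h1 _ h
    · obtain ⟨b1, b2, b3⟩ := h2 g g' k1 k2 k3
      refine ⟨iso_cr_smooth L b1, ?_, ?_⟩
      · obtain ⟨V, hV, hVo, h0V⟩ := _root_.eventually_nhds_iff.1 (b2.and a1.iso_diff)
        have := isoVop_diff hVo (ξ := ξ) (g := isoVops ξs g')
          (fun x hx => (hV x hx).2.differentiableWithinAt)
          (fun x hx => (hV x hx).1.differentiableWithinAt)
        filter_upwards [hVo.mem_nhds h0V] with x hx
        exact this.differentiableAt (hVo.mem_nhds hx)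
      · filter_upwards [a3, hP.tendsto_real.eventually b1, iso_eventually_real b2,
          b3.eventually_nhds] with x c1 c2 c3 c4
        exact c1 _ _ (c2.differentiableAt (by simp)) c3 c4

end CR4

set_option linter.unusedSectionVars false
section Def5
open Filter Metric Set

lemma iso_extend {N' m d : ℕ} {p' : Cn N'} (D : Deformation N' m d p') {ε₀ : Rm m} (hε₀ : ε₀ ∈ D.X)
    {r : Cn N' → ℝ} (hr : AnalyticAt ℝ r p') (h0 : ∀ᶠ w in 𝓝 p', w ∈ D.Mfib ε₀ → r w = 0) :
    ∃ G : Cn N' × Rm m → ℝ, AnalyticAt ℝ G (p', ε₀) ∧ (∀ᶠ w in 𝓝 p', G (w, ε₀) = r w) ∧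
      ∀ᶠ y in 𝓝 (p', ε₀), (∀ k, D.ρ y.1 y.2 k = 0) → G y = 0 := by
  have hW : ε₀ ∈ D.W := D.X_subset_W hε₀
  have hρ : AnalyticAt ℝ (fun y : Cn N' × Rm m => D.ρ y.1 y.2) (p', ε₀) :=
    AnalyticAt.pi fun k => D.analytic_ρ k _ ⟨D.basept_mem, hW⟩
  have hρ0 : AnalyticAt ℝ (fun w => D.ρ w ε₀) p' :=
    AnalyticAt.fun_comp (g := fun y : Cn N' × Rm m => D.ρ y.1 y.2) (f := fun w => (w, ε₀)) hρ
      (analyticAt_id.prod analyticAt_const)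
  have hs : Function.Surjective (fderiv ℝ (fun w => D.ρ w ε₀) p') := by
    intro c
    obtain ⟨v, hv⟩ := iso_wirt_solve (ρ := fun w => D.ρ w ε₀)
      (D.generic ε₀ hε₀ p' D.basept_mem (D.basept ε₀ hW)) (fun k => (c k : ℂ))
    refine ⟨v, funext fun k => ?_⟩
    rw [← iso_fderiv_pi hρ0.differentiableAt]
    simpa using (hv k).1
  have hle := LinearMap.finrank_le_finrank_of_surjective
    (f := (fderiv ℝ (fun w => D.ρ w ε₀) p').toLinearMap) hs
  obtain ⟨κ, hκ⟩ := iso_complement _ hs (Module.finrank ℝ (Cn N') - Module.finrank ℝ (Fin d → ℝ))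
    (by omega)
  have hκa : AnalyticAt ℝ (fun w => κ (w - p')) p' :=
    AnalyticAt.fun_comp (g := κ) (f := fun z => z - p') (κ.analyticAt _)
        (analyticAt_id.sub analyticAt_const)
  have hd : HasFDerivAt (fun w => (D.ρ w ε₀, κ (w - p')))
      ((fderiv ℝ (fun w => D.ρ w ε₀) p').prod κ) p' :=
    hρ0.differentiableAt.hasFDerivAt.prodMk
      (HasFDerivAt.comp (g := κ) p' κ.hasFDerivAt ((hasFDerivAt_id p').sub_const p'))
  obtain ⟨ψ, i1, i2, i3, i4⟩ := iso_local_inverse (hρ0.prod hκa) (by rw [hd.fderiv]; exact hκ)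
  have hb : D.ρ p' ε₀ = 0 := funext (D.basept ε₀ hW)
  simp only [hb, sub_self, map_zero] at i1 i2 i4
  have hQ : AnalyticAt ℝ (fun y : Cn N' × Rm m => (D.ρ y.1 y.2, κ (y.1 - p'))) (p', ε₀) := by
    refine hρ.prod ?_
    exact AnalyticAt.fun_comp (g := fun w => κ (w - p')) (f := fun y : Cn N' × Rm m => y.1) hκa
      analyticAt_fst
  have hψQ : AnalyticAt ℝ (fun y : Cn N' × Rm m => ψ (D.ρ y.1 y.2, κ (y.1 - p'))) (p', ε₀) := by
    refine AnalyticAt.fun_comp (g := ψ) (f := fun y : Cn N' × Rm m => (D.ρ y.1 y.2, κ (y.1 - p'))) ?_ hQ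
    simp only [hb, sub_self, map_zero]
    exact i1
  have hv0 : ψ (D.ρ p' ε₀, κ (p' - p')) = p' := by
    simp only [hb, sub_self, map_zero]; exact i2
  have tQ : Tendsto (fun y : Cn N' × Rm m => (D.ρ y.1 y.2, κ (y.1 - p'))) (𝓝 (p', ε₀)) (𝓝 (0, 0)) := by
    have := hQ.continuousAt.tendsto
    simpa only [hb, sub_self, map_zero] using this
  have tψ : Tendsto (fun y : Cn N' × Rm m => ψ (D.ρ y.1 y.2, κ (y.1 - p'))) (𝓝 (p', ε₀)) (𝓝 p') := by
    have := hψQ.continuousAt.tendsto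
    simpa only [hv0] using this
  refine ⟨fun y => r (ψ (D.ρ y.1 y.2, κ (y.1 - p'))), ?_, ?_, ?_⟩
  · refine AnalyticAt.fun_comp (g := r) ?_ hψQ
    simp only [hv0]; exact hr
  · filter_upwards [i3] with w hw
    simp only [hw]
  · have hU : ∀ᶠ w in 𝓝 p', w ∈ D.U' := D.isOpen_U'.mem_nhds D.basept_mem
    filter_upwards [tψ.eventually h0, tψ.eventually hU, tQ.eventually i4] with y k1 k2 k3 hy
    refine k1 ⟨k2, fun k => ?_⟩
    have := congrFun (congrArg Prod.fst k3) k
    simp only at this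
    rw [this, hy k]

/-- real parameters as complex ones -/
def isoE (m : ℕ) : Rm m →L[ℝ] (Fin m → ℂ) :=
  (isoC (Fin m)).comp (EuclideanSpace.equiv (Fin m) ℝ : Rm m →L[ℝ] (Fin m → ℝ))

lemma isoE_apply {m : ℕ} (e : Rm m) (i : Fin m) : isoE m e i = (e i : ℂ) := by
  simp [isoE, isoC_apply]

lemma iso_polar {N' m : ℕ} {p' : Cn N'} {ε₀ : Rm m} {G : Cn N' × Rm m → ℝ}
    (hG : AnalyticAt ℝ G (p', ε₀)) :
    ∃ F : Cn N' × Cn N' × (Fin m → ℂ) → ℂ, AnalyticAt ℂ F (p', isoCj N' p', isoE m ε₀) ∧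
      (∀ᶠ y in 𝓝 (p', ε₀), F (y.1, isoCj N' y.1, isoE m y.2) = G y) ∧
      ∀ᶠ w in 𝓝 p', ∀ j, fderiv ℂ F (w, isoCj N' w, isoE m ε₀) (cbasis j 1, 0) =
        wirtD (fun w => G (w, ε₀)) w j := by
  obtain ⟨T, hT1, hT2⟩ : ∃ T : (((Fin N' ⊕ Fin N') ⊕ Fin m) → ℝ) →L[ℝ] Cn N' × Rm m,
      (∀ x j, (T x).1 j = x (.inl (.inl j)) + x (.inl (.inr j)) * I) ∧
      (∀ x k, (T x).2 k = x (.inr k)) := by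
    refine ⟨LinearMap.toContinuousLinearMap
      { toFun := fun x => (WithLp.toLp 2 fun j => ((x (.inl (.inl j)) : ℂ) + x (.inl (.inr j)) * I),
          WithLp.toLp 2 fun k => x (.inr k))
        map_add' := fun a b => ?_
        map_smul' := fun a b => ?_ }, fun x j => rfl, fun x k => rfl⟩
    · refine Prod.ext ?_ ?_
      · ext j; simp; ring
      · ext k; simp
    · refine Prod.ext ?_ ?_
      · ext j; simp; ring
      · ext k; simp
  obtain ⟨C, hC1, hC2, hC3⟩ : ∃ C : Cn N' × Rm m →L[ℝ] (((Fin N' ⊕ Fin N') ⊕ Fin m) → ℝ),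
      (∀ y j, C y (.inl (.inl j)) = (y.1 j).re) ∧ (∀ y j, C y (.inl (.inr j)) = (y.1 j).im) ∧
      (∀ y k, C y (.inr k) = y.2 k) := by
    refine ⟨LinearMap.toContinuousLinearMap
      { toFun := fun y => Sum.elim (Sum.elim (fun j => (y.1 j).re) (fun j => (y.1 j).im))
          (fun k => y.2 k)
        map_add' := fun a b => ?_
        map_smul' := fun a b => ?_ }, fun _ _ => rfl, fun _ _ => rfl, fun _ _ => rfl⟩
    · funext i; rcases i with (i | i) | i <;> simp
    · funext i; rcases i with (i | i) | i <;> simp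
  have hTC : ∀ y, T (C y) = y := by
    intro y
    refine Prod.ext ?_ ?_
    · ext j; rw [hT1, hC1, hC2, Complex.re_add_im]
    · ext k; rw [hT2, hC3]
  obtain ⟨A, hA1, hA2, hA3⟩ : ∃ A : Cn N' × Cn N' × (Fin m → ℂ) →L[ℂ] (((Fin N' ⊕ Fin N') ⊕ Fin m) → ℂ),
      (∀ y j, A y (.inl (.inl j)) = (y.1 j + y.2.1 j) / 2) ∧
      (∀ y j, A y (.inl (.inr j)) = (y.1 j - y.2.1 j) / (2 * I)) ∧
      (∀ y k, A y (.inr k) = y.2.2 k) := by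
    refine ⟨LinearMap.toContinuousLinearMap
      { toFun := fun y => Sum.elim (Sum.elim (fun j => (y.1 j + y.2.1 j) / 2)
          (fun j => (y.1 j - y.2.1 j) / (2 * I))) (fun k => y.2.2 k)
        map_add' := fun a b => ?_
        map_smul' := fun a b => ?_ }, fun _ _ => rfl, fun _ _ => rfl, fun _ _ => rfl⟩
    · funext i; rcases i with (i | i) | i <;> simp <;> ring
    · funext i; rcases i with (i | i) | i <;> simp <;> ring
  have hAC : ∀ y : Cn N' × Rm m, A (y.1, isoCj N' y.1, isoE m y.2) = isoC _ (C y) := by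
    intro y
    funext i
    rcases i with (i | i) | i
    · rw [hA1, isoC_apply, hC1, isoCj_apply]
      simp only
      rw [Complex.re_eq_add_conj]
    · rw [hA2, isoC_apply, hC2, isoCj_apply]
      simp only
      rw [Complex.im_eq_sub_conj]
    · rw [hA3, isoC_apply, hC3]; exact isoE_apply _ _
  have hGT : AnalyticAt ℝ (fun x => (G (T x) : ℂ)) (C (p', ε₀)) := by
    have h1 : AnalyticAt ℝ (fun x => G (T x)) (C (p', ε₀)) := by
      refine AnalyticAt.fun_comp (g := G) (f := fun x => T x) ?_ (T.analyticAt _)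
      simp only [hTC]; exact hG
    exact AnalyticAt.fun_comp (g := Complex.ofRealCLM) (ContinuousLinearMap.analyticAt _ _) h1
  obtain ⟨g, ga, gr⟩ := iso_complexify hGT
  rw [← hAC] at ga
  have hFa : AnalyticAt ℂ (fun y => g (A y)) (p', isoCj N' p', isoE m ε₀) :=
    AnalyticAt.fun_comp (g := g) (f := fun y => A y) ga (A.analyticAt _)
  have hFr : ∀ᶠ y in 𝓝 (p', ε₀), g (A (y.1, isoCj N' y.1, isoE m y.2)) = G y := by
    have tC : Tendsto C (𝓝 (p', ε₀)) (𝓝 (C (p', ε₀))) := C.continuous.tendsto _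
    filter_upwards [tC.eventually gr] with y hy
    rw [hAC, hy, hTC]
  refine ⟨fun y => g (A y), hFa, hFr, ?_⟩
  have tw : Tendsto (fun w : Cn N' => (w, ε₀)) (𝓝 p') (𝓝 (p', ε₀)) :=
    (Continuous.prodMk continuous_id continuous_const).tendsto' _ _ rfl
  have tw2 : Tendsto (fun w : Cn N' => (w, isoCj N' w, isoE m ε₀)) (𝓝 p')
      (𝓝 (p', isoCj N' p', isoE m ε₀)) :=
    (Continuous.prodMk continuous_id
      ((isoCj N').continuous.prodMk continuous_const)).tendsto' _ _ rfl
  filter_upwards [tw.eventually hG.eventually_analyticAt, (tw.eventually hFr).eventually_nhds,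
    tw2.eventually hFa.iso_diff] with w h1 h2 h3 j
  obtain ⟨cR, hcR⟩ : ∃ cR : Cn N' →L[ℝ] Cn N', ∀ v, cR v = isoCj N' v := by
    refine ⟨⟨{ toFun := isoCj N', map_add' := map_add _, map_smul' := fun a b => ?_ },
      (isoCj N').continuous⟩, fun _ => rfl⟩
    ext j; simp [isoCj_apply]
  have key : ∀ v : Cn N', fderiv ℂ (fun y => g (A y)) (w, isoCj N' w, isoE m ε₀) (v, isoCj N' v, 0) =
      (fderiv ℝ (fun w => G (w, ε₀)) w v : ℝ) := by
    intro v
    have e0 : HasFDerivAt (fun w : Cn N' => (w, isoCj N' w, isoE m ε₀))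
        ((ContinuousLinearMap.id ℝ (Cn N')).prod (cR.prod 0)) w := by
      refine (hasFDerivAt_id w).prodMk (HasFDerivAt.prodMk ?_ (hasFDerivAt_const _ _))
      have := cR.hasFDerivAt (x := w)
      rwa [show (cR : Cn N' → Cn N') = fun w => isoCj N' w from funext hcR] at this
    have e1 : HasFDerivAt (fun w : Cn N' => g (A (w, isoCj N' w, isoE m ε₀))) _ w :=
      HasFDerivAt.comp (g := fun y => g (A y)) w (h3.hasFDerivAt.restrictScalars ℝ) e0
    have h4 : DifferentiableAt ℝ (fun w => G (w, ε₀)) w :=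
      DifferentiableAt.comp (g := G) w h1.differentiableAt
        (differentiableAt_id.prodMk (differentiableAt_const _))
    have e2 : HasFDerivAt (fun w => (G (w, ε₀) : ℂ)) _ w :=
      HasFDerivAt.comp (g := Complex.ofRealCLM) w Complex.ofRealCLM.hasFDerivAt h4.hasFDerivAt
    have e3 := congrArg (fun A => A v) (e1.unique (e2.congr_of_eventuallyEq h2))
    rw [← hcR v]
    exact e3
  have hj1 : isoCj N' (cbasis j 1) = cbasis j 1 := by
    ext i; rw [isoCj_apply]; simp [cbasis]
  have hjI : isoCj N' (cbasis j I) = -(I • cbasis j 1) := by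
    ext i; rw [isoCj_apply]; simp [cbasis]
    split_ifs <;> simp
  have hI : (cbasis j I : Cn N') = I • cbasis j 1 := by
    ext i; simp [cbasis]
  unfold wirtD
  rw [← key, ← key, hj1, hjI, hI]
  obtain ⟨B, hB⟩ : ∃ B, B = fderiv ℂ (fun y => g (A y)) (w, isoCj N' w, isoE m ε₀) := ⟨_, rfl⟩
  rw [← hB]
  obtain ⟨e, he⟩ : ∃ e : Cn N', e = cbasis j 1 := ⟨_, rfl⟩
  rw [← he]
  have s1 : B (e, e, 0) = B (e, 0) + B (0, e, 0) := by
    rw [← map_add]; congr 1; simp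
  have s2 : B (I • e, -(I • e), 0) = I * B (e, 0) - I * B (0, e, 0) := by
    rw [← smul_eq_mul, ← smul_eq_mul, ← map_smul, ← map_smul, ← map_sub]; congr 1; simp
  rw [s1, s2]
  linear_combination (1 / 2 : ℂ) * (B (e, 0) - B (0, e, 0)) * Complex.I_sq

end Def5

set_option linter.unusedSectionVars false
section Refl6
open Filter Metric Set

lemma iso_inj_est {E W X : Type*} [NormedAddCommGroup E] [NormedSpace ℂ E]
    [NormedAddCommGroup W] [NormedSpace ℂ W] [FiniteDimensional ℂ W]
    [NormedAddCommGroup X] [NormedSpace ℂ X] {f : E × W → X} {A : E × W →L[ℂ] X} {x0 : E} {w0 : W}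
    (hf : HasStrictFDerivAt f A (x0, w0)) (hA : ∀ e, A (0, e) = 0 → e = 0) :
    ∃ C, 0 ≤ C ∧ ∃ r > 0, ∀ x ∈ ball x0 r, ∀ w ∈ ball w0 r, ∀ w' ∈ ball w0 r,
      ‖w - w'‖ ≤ C * ‖f (x, w) - f (x, w')‖ := by
  obtain ⟨B, hB⟩ : ∃ B : W →L[ℂ] X, ∀ e, B e = A (0, e) :=
    ⟨A.comp (ContinuousLinearMap.inr ℂ E W), fun e => by simp⟩
  have hinj : LinearMap.ker B.toLinearMap = ⊥ := by
    rw [LinearMap.ker_eq_bot']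
    intro e he
    exact hA e (by rw [← hB]; exact he)
  obtain ⟨K, hK, hanti⟩ := B.toLinearMap.exists_antilipschitzWith hinj
  have hK' : (0 : ℝ) < K := by exact_mod_cast hK
  have hb : ∀ e, ‖e‖ ≤ K * ‖B e‖ := by
    intro e
    have := hanti.le_mul_dist e 0
    simpa using this
  have hlo := hf.isLittleO.def (c := 1 / (2 * K)) (by positivity)
  obtain ⟨r, hr, h⟩ := Metric.eventually_nhds_iff_ball.1 hlo
  refine ⟨2 * K, by positivity, r, hr, fun x hx w hw w' hw' => ?_⟩
  have h1 := h ((x, w), (x, w')) (by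
    rw [← ball_prod_same, ← ball_prod_same]
    exact ⟨⟨hx, hw⟩, ⟨hx, hw'⟩⟩)
  simp only [Prod.mk_sub_mk, sub_self] at h1
  rw [← hB] at h1
  have h2 : ‖((0 : E), w - w')‖ = ‖w - w'‖ := by
    rw [Prod.norm_mk, norm_zero, max_eq_right (norm_nonneg _)]
  rw [h2] at h1
  have h3 := hb (w - w')
  have h4 : ‖B (w - w')‖ ≤ ‖f (x, w) - f (x, w')‖ + 1 / (2 * K) * ‖w - w'‖ := by
    have := norm_sub_norm_le (B (w - w')) (f (x, w) - f (x, w'))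
    rw [← norm_neg, neg_sub] at h1
    linarith
  have h5 : (K : ℝ) * ‖B (w - w')‖ ≤ K * (‖f (x, w) - f (x, w')‖ + 1 / (2 * K) * ‖w - w'‖) :=
    mul_le_mul_of_nonneg_left h4 hK'.le
  have h6 : (K : ℝ) * (‖f (x, w) - f (x, w')‖ + 1 / (2 * K) * ‖w - w'‖) =
      K * ‖f (x, w) - f (x, w')‖ + ‖w - w'‖ / 2 := by field_simp
  linarith

lemma iso_graph_freeze {E W : Type*} [NormedAddCommGroup E] [NormedSpace ℂ E]
    [FiniteDimensional ℂ E] [NormedAddCommGroup W] [NormedSpace ℂ W] [FiniteDimensional ℂ W]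
    {U : Set E} {V : Set (E × W)} (hU : IsOpen U) (hV : IsOpen V) (hVU : ∀ y ∈ V, y.1 ∈ U) {h : E → W}
    (hh : DifferentiableOn ℂ h U) (hm : ∀ x ∈ U, (x, h x) ∈ V) {ξs : List (E → E)}
    (hξ : ∀ ξ ∈ ξs, DifferentiableOn ℂ ξ U) (hk : ∀ ξ ∈ ξs, ∀ x ∈ U, fderiv ℂ h x (ξ x) = 0)
    {g : E × W → ℂ} (hg : DifferentiableOn ℂ g V) :
    ∀ x ∈ U, isoVops ξs (fun x => g (x, h x)) x = isoVops (ξs.map (isoLift W)) g (x, h x) := by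
  refine isoVops_comp hU hV (γ := fun x => (x, h x)) (differentiableOn_id.prodMk hh) hm (isoLift W)
    ?_ ?_ hg
  · intro ξ hx x hxU
    have h1 := (hh.differentiableAt (hU.mem_nhds hxU)).hasFDerivAt
    have h2 : HasFDerivAt (fun x => (x, h x)) ((ContinuousLinearMap.id ℂ E).prod (fderiv ℂ h x)) x :=
      (hasFDerivAt_id x).prodMk h1
    rw [h2.fderiv]
    change (ξ x, fderiv ℂ h x (ξ x)) = _
    rw [hk ξ hx x hxU]; rfl
  · intro ξ hx
    exact isoLift_diff (hξ ξ hx) hVU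

lemma iso_cn_sum {n : ℕ} (v : Cn n) : v = ∑ j, v j • (cbasis j 1 : Cn n) := by
  ext i
  simp [cbasis, Pi.single_apply]

lemma iso_reflect {E P : Type*} [NormedAddCommGroup E] [NormedSpace ℂ E]
    [FiniteDimensional ℂ E] [NormedAddCommGroup P] [NormedSpace ℂ P] [FiniteDimensional ℂ P]
    {n' : ℕ} {ι : Type} [Fintype ι] {F : ι → Cn n' × Cn n' × P → ℂ} {h k : E → Cn n'} {e₀ : P}
    {ξs : ι → List (E → E)}
    (hF : ∀ i, AnalyticAt ℂ (F i) (h 0, k 0, e₀)) (hh : ∀ᶠ x in 𝓝 0, DifferentiableAt ℂ h x)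
    (hk : ∀ᶠ x in 𝓝 0, DifferentiableAt ℂ k x)
    (hξ : ∀ i, ∀ ξ ∈ ξs i, AnalyticAt ℂ ξ 0)
    (hξh : ∀ i, ∀ ξ ∈ ξs i, ∀ᶠ x in 𝓝 0, fderiv ℂ h x (ξ x) = 0)
    (hzero : ∀ i, ∀ᶠ x in 𝓝 0, F i (h x, k x, e₀) = 0)
    (hnd : ∀ v : Cn n', (∀ i, ∑ j, v j * isoVops (ξs i)
      (fun x => fderiv ℂ (F i) (h x, k x, e₀) (cbasis j 1, 0)) 0 = 0) → v = 0) :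
    ∃ R > 0, ∀ R0 > 0, R0 ≤ R → ∀ (l : Filter ℕ) (s : ℕ → ℝ) (hn kn : ℕ → E → Cn n') (e : ℕ → P),
      (∀ᶠ n in l, DifferentiableOn ℂ (hn n) (ball 0 R0)) →
      (∀ᶠ n in l, DifferentiableOn ℂ (kn n) (ball 0 R0)) →
      (∀ᶠ n in l, ∀ i, ∀ ξ ∈ ξs i, ∀ x ∈ ball 0 R0, fderiv ℂ (hn n) x (ξ x) = 0) →
      (∀ᶠ n in l, ∀ i, ∀ x ∈ ball 0 R0, F i (hn n x, kn n x, e n) = 0) →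
      (∀ η > 0, ∀ᶠ n in l, ∀ x ∈ ball 0 R0, ‖hn n x - h x‖ < η) →
      (∀ η > 0, ∀ᶠ n in l, ∀ x ∈ ball 0 R0, ‖kn n x - k x‖ < η) →
      (∀ η > 0, ∀ᶠ n in l, ‖e n - e₀‖ < η) → (∀ n, ‖e n - e₀‖ ≤ s n) →
      ∀ x0 ∈ ball (0 : E) R0, IsoUB l s (fun n x => kn n x - k x) x0 →
        IsoUB l s (fun n x => hn n x - h x) x0 := by
  -- Lipschitz and differentiability neighbourhood for `F`
  have hL : ∀ i, ∃ K : NNReal, ∃ t ∈ 𝓝 (h 0, k 0, e₀), LipschitzOnWith K (F i) t := fun i =>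
    ContDiffAt.exists_lipschitzOnWith (𝕂 := ℂ) ((hF i).contDiffAt)
  choose K t ht hKt using hL
  have hFd : ∀ᶠ y in 𝓝 (h 0, k 0, e₀), ∀ i, y ∈ t i ∧ DifferentiableAt ℂ (F i) y :=
    eventually_all.2 fun i => (Filter.Eventually.and (ht i) (hF i).iso_diff)
  obtain ⟨r, hr, hball⟩ := Metric.eventually_nhds_iff_ball.1 hFd
  have hballm : ∀ {a b c}, a ∈ ball (h 0) r → b ∈ ball (k 0) r → c ∈ ball e₀ r →
      ∀ i, (a, b, c) ∈ t i ∧ DifferentiableAt ℂ (F i) (a, b, c) := by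
    intro a b c ha hb hc
    refine hball _ ?_
    rw [← ball_prod_same, ← ball_prod_same]
    exact ⟨ha, hb, hc⟩
  have hcont : ContinuousAt h 0 := hh.self_of_nhds.continuousAt
  have hcontk : ContinuousAt k 0 := hk.self_of_nhds.continuousAt
  have hξ' : ∀ᶠ x in 𝓝 (0 : E), ∀ i, ∀ ξ ∈ ξs i, DifferentiableAt ℂ ξ x ∧ fderiv ℂ h x (ξ x) = 0 := by
    refine eventually_all.2 fun i => ?_
    have := (List.finite_toSet (ξs i)).eventually_all (l := 𝓝 (0 : E))
      (p := fun ξ x => DifferentiableAt ℂ ξ x ∧ fderiv ℂ h x (ξ x) = 0)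
    exact this.2 fun ξ hx => (hξ i ξ hx).iso_diff.and (hξh i ξ hx)
  have hev := (hh.and hk).and (hξ'.and ((eventually_all.2 hzero).and
    ((hcont.tendsto.eventually (ball_mem_nhds (h 0) hr)).and
      (hcontk.tendsto.eventually (ball_mem_nhds (k 0) (half_pos hr))))))
  obtain ⟨R1, hR1, hb1⟩ := Metric.eventually_nhds_iff_ball.1 hev
  -- the limit functions
  obtain ⟨f, hf⟩ : ∃ f : ι → E × Cn n' → ℂ, ∀ i y, f i y = F i (y.2, k y.1, e₀) := ⟨_, fun _ _ => rfl⟩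
  have hVo : ∀ ρ : ℝ, IsOpen (ball (0 : E) ρ ×ˢ ball (h 0) r) := fun ρ => isOpen_ball.prod isOpen_ball
  have hVU : ∀ ρ : ℝ, ∀ y ∈ ball (0 : E) ρ ×ˢ ball (h 0) r, y.1 ∈ ball (0 : E) ρ := fun _ y hy => hy.1
  have he0 : e₀ ∈ ball e₀ r := mem_ball_self hr
  have hfd : ∀ i, DifferentiableOn ℂ (f i) (ball (0 : E) R1 ×ˢ ball (h 0) r) := by
    intro i y hy
    rw [funext (hf i)]
    have h1 := hb1 _ hy.1
    refine DifferentiableAt.differentiableWithinAt ?_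
    refine DifferentiableAt.comp (g := F i) (f := fun y : E × Cn n' => (y.2, k y.1, e₀)) y
      (hballm hy.2 (ball_subset_ball (by linarith) h1.2.2.2.2) he0 i).2 ?_
    refine differentiableAt_snd.prodMk (DifferentiableAt.prodMk ?_ (differentiableAt_const _))
    exact DifferentiableAt.comp (g := k) y h1.1.2 differentiableAt_fst
  have hξd : ∀ i, ∀ ξ ∈ ξs i, DifferentiableOn ℂ ξ (ball (0 : E) R1) := fun i ξ hx x hxb =>
    ((hb1 x hxb).2.1 i ξ hx).1.differentiableWithinAt
  have hξld : ∀ i, ∀ ζ ∈ (ξs i).map (isoLift (Cn n')), DifferentiableOn ℂ ζ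
      (ball (0 : E) R1 ×ˢ ball (h 0) r) := by
    intro i ζ hζ
    obtain ⟨ξ, hx, rfl⟩ := List.mem_map.1 hζ
    exact isoLift_diff (hξd i ξ hx) (hVU R1)
  obtain ⟨𝓔, h𝓔⟩ : ∃ 𝓔 : E × Cn n' → ι → ℂ, ∀ y i, 𝓔 y i =
    isoVops ((ξs i).map (isoLift (Cn n'))) (f i) y := ⟨_, fun _ _ => rfl⟩
  have h𝓔d : DifferentiableOn ℂ 𝓔 (ball (0 : E) R1 ×ˢ ball (h 0) r) := by
    rw [differentiableOn_pi]
    intro i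
    have : (fun y => 𝓔 y i) = isoVops ((ξs i).map (isoLift (Cn n'))) (f i) := funext fun y => h𝓔 y i
    rw [this]
    exact isoVops_diff (hVo R1) (hξld i) (hfd i)
  have hmem0 : ((0 : E), h 0) ∈ ball (0 : E) R1 ×ˢ ball (h 0) r := ⟨mem_ball_self hR1, mem_ball_self hr⟩
  have hstrict : HasStrictFDerivAt 𝓔 (fderiv ℂ 𝓔 (0, h 0)) (0, h 0) :=
    ((iso_contDiffOn (hVo R1) h𝓔d).contDiffAt ((hVo R1).mem_nhds hmem0)).hasStrictFDerivAt (by simp)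
  have hinj : ∀ v, fderiv ℂ 𝓔 (0, h 0) (0, v) = 0 → v = 0 := by
    intro v hv
    refine hnd v fun i => ?_
    have d1 : DifferentiableAt ℂ 𝓔 (0, h 0) := hstrict.hasFDerivAt.differentiableAt
    have d2 : ∀ u, fderiv ℂ (isoVops ((ξs i).map (isoLift (Cn n'))) (f i)) (0, h 0) u =
        fderiv ℂ 𝓔 (0, h 0) u i := by
      intro u
      have := (hasFDerivAt_pi'.1 d1.hasFDerivAt) i
      rw [show (fun y => 𝓔 y i) = isoVops ((ξs i).map (isoLift (Cn n'))) (f i) from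
        funext fun y => h𝓔 y i] at this
      rw [this.fderiv]; rfl
    have d3 : ∀ j, isoVops (ξs i)
        (fun x => fderiv ℂ (F i) (h x, k x, e₀) (cbasis j 1, 0)) 0 =
        fderiv ℂ (isoVops ((ξs i).map (isoLift (Cn n'))) (f i)) (0, h 0) (0, cbasis j 1) := by
      intro j
      have c1 := isoVops_dw isOpen_ball (hVo R1) (hVU R1) (hξd i) (hfd i) (cbasis j 1) hmem0
      simp only at c1
      rw [← c1]
      have hgd : DifferentiableOn ℂ (fun y => fderiv ℂ (f i) y (0, cbasis j 1))
        (ball (0 : E) R1 ×ˢ ball (h 0) r) := iso_diff_dir (hVo R1) (hfd i) _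
      rw [← iso_graph_freeze isOpen_ball (hVo R1) (hVU R1) (h := h)
        (fun x hx => (hb1 x hx).1.1.differentiableWithinAt)
        (fun x hx => ⟨hx, (hb1 x hx).2.2.2.1⟩) (hξd i)
        (fun ξ hξm x hx => ((hb1 x hx).2.1 i ξ hξm).2) hgd 0 (mem_ball_self hR1)]
      refine isoVops_congr (isOpen_ball (x := (0 : E)) (ε := R1)) ?_ (mem_ball_self hR1)
      intro x hx
      have h1 := hb1 x hx
      have e1 : HasFDerivAt (f i) ((fderiv ℂ (F i) (h x, k x, e₀)).comp
          ((ContinuousLinearMap.snd ℂ E (Cn n')).prod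
            (((fderiv ℂ k x).comp (ContinuousLinearMap.fst ℂ E (Cn n'))).prod 0))) (x, h x) := by
        rw [funext (hf i)]
        refine HasFDerivAt.comp (g := F i) (f := fun y : E × Cn n' => (y.2, k y.1, e₀)) (x, h x)
          (hballm h1.2.2.2.1 (ball_subset_ball (by linarith) h1.2.2.2.2) he0 i).2.hasFDerivAt ?_
        refine hasFDerivAt_snd.prodMk (HasFDerivAt.prodMk ?_ (hasFDerivAt_const _ _))
        exact HasFDerivAt.comp (g := k) (x, h x) h1.1.2.hasFDerivAt hasFDerivAt_fst
      simp only
      rw [e1.fderiv]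
      simp
      rfl
    simp only [d3]
    have d4 : (0 : ℂ) = fderiv ℂ (isoVops ((ξs i).map (isoLift (Cn n'))) (f i)) (0, h 0) (0, v) := by
      rw [d2, hv]; rfl
    rw [d4]
    have d5 : ((0 : E), v) = ∑ j, v j • ((0 : E), (cbasis j 1 : Cn n')) := by
      have : ∀ j, v j • ((0 : E), (cbasis j 1 : Cn n')) =
          ContinuousLinearMap.inr ℂ E (Cn n') (v j • cbasis j 1) := by intro j; simp
      simp only [this]
      rw [← map_sum, ← iso_cn_sum]; rfl
    rw [d5, map_sum]
    simp only [map_smul, smul_eq_mul]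
  obtain ⟨C, hC, r1, hr1, hest⟩ := iso_inj_est hstrict hinj
  have hev2 := (hcont.tendsto.eventually (ball_mem_nhds (h 0)
    (half_pos (lt_min hr hr1))))
  obtain ⟨R2, hR2, hb2⟩ := Metric.eventually_nhds_iff_ball.1 hev2
  refine ⟨min (min R1 R2) r1, lt_min (lt_min hR1 hR2) hr1, ?_⟩
  intro R0 hR0 hR0le l s hn kn e c1 c1' c2 c3 c4 c4' c5 c6 x0 hx0 hUB
  have hle1 : R0 ≤ R1 := hR0le.trans ((min_le_left _ _).trans (min_le_left _ _))
  have hle2 : R0 ≤ R2 := hR0le.trans ((min_le_left _ _).trans (min_le_right _ _))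
  have hle3 : R0 ≤ r1 := hR0le.trans (min_le_right _ _)
  have hsub : ball (0 : E) R0 ×ˢ ball (h 0) r ⊆ ball (0 : E) R1 ×ˢ ball (h 0) r :=
    prod_mono (ball_subset_ball hle1) subset_rfl
  have hmin0 : 0 < min r r1 := lt_min hr hr1
  obtain ⟨fn, hfn⟩ : ∃ fn : ℕ → ι → E × Cn n' → ℂ, ∀ n i y, fn n i y = F i (y.2, kn n y.1, e n) :=
    ⟨_, fun _ _ _ => rfl⟩
  -- eventual inclusion facts
  have hin : ∀ᶠ n in l, (∀ x ∈ ball (0 : E) R0, hn n x ∈ ball (h 0) (min r r1)) ∧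
      (∀ x ∈ ball (0 : E) R0, kn n x ∈ ball (k 0) r) ∧ e n ∈ ball e₀ r := by
    filter_upwards [c4 _ (half_pos hmin0), c4' _ (half_pos hr), c5 _ hr] with n a1 a2 a3
    refine ⟨fun x hx => ?_, fun x hx => ?_, by rw [mem_ball_iff_norm]; exact a3⟩
    · have b1 := a1 x hx
      have b2 := hb2 x (ball_subset_ball hle2 hx)
      rw [dist_eq_norm] at b2; rw [mem_ball, dist_eq_norm]
      calc ‖hn n x - h 0‖ = ‖(hn n x - h x) + (h x - h 0)‖ := by congr 1; abel
        _ ≤ _ := norm_add_le _ _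
        _ < _ := by linarith
    · have b1 := a2 x hx
      have b2 := (hb1 x (ball_subset_ball hle1 hx)).2.2.2.2
      rw [dist_eq_norm] at b2; rw [mem_ball, dist_eq_norm]
      calc ‖kn n x - k 0‖ = ‖(kn n x - k x) + (k x - k 0)‖ := by congr 1; abel
        _ ≤ _ := norm_add_le _ _
        _ < _ := by linarith
  have hfnd : ∀ᶠ n in l, ∀ i, DifferentiableOn ℂ (fn n i) (ball (0 : E) R0 ×ˢ ball (h 0) r) := by
    filter_upwards [hin, c1'] with n a1 a2 i y hy
    rw [funext (hfn n i)]
    refine DifferentiableAt.differentiableWithinAt ?_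
    refine DifferentiableAt.comp (g := F i) (f := fun y : E × Cn n' => (y.2, kn n y.1, e n)) y
      (hballm hy.2 (a1.2.1 _ hy.1) a1.2.2 i).2 ?_
    refine differentiableAt_snd.prodMk (DifferentiableAt.prodMk ?_ (differentiableAt_const _))
    exact DifferentiableAt.comp (g := kn n) y (a2.differentiableAt (isOpen_ball.mem_nhds hy.1))
      differentiableAt_fst
  have hx1 : x0 ∈ ball (0 : E) R1 := ball_subset_ball hle1 hx0
  have hy0 : (x0, h x0) ∈ ball (0 : E) R0 ×ˢ ball (h 0) r := ⟨hx0, (hb1 x0 hx1).2.2.2.1⟩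
  -- bound for `fn - f`
  have hdiff : ∀ i, IsoUB l s (fun n y => fn n i y - f i y) (x0, h x0) := by
    intro i
    obtain ⟨C1, V1, hV1, hev1⟩ := hUB
    refine ⟨K i * (|C1| + 1), (V1 ∩ ball 0 R0) ×ˢ ball (h 0) r, ?_, ?_⟩
    · exact prod_mem_nhds (inter_mem hV1 (isOpen_ball.mem_nhds hx0)) (isOpen_ball.mem_nhds hy0.2)
    · filter_upwards [hev1, hin] with n a1 a2 y hy
      simp only [hf, hfn]
      have b1 := (hballm hy.2 (a2.2.1 _ hy.1.2) a2.2.2 i).1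
      have b2 := (hballm hy.2 (ball_subset_ball (by linarith)
        (hb1 _ (ball_subset_ball hle1 hy.1.2)).2.2.2.2) he0 i).1
      have b3 := (hKt i).dist_le_mul _ b1 _ b2
      rw [dist_eq_norm, dist_eq_norm] at b3
      refine b3.trans ?_
      rw [mul_assoc]
      refine mul_le_mul_of_nonneg_left ?_ (K i).coe_nonneg
      have s0 : 0 ≤ s n := (norm_nonneg _).trans (c6 n)
      have b4 := a1 _ hy.1.1
      have b5 : C1 * s n ≤ |C1| * s n := mul_le_mul_of_nonneg_right (le_abs_self _) s0
      have b6 : 0 ≤ |C1| * s n := mul_nonneg (abs_nonneg _) s0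
      simp only [Prod.mk_sub_mk, sub_self, Prod.norm_mk, norm_zero]
      refine max_le (by nlinarith) (max_le (by linarith) (by linarith [c6 n]))
  have hE : ∀ i, IsoUB l s (fun n => isoVops ((ξs i).map (isoLift (Cn n')))
      (fun y => fn n i y - f i y)) (x0, h x0) := by
    intro i
    refine IsoUB.vops (hVo R0) hy0 (fun ζ hζ => (hξld i ζ hζ).mono hsub) ?_ (hdiff i)
    filter_upwards [hfnd] with n a1
    exact (a1 i).sub ((hfd i).mono hsub)
  choose C2 V2 hV2 hev2 using hE
  have hVall : (⋂ i, V2 i) ∈ 𝓝 (x0, h x0) := by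
    rw [iInter_mem]; exact hV2
  obtain ⟨r3, hr3, hb3⟩ := Metric.mem_nhds_iff.1 hVall
  have hcx : ContinuousAt h x0 := (hb1 x0 hx1).1.1.continuousAt
  have hVx : ∀ᶠ x in 𝓝 x0, x ∈ ball x0 r3 ∧ x ∈ ball (0 : E) R0 ∧ h x ∈ ball (h x0) (r3 / 2) :=
    (Filter.Eventually.and (ball_mem_nhds x0 hr3) (Filter.Eventually.and (isOpen_ball.mem_nhds hx0)
      (hcx.tendsto.eventually (ball_mem_nhds (h x0) (half_pos hr3)))))
  refine ⟨C * ∑ i, |C2 i|, _, hVx, ?_⟩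
  filter_upwards [eventually_all.2 hev2, hin, hfnd, c1, c2, c3, c4 _ (half_pos hr3)] with
    n a1 a2 a3 a4 a5 a6 a7 x hx
  have s0 : 0 ≤ s n := (norm_nonneg _).trans (c6 n)
  obtain ⟨hx3, hxR, hxh⟩ := hx
  have hxR1 := ball_subset_ball hle1 hxR
  have w1 := a2.1 x hxR
  have w2 := hb2 x (ball_subset_ball hle2 hxR)
  have w3 := hest x (ball_subset_ball hle3 hxR) (hn n x) (ball_subset_ball (min_le_right _ _) w1)
    (h x) (ball_subset_ball (by linarith [min_le_right r r1]) w2)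
  refine w3.trans ?_
  rw [mul_assoc]
  refine mul_le_mul_of_nonneg_left ?_ hC
  rw [pi_norm_le_iff_of_nonneg (mul_nonneg (Finset.sum_nonneg fun i _ => abs_nonneg _) s0)]
  intro i
  rw [Pi.sub_apply]
  have z1 : 𝓔 (x, h x) i = 0 := by
    rw [h𝓔, ← iso_graph_freeze isOpen_ball (hVo R1) (hVU R1) (h := h)
        (fun x hx => (hb1 x hx).1.1.differentiableWithinAt)
        (fun x hx => ⟨hx, (hb1 x hx).2.2.2.1⟩) (hξd i)
        (fun ξ hξm x hx => ((hb1 x hx).2.1 i ξ hξm).2) (hfd i) x hxR1]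
    refine isoVops_zero (isOpen_ball (x := (0 : E)) (ε := R1)) ?_ hxR1
    intro x' hx'
    simp only [hf]
    exact (hb1 x' hx').2.2.1 i
  have z2 : isoVops ((ξs i).map (isoLift (Cn n'))) (fn n i) (x, hn n x) = 0 := by
    rw [← iso_graph_freeze isOpen_ball (hVo R0) (hVU R0) (h := hn n) a4
        (fun x hx => ⟨hx, ball_subset_ball (min_le_left _ _) (a2.1 x hx)⟩)
        (fun ξ hx => (hξd i ξ hx).mono (ball_subset_ball hle1))
        (a5 i) (a3 i) x hxR]
    refine isoVops_zero (isOpen_ball (x := (0 : E)) (ε := R0)) ?_ hxR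
    intro x' hx'
    simp only [hfn]
    exact a6 i x' hx'
  have z3 := isoVops_sub (hVo R0) (fun ζ hζ => (hξld i ζ hζ).mono hsub) (a3 i) ((hfd i).mono hsub)
    (⟨hxR, ball_subset_ball (min_le_left _ _) w1⟩ : (x, hn n x) ∈ ball (0 : E) R0 ×ˢ ball (h 0) r)
  simp only at z3
  rw [z2, zero_sub] at z3
  have hmem : (x, hn n x) ∈ ball (x0, h x0) r3 := by
    rw [← ball_prod_same]
    refine ⟨hx3, ?_⟩
    have b1 := a7 x hxR
    rw [mem_ball, dist_eq_norm] at hxh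
    rw [mem_ball, dist_eq_norm]
    calc ‖hn n x - h x0‖ = ‖(hn n x - h x) + (h x - h x0)‖ := by congr 1; abel
      _ ≤ _ := norm_add_le _ _
      _ < _ := by linarith
  have z4 := a1 i _ (mem_iInter.1 (hb3 hmem) i)
  rw [z3, norm_neg] at z4
  rw [z1, sub_zero, h𝓔]
  refine z4.trans (mul_le_mul_of_nonneg_right ?_ s0)
  exact (le_abs_self _).trans (Finset.single_le_sum (f := fun i => |C2 i|)
    (fun i _ => abs_nonneg _) (Finset.mem_univ i))

end Refl6

set_option linter.unusedSectionVars false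
section Dat
open Filter Metric Set

lemma iso_wirtD_smooth {n : ℕ} {r : Cn n → ℝ} {q : Cn n} (hr : AnalyticAt ℝ r q) (j : Fin n) :
    ContDiffAt ℝ (⊤ : ℕ∞) (fun w => wirtD r w j) q := by
  have h1 : ContDiffAt ℝ (⊤ : ℕ∞) (fderiv ℝ r) q := hr.fderiv.contDiffAt
  have h2 : ∀ v : Cn n, ContDiffAt ℝ (⊤ : ℕ∞) (fun w => ((fderiv ℝ r w v : ℝ) : ℂ)) q := fun v =>
    Complex.ofRealCLM.contDiff.contDiffAt.comp q (h1.clm_apply contDiffAt_const)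
  unfold wirtD
  exact contDiffAt_const.mul ((h2 _).sub (contDiffAt_const.mul (h2 _)))

lemma iso_datum {N N' m d dM : ℕ} {M : Set (Cn N)} {p : Cn N} {D U ρ κ φ}
    (hP : IsoPar M dM p D U ρ κ φ) {p' : Cn N'} (Df : Deformation N' m d p') {ε₀ : Rm m}
    (hε₀ : ε₀ ∈ Df.X) {H : Cn N → Cn N'} {Ω : Set (Cn N)} (hΩ : IsOpen Ω) (hpΩ : p ∈ Ω)
    (hd : DifferentiableOn ℂ H Ω) (hHp : H p = p') (Ls : List (CRVectorField M p))
    {r : Cn N' → ℝ} (hr : AnalyticAt ℝ r p') (h0 : ∀ᶠ w in 𝓝 p', w ∈ Df.Mfib ε₀ → r w = 0) :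
    ∃ (F : Cn N' × Cn N' × (Fin m → ℂ) → ℂ) (ξs : List ((Fin D → ℂ) → (Fin D → ℂ))),
      AnalyticAt ℂ F (p', isoCj N' p', isoE m ε₀) ∧
      (∀ᶠ y in 𝓝 (p', ε₀), (∀ k, Df.ρ y.1 y.2 k = 0) → F (y.1, isoCj N' y.1, isoE m y.2) = 0) ∧
      (∀ ξ ∈ ξs, AnalyticAt ℂ ξ 0 ∧ ∀ᶠ x in 𝓝 0, fderiv ℂ φ x (ξ x) = 0) ∧
      ∀ j, isoVops ξs (fun x => fderiv ℂ F (H (φ x), isoCj N' (H (φ (isoStar (Fin D) x))), isoE m ε₀)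
        (cbasis j 1, 0)) 0 = CRApplyList Ls (fun z => wirtD r (H z) j) p := by
  obtain ⟨G, hG, hGr, hG0⟩ := iso_extend Df hε₀ hr h0
  obtain ⟨F, hF, hFG, hFw⟩ := iso_polar hG
  obtain ⟨ξs, hξ, hlist⟩ := iso_cr_list hP Ls
  refine ⟨F, ξs, hF, ?_, hξ, fun j => ?_⟩
  · filter_upwards [hFG, hG0] with y a1 a2 a3
    rw [a1, a2 a3]; simp
  have hΩn : ∀ᶠ z in 𝓝 p, z ∈ Ω := hΩ.mem_nhds hpΩ
  have hHc : ContinuousAt H p := (hd.differentiableAt hΩn).continuousAt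
  have hHt : Tendsto H (𝓝 p) (𝓝 p') := by
    have := hHc.tendsto; rwa [hHp] at this
  have hφt : Tendsto φ (𝓝 0) (𝓝 p) := by
    have := hP.hφ.continuousAt.tendsto; rwa [hP.hφ0] at this
  have hHφ : ∀ᶠ x in 𝓝 0, DifferentiableAt ℂ (fun x => H (φ x)) x := by
    filter_upwards [hP.hφ.iso_diff, hφt.eventually hΩn] with x a1 a2
    exact DifferentiableAt.comp (g := H) x (hd.differentiableAt (hΩ.mem_nhds a2)) a1
  obtain ⟨R, hR, hRb⟩ := Metric.eventually_nhds_iff_ball.1 hHφ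
  have hHφd : DifferentiableOn ℂ (fun x => H (φ x)) (ball 0 R) := fun x hx =>
    (hRb x hx).differentiableWithinAt
  have hkd := iso_conj_differentiableOn (isoCj N') hHφd
  have hst : Tendsto (isoStar (Fin D)) (𝓝 0) (𝓝 0) := by
    simpa using (isoStar (Fin D)).continuous.tendsto 0
  have hT : Tendsto (fun x => (H (φ x), isoCj N' (H (φ (isoStar (Fin D) x))), isoE m ε₀)) (𝓝 0)
      (𝓝 (p', isoCj N' p', isoE m ε₀)) := by
    have t1 : Tendsto (fun x => H (φ x)) (𝓝 0) (𝓝 p') := hHt.comp hφt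
    have t2 : Tendsto (fun x => isoCj N' (H (φ (isoStar (Fin D) x)))) (𝓝 0) (𝓝 (isoCj N' p')) :=
      ((isoCj N').continuous.tendsto p').comp (t1.comp hst)
    exact t1.prodMk_nhds (t2.prodMk_nhds tendsto_const_nhds)
  have hRn : ∀ᶠ x in 𝓝 (0 : Fin D → ℂ), x ∈ ball (0 : Fin D → ℂ) R := ball_mem_nhds _ hR
  have key := hlist (fun z => wirtD r (H z) j)
    (fun x => fderiv ℂ F (H (φ x), isoCj N' (H (φ (isoStar (Fin D) x))), isoE m ε₀) (cbasis j 1, 0))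
    ?_ ?_ ?_
  · have k2 := key.2.2.self_of_nhds
    rw [map_zero, hP.hφ0] at k2
    exact k2
  · filter_upwards [hΩn, hHt.eventually hr.eventually_analyticAt] with z a1 a2
    have h1 : ContDiffAt ℝ (⊤ : ℕ∞) H z :=
      ((iso_contDiffOn hΩ hd).contDiffAt (hΩ.mem_nhds a1)).restrict_scalars ℝ
    exact ContDiffAt.comp (g := fun w => wirtD r w j) z (iso_wirtD_smooth a2 j) h1
  · filter_upwards [hT.eventually hF.eventually_analyticAt, hRn] with x a1 a2
    have h1 : DifferentiableAt ℂ (fun x => (H (φ x), isoCj N' (H (φ (isoStar (Fin D) x))), isoE m ε₀)) x :=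
      (hRb x a2).prodMk ((hkd.differentiableAt (isOpen_ball.mem_nhds a2)).prodMk
        (differentiableAt_const _))
    exact (DifferentiableAt.comp (g := fderiv ℂ F) x a1.fderiv.differentiableAt h1).clm_apply
      (differentiableAt_const _)
  · have t1 : Tendsto (fun x : Fin D → ℝ => H (φ (isoC _ x))) (𝓝 0) (𝓝 p') := hHt.comp hP.tendsto_real
    filter_upwards [t1.eventually hFw, t1.eventually hGr.eventually_nhds] with x a1 a2
    simp only [isoStar_real]
    rw [a1 j]
    unfold wirtD
    have : (fun w => G (w, ε₀)) =ᶠ[𝓝 (H (φ (isoC _ x)))] r := a2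
    rw [this.fderiv_eq]

lemma iso_span_sep {n : ℕ} {b : Set (Fin n → ℂ)} (hb : Submodule.span ℂ b = ⊤) {v : Fin n → ℂ}
    (h : ∀ u ∈ b, ∑ j, v j * u j = 0) : v = 0 := by
  obtain ⟨T, hT⟩ : ∃ T : (Fin n → ℂ) →ₗ[ℂ] ℂ, ∀ u, T u = ∑ j, v j * u j :=
    ⟨{ toFun := fun u => ∑ j, v j * u j
       map_add' := fun x y => by simp [mul_add, Finset.sum_add_distrib]
       map_smul' := fun c x => by
        simp only [Pi.smul_apply, smul_eq_mul, RingHom.id_apply, Finset.mul_sum]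
        exact Finset.sum_congr rfl fun j _ => by ring }, fun _ => rfl⟩
  have h1 : Submodule.span ℂ b ≤ LinearMap.ker T := by
    rw [Submodule.span_le]
    intro u hu
    simp only [SetLike.mem_coe, LinearMap.mem_ker, hT]
    exact h u hu
  rw [hb] at h1
  funext j
  have h2 : T (Pi.single j 1) = 0 := h1 (Submodule.mem_top)
  rw [hT] at h2
  simpa [Pi.single_apply] using h2

lemma iso_reflect_data {N N' m d dM ℓ : ℕ} {M : Set (Cn N)} {p : Cn N} {D U ρ κ φ}
    (hP : IsoPar M dM p D U ρ κ φ) {p' : Cn N'} (Df : Deformation N' m d p') {ε₀ : Rm m}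
    (hε₀ : ε₀ ∈ Df.X) {H : Cn N → Cn N'} {Ω : Set (Cn N)} (hΩ : IsOpen Ω) (hpΩ : p ∈ Ω)
    (hd : DifferentiableOn ℂ H Ω) (hHp : H p = p') (hfn : FinNondeg M p (Df.Mfib ε₀) ℓ H) :
    ∃ (ι : Type) (_ : Fintype ι) (F : ι → Cn N' × Cn N' × (Fin m → ℂ) → ℂ)
      (ξs : ι → List ((Fin D → ℂ) → (Fin D → ℂ))),
      (∀ i, AnalyticAt ℂ (F i) (p', isoCj N' p', isoE m ε₀)) ∧
      (∀ᶠ y in 𝓝 (p', ε₀), (∀ k, Df.ρ y.1 y.2 k = 0) →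
        ∀ i, F i (y.1, isoCj N' y.1, isoE m y.2) = 0) ∧
      (∀ i, ∀ ξ ∈ ξs i, AnalyticAt ℂ ξ 0 ∧ ∀ᶠ x in 𝓝 0, fderiv ℂ φ x (ξ x) = 0) ∧
      ∀ v : Cn N', (∀ i, ∑ j, v j * isoVops (ξs i) (fun x => fderiv ℂ (F i)
        (H (φ x), isoCj N' (H (φ (isoStar (Fin D) x))), isoE m ε₀) (cbasis j 1, 0)) 0 = 0) → v = 0 := by
  unfold FinNondeg at hfn
  obtain ⟨b, hbS, hbspan, hbli⟩ := exists_linearIndependent ℂ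
    { v : Fin N' → ℂ | ∃ (Ls : List (CRVectorField M p)) (ρ' : Cn N' → ℝ) (U' : Set (Cn N')),
        Ls.length ≤ ℓ ∧ IsOpen U' ∧ H p ∈ U' ∧ AnalyticOnNhd ℝ ρ' U' ∧
        (∀ w ∈ Df.Mfib ε₀ ∩ U', ρ' w = 0) ∧
        v = fun j => CRApplyList Ls (fun z => wirtD ρ' (H z) j) p }
  rw [hfn] at hbspan
  have hfin : b.Finite := hbli.setFinite
  have key : ∀ i : b, ∃ (F : Cn N' × Cn N' × (Fin m → ℂ) → ℂ) (ξs : List ((Fin D → ℂ) → (Fin D → ℂ))),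
      AnalyticAt ℂ F (p', isoCj N' p', isoE m ε₀) ∧
      (∀ᶠ y in 𝓝 (p', ε₀), (∀ k, Df.ρ y.1 y.2 k = 0) → F (y.1, isoCj N' y.1, isoE m y.2) = 0) ∧
      (∀ ξ ∈ ξs, AnalyticAt ℂ ξ 0 ∧ ∀ᶠ x in 𝓝 0, fderiv ℂ φ x (ξ x) = 0) ∧
      ∀ j, isoVops ξs (fun x => fderiv ℂ F (H (φ x), isoCj N' (H (φ (isoStar (Fin D) x))), isoE m ε₀)
        (cbasis j 1, 0)) 0 = i.1 j := by
    intro i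
    obtain ⟨Ls, r, U', -, hU', hpU', hr, hr0, hi⟩ := hbS i.2
    rw [hHp] at hpU'
    have hU'n : ∀ᶠ w in 𝓝 p', w ∈ U' := hU'.mem_nhds hpU'
    obtain ⟨F, ξs, a1, a2, a3, a4⟩ := iso_datum hP Df hε₀ hΩ hpΩ hd hHp Ls (hr p' hpU')
      (hU'n.mono fun w hw hw' => hr0 w ⟨hw', hw⟩)
    refine ⟨F, ξs, a1, a2, a3, fun j => ?_⟩
    rw [a4 j, hi]
  choose F ξs a1 a2 a3 a4 using key
  have : Fintype b := hfin.fintype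
  refine ⟨b, this, F, ξs, a1, ?_, a3, ?_⟩
  · filter_upwards [eventually_all.2 a2] with y h1 h2 i
    exact h1 i h2
  · intro v hv
    have : (fun j => v j) = 0 := by
      refine iso_span_sep hbspan fun u hu => ?_
      have := hv ⟨u, hu⟩
      simpa only [a4] using this
    ext j
    exact congrFun this j

end Dat

set_option linter.unusedSectionVars false
section Prop15
open Filter Metric Set

lemma isoCj_norm {n : ℕ} (v : Cn n) : ‖isoCj n v‖ = ‖v‖ := by
  simp [EuclideanSpace.norm_eq, isoCj_apply]

lemma isoE_norm_le {m : ℕ} (e : Rm m) : ‖isoE m e‖ ≤ ‖e‖ := by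
  rw [pi_norm_le_iff_of_nonneg (norm_nonneg _)]
  intro i
  rw [isoE_apply, Complex.norm_real]
  exact PiLp.norm_apply_le e i

lemma IsoUB.pull {E E' F : Type*} [TopologicalSpace E] [TopologicalSpace E'] [NormedAddCommGroup F]
    {l : Filter ℕ} {s : ℕ → ℝ} {f : ℕ → E' → F} {φ : E → E'} {x : E} (h : IsoUB l s f (φ x))
    (hc : ContinuousAt φ x) : IsoUB l s (fun n y => f n (φ y)) x := by
  obtain ⟨C, V, hV, hb⟩ := h
  exact ⟨C, φ ⁻¹' V, hc hV, hb.mono fun n hn y hy => hn _ hy⟩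

lemma IsoUB.push {E E' F : Type*} [TopologicalSpace E] [TopologicalSpace E'] [NormedAddCommGroup F]
    {l : Filter ℕ} {s : ℕ → ℝ} {f : ℕ → E' → F} {φ : E → E'} {x : E}
    (h : IsoUB l s (fun n y => f n (φ y)) x) (ho : map φ (𝓝 x) = 𝓝 (φ x)) :
    IsoUB l s f (φ x) := by
  obtain ⟨C, V, hV, hb⟩ := h
  refine ⟨C, φ '' V, ?_, hb.mono ?_⟩
  · rw [← ho]; exact image_mem_map hV
  · rintro n hn _ ⟨y, hy, rfl⟩; exact hn _ hy

lemma iso_zero_near {N N' m d dM : ℕ} {M : Set (Cn N)} {p : Cn N} {D U ρ κ φ}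
    (hP : IsoPar M dM p D U ρ κ φ) {p' : Cn N'} (Df : Deformation N' m d p') {ε₀ : Rm m}
    {H : Cn N → Cn N'} {rK : ℝ} (hrK : 0 < rK)
    (hd : DifferentiableOn ℂ H (ball p rK)) (hHp : H p = p') {ι : Type} [Fintype ι]
    {F : ι → Cn N' × Cn N' × (Fin m → ℂ) → ℂ}
    (hF : ∀ i, AnalyticAt ℂ (F i) (p', isoCj N' p', isoE m ε₀))
    (hF0 : ∀ᶠ y in 𝓝 (p', ε₀), (∀ k, Df.ρ y.1 y.2 k = 0) →
        ∀ i, F i (y.1, isoCj N' y.1, isoE m y.2) = 0) :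
    ∃ R > 0, ∃ η > 0, ∀ (Hn : Cn N → Cn N') (e : Rm m), DifferentiableOn ℂ Hn (ball p rK) →
      (∀ z ∈ M ∩ ball p rK, ∀ k, Df.ρ (Hn z) e k = 0) → (∀ z ∈ ball p rK, ‖Hn z - H z‖ < η) →
      ‖e - ε₀‖ < η → ∀ i, ∀ x ∈ ball (0 : Fin D → ℂ) R,
        F i (Hn (φ x), isoCj N' (Hn (φ (isoStar (Fin D) x))), isoE m e) = 0 := by
  obtain ⟨r1, hr1, hb1⟩ := Metric.eventually_nhds_iff_ball.1 hF0
  obtain ⟨r2, hr2, hb2⟩ := Metric.eventually_nhds_iff_ball.1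
    (eventually_all.2 fun i => (hF i).iso_diff)
  obtain ⟨r, hr, hrr1, hrr2⟩ : ∃ r > 0, r ≤ r1 ∧ r ≤ r2 :=
    ⟨min r1 r2, lt_min hr1 hr2, min_le_left _ _, min_le_right _ _⟩
  have hpn : ∀ᶠ z in 𝓝 p, z ∈ ball p rK := ball_mem_nhds _ hrK
  have hHt : Tendsto H (𝓝 p) (𝓝 p') := by
    have := (hd.differentiableAt hpn).continuousAt.tendsto; rwa [hHp] at this
  have hφt : Tendsto φ (𝓝 0) (𝓝 p) := by
    have := hP.hφ.continuousAt.tendsto; rwa [hP.hφ0] at this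
  have hHb : ∀ᶠ z in 𝓝 p, H z ∈ ball p' (r / 2) := hHt.eventually (ball_mem_nhds _ (half_pos hr))
  obtain ⟨R1, hR1, hc1⟩ := Metric.eventually_nhds_iff_ball.1
    (hP.hφ.iso_diff.and (hφt.eventually (hpn.and hHb)))
  obtain ⟨R2, hR2, hc2⟩ := Metric.eventually_nhds_iff_ball.1 hP.hMφ
  refine ⟨min R1 R2, lt_min hR1 hR2, r / 2, half_pos hr, ?_⟩
  intro Hn e hn hM hclose he i
  have hin : ∀ x ∈ ball (0 : Fin D → ℂ) (min R1 R2), Hn (φ x) ∈ ball p' r := by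
    intro x hx
    have h1 := hc1 x (ball_subset_ball (min_le_left _ _) hx)
    have h2 := hclose _ h1.2.1
    have h3 := h1.2.2
    rw [mem_ball, dist_eq_norm] at h3 ⊢
    calc ‖Hn (φ x) - p'‖ = ‖(Hn (φ x) - H (φ x)) + (H (φ x) - p')‖ := by congr 1; abel
      _ ≤ _ := norm_add_le _ _
      _ < _ := by linarith
  have heb : e ∈ ball ε₀ r := by rw [mem_ball, dist_eq_norm]; linarith
  have hhd : DifferentiableOn ℂ (fun x => Hn (φ x)) (ball 0 (min R1 R2)) := by
    intro x hx
    have h1 := hc1 x (ball_subset_ball (min_le_left _ _) hx)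
    exact (DifferentiableAt.comp (g := Hn) x (hn.differentiableAt (isOpen_ball.mem_nhds h1.2.1))
      h1.1).differentiableWithinAt
  have hkd := iso_conj_differentiableOn (isoCj N') hhd
  refine iso_real_identity (f := fun x => F i (Hn (φ x), isoCj N' (Hn (φ (isoStar (Fin D) x))),
    isoE m e)) ?_ ?_
  · intro x hx
    refine DifferentiableAt.differentiableWithinAt ?_
    have hx' := isOpen_ball.mem_nhds hx
    refine DifferentiableAt.comp (g := F i) x (hb2 _ ?_ i) ((hhd.differentiableAt hx').prodMk
      ((hkd.differentiableAt hx').prodMk (differentiableAt_const _)))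
    rw [← ball_prod_same, ← ball_prod_same]
    refine ⟨ball_subset_ball hrr2 (hin x hx), ?_, ?_⟩
    · have h1 := hin _ (isoStar_mem_ball.2 hx)
      simp only
      rw [mem_ball, dist_eq_norm] at h1 ⊢
      rw [← map_sub, isoCj_norm]
      linarith
    · simp only
      rw [mem_ball, dist_eq_norm] at heb ⊢
      rw [← map_sub]
      exact (isoE_norm_le _).trans_lt (by linarith)
  · intro x hx
    simp only [isoStar_real]
    have hxr : x ∈ ball (0 : Fin D → ℝ) R2 := by
      have h1 := ball_subset_ball (min_le_right R1 R2) hx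
      rw [mem_ball_zero_iff] at h1 ⊢
      rwa [isoC_norm] at h1
    have h1 := (hc2 x hxr).1
    have h2 := (hc1 _ (ball_subset_ball (min_le_left _ _) hx)).2.1
    refine hb1 (Hn (φ (isoC _ x)), e) ?_ (hM _ ⟨h1, h2⟩) i
    rw [← ball_prod_same]
    exact ⟨ball_subset_ball hrr1 (hin _ hx), ball_subset_ball hrr1 heb⟩

lemma iso_propagate {N N' m d dM ℓ : ℕ} {M : Set (Cn N)} {p : Cn N} {D U ρ κ φ}
    (hP : IsoPar M dM p D U ρ κ φ)
    (horb : ∀ η > 0, ∀ᶠ x in 𝓝 0, IsoOrb (isoPair φ (isoCj N)) η x)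
    {p' : Cn N'} (Df : Deformation N' m d p') {ε₀ : Rm m}
    (hε₀ : ε₀ ∈ Df.X) {H : Cn N → Cn N'} {rK : ℝ} (hrK : 0 < rK)
    (hd : DifferentiableOn ℂ H (ball p rK)) (hHp : H p = p')
    (hHM : ∀ z ∈ M ∩ ball p rK, H z ∈ Df.Mfib ε₀) (hfn : FinNondeg M p (Df.Mfib ε₀) ℓ H) :
    ∃ R > 0, R ≤ rK ∧ ∀ (l : Filter ℕ) (s : ℕ → ℝ) (Hn : ℕ → Cn N → Cn N') (e : ℕ → Rm m),
      (∀ n, DifferentiableOn ℂ (Hn n) (ball p rK)) →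
      (∀ n, ∀ z ∈ M ∩ ball p rK, ∀ k, Df.ρ (Hn n z) (e n) k = 0) →
      (∀ η > 0, ∀ᶠ n in l, ∀ z ∈ ball p rK, ‖Hn n z - H z‖ < η) →
      (∀ η > 0, ∀ᶠ n in l, ‖e n - ε₀‖ < η) → (∀ n, ‖e n - ε₀‖ ≤ s n) →
      IsoUB l s (fun n z => Hn n z - H z) p →
      ∀ z ∈ ball p R, IsoUB l s (fun n z => Hn n z - H z) z := by
  obtain ⟨ι, hι, F, ξs, hF, hF0, hξ, hnd⟩ := iso_reflect_data hP Df hε₀ isOpen_ball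
    (mem_ball_self hrK) hd hHp hfn
  obtain ⟨R1, hR1, η, hη, hZ⟩ := iso_zero_near hP Df hrK hd hHp hF hF0
  have hpn : ∀ᶠ z in 𝓝 p, z ∈ ball p rK := ball_mem_nhds _ hrK
  have hφt : Tendsto φ (𝓝 0) (𝓝 p) := by
    have := hP.hφ.continuousAt.tendsto; rwa [hP.hφ0] at this
  have hφK := hφt.eventually hpn
  have hdφ : ∀ᶠ x in 𝓝 (0 : Fin D → ℂ), DifferentiableAt ℂ (fun x => H (φ x)) x := by
    filter_upwards [hφK, hP.hφ.iso_diff] with x a1 a2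
    exact DifferentiableAt.comp (g := H) x (hd.differentiableAt (isOpen_ball.mem_nhds a1)) a2
  have hR1n : ∀ᶠ x in 𝓝 (0 : Fin D → ℂ), x ∈ ball (0 : Fin D → ℂ) R1 := ball_mem_nhds _ hR1
  obtain ⟨R2, hR2, hrefl⟩ := iso_reflect (F := F) (h := fun x => H (φ x))
    (k := fun x => isoCj N' (H (φ (isoStar (Fin D) x)))) (e₀ := isoE m ε₀) (ξs := ξs)
    (by simpa [hP.hφ0, hHp] using hF) hdφ (by
      obtain ⟨R, hR, hRb⟩ := Metric.eventually_nhds_iff_ball.1 hdφ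
      have := iso_conj_differentiableOn (isoCj N') (f := fun x => H (φ x)) (r := R)
        (fun x hx => (hRb x hx).differentiableWithinAt)
      have hRn : ∀ᶠ x in 𝓝 (0 : Fin D → ℂ), x ∈ ball (0 : Fin D → ℂ) R := ball_mem_nhds _ hR
      exact hRn.mono fun x hx => this.differentiableAt (isOpen_ball.mem_nhds hx))
    (fun i ξ hx => (hξ i ξ hx).1) (by
      intro i ξ hx
      filter_upwards [hφK, hP.hφ.iso_diff, (hξ i ξ hx).2] with x a1 a2 a3
      have := HasFDerivAt.comp (g := H) x
        (hd.differentiableAt (isOpen_ball.mem_nhds a1)).hasFDerivAt a2.hasFDerivAt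
      have h2 : fderiv ℂ (fun x => H (φ x)) x = (fderiv ℂ H (φ x)).comp (fderiv ℂ φ x) := this.fderiv
      rw [h2, ContinuousLinearMap.comp_apply, a3, map_zero])
    (by
      intro i
      refine hR1n.mono fun x hx => hZ H ε₀ hd (fun z hz k => (hHM z hz).2 k) ?_ ?_ i x hx
      · intro z _; simpa using hη
      · simpa using hη) hnd
  have hξ' : ∀ᶠ x in 𝓝 (0 : Fin D → ℂ), ∀ i, ∀ ξ ∈ ξs i, fderiv ℂ φ x (ξ x) = 0 := by
    refine eventually_all.2 fun i => ?_
    have := (List.finite_toSet (ξs i)).eventually_all (l := 𝓝 (0 : Fin D → ℂ))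
      (p := fun ξ x => fderiv ℂ φ x (ξ x) = 0)
    exact this.2 fun ξ hx => (hξ i ξ hx).2
  have hsurj : ∀ᶠ x in 𝓝 (0 : Fin D → ℂ), Function.Surjective (fderiv ℂ φ x) := by
    have hle := LinearMap.finrank_le_finrank_of_surjective (f := (fderiv ℂ φ 0).toLinearMap) hP.hsurj
    obtain ⟨κ', hκ'⟩ := iso_complement (fderiv ℂ φ 0) hP.hsurj _ (Nat.add_sub_of_le hle).symm
    filter_upwards [iso_surj_open κ' hP.hφ hκ'] with x hx v
    obtain ⟨u, hu⟩ := hx.2 (v, 0)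
    exact ⟨u, congrArg Prod.fst hu⟩
  obtain ⟨R3, hR3, hb3⟩ := Metric.eventually_nhds_iff_ball.1
    (hξ'.and (hsurj.and (hφK.and hP.hφ.eventually_analyticAt)))
  obtain ⟨R0, hR0, h01, h02, h03⟩ : ∃ R0 > 0, R0 ≤ R1 ∧ R0 ≤ R2 ∧ R0 ≤ R3 :=
    ⟨min R1 (min R2 R3), lt_min hR1 (lt_min hR2 hR3), min_le_left _ _,
      (min_le_right _ _).trans (min_le_left _ _), (min_le_right _ _).trans (min_le_right _ _)⟩
  have hopen : ∀ x ∈ ball (0 : Fin D → ℂ) R0, map φ (𝓝 x) = 𝓝 (φ x) := by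
    intro x hx
    have h1 := hb3 x (ball_subset_ball h03 hx)
    exact h1.2.2.2.hasStrictFDerivAt.map_nhds_eq_of_surj (LinearMap.range_eq_top.2 h1.2.1)
  have hR0n : ∀ᶠ x in 𝓝 (0 : Fin D → ℂ), x ∈ ball (0 : Fin D → ℂ) R0 := ball_mem_nhds _ hR0
  have hev : ∀ᶠ z in 𝓝 p, ∃ x, IsoOrb (isoPair φ (isoCj N)) R0 x ∧ x ∈ ball (0 : Fin D → ℂ) R0 ∧ φ x = z := by
    have h1 := image_mem_map (m := φ) ((horb R0 hR0).and hR0n)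
    rw [hopen 0 (mem_ball_self hR0), hP.hφ0] at h1
    filter_upwards [h1] with z hz
    obtain ⟨x, hx, rfl⟩ := hz
    exact ⟨x, hx.1, hx.2, rfl⟩
  obtain ⟨R, hR, hRb⟩ := Metric.eventually_nhds_iff_ball.1 hev
  refine ⟨min R rK, lt_min hR hrK, min_le_right _ _, ?_⟩
  intro l s Hn e c1 c2 c3 c4 c5 hUB z hz
  have hφR : ∀ x ∈ ball (0 : Fin D → ℂ) R0, φ x ∈ ball p rK := fun x hx =>
    (hb3 x (ball_subset_ball h03 hx)).2.2.1
  have hφc : ∀ x ∈ ball (0 : Fin D → ℂ) R0, DifferentiableAt ℂ φ x := fun x hx =>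
    (hb3 x (ball_subset_ball h03 hx)).2.2.2.differentiableAt
  have hnd' : ∀ n, DifferentiableOn ℂ (fun x => Hn n (φ x)) (ball 0 R0) := fun n x hx =>
    (DifferentiableAt.comp (g := Hn n) x ((c1 n).differentiableAt (isOpen_ball.mem_nhds (hφR x hx)))
      (hφc x hx)).differentiableWithinAt
  have hrefl' := hrefl R0 hR0 h02 l s (fun n x => Hn n (φ x))
    (fun n x => isoCj N' (Hn n (φ (isoStar (Fin D) x)))) (fun n => isoE m (e n))
    (Eventually.of_forall hnd')
    (Eventually.of_forall fun n => iso_conj_differentiableOn (isoCj N') (hnd' n))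
    (Eventually.of_forall (by
      intro n i ξ hξm x hx
      have := HasFDerivAt.comp (g := Hn n) x
        ((c1 n).differentiableAt (isOpen_ball.mem_nhds (hφR x hx))).hasFDerivAt (hφc x hx).hasFDerivAt
      have h2 : fderiv ℂ (fun x => Hn n (φ x)) x = (fderiv ℂ (Hn n) (φ x)).comp (fderiv ℂ φ x) :=
        this.fderiv
      rw [h2, ContinuousLinearMap.comp_apply, (hb3 x (ball_subset_ball h03 hx)).1 i ξ hξm, map_zero]))
    (by
      filter_upwards [c3 η hη, c4 η hη] with n a1 a2 i x hx
      exact hZ (Hn n) (e n) (c1 n) (c2 n) a1 a2 i x (ball_subset_ball h01 hx))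
    (fun η' hη' => (c3 η' hη').mono fun n hn x hx => hn _ (hφR x hx))
    (fun η' hη' => (c3 η' hη').mono fun n hn x hx => by
      rw [← map_sub, isoCj_norm]
      exact hn _ (hφR _ (isoStar_mem_ball.2 hx)))
    (fun η' hη' => (c4 η' hη').mono fun n hn => by
      rw [← map_sub]; exact (isoE_norm_le _).trans_lt hn)
    (fun n => by rw [← map_sub]; exact (isoE_norm_le _).trans (c5 n))
  have hstar : ∀ x ∈ ball (0 : Fin D → ℂ) R0, IsoUB l s (fun n x => Hn n (φ x) - H (φ x)) x →
      IsoUB l s (fun n x => Hn n (φ x) - H (φ x)) (isoStar (Fin D) x) := by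
    intro x hx h
    refine hrefl' _ (isoStar_mem_ball.2 hx) ?_
    have h1 : IsoUB l s (fun n y => Hn n (φ (isoStar (Fin D) y)) - H (φ (isoStar (Fin D) y)))
        (isoStar (Fin D) x) :=
      IsoUB.pull (f := fun n x => Hn n (φ x) - H (φ x)) (φ := isoStar (Fin D)) (by simpa using h)
        (isoStar (Fin D)).continuous.continuousAt
    obtain ⟨C, V, hV, hb⟩ := h1
    refine ⟨C, V, hV, hb.mono fun n hn y hy => ?_⟩
    simp only
    rw [← map_sub, isoCj_norm]
    exact hn y hy
  have hfib : ∀ x ∈ ball (0 : Fin D → ℂ) R0, ∀ y ∈ ball (0 : Fin D → ℂ) R0, φ y = φ x →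
      IsoUB l s (fun n x => Hn n (φ x) - H (φ x)) x → IsoUB l s (fun n x => Hn n (φ x) - H (φ x)) y := by
    intro x hx y hy hxy h
    have h1 := IsoUB.push (f := fun n z => Hn n z - H z) h (hopen x hx)
    rw [← hxy] at h1
    exact h1.pull (hφc y hy).continuousAt
  have hall : ∀ x, IsoOrb (isoPair φ (isoCj N)) R0 x → IsoUB l s (fun n x => Hn n (φ x) - H (φ x)) x := by
    intro x hx
    induction hx with
    | zero =>
      refine IsoUB.pull (f := fun n z => Hn n z - H z) ?_ hP.hφ.continuousAt
      rw [hP.hφ0]; exact hUB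
    | step b x y h1 h2 h3 ih =>
      have hx := h1.mem_ball hR0
      cases b with
      | true => exact hfib x hx y h2 h3 ih
      | false =>
        have h4 : φ (isoStar (Fin D) y) = φ (isoStar (Fin D) x) := by
          have := congrArg (isoCj N) h3
          simpa [isoPair, isoCj_isoCj] using this
        have h5 := hfib _ (isoStar_mem_ball.2 hx) _ (isoStar_mem_ball.2 h2) h4 (hstar x hx ih)
        have h6 := hstar _ (isoStar_mem_ball.2 h2) h5
        simpa using h6
  obtain ⟨x, hx1, hx2, rfl⟩ := hRb z (ball_subset_ball (min_le_left _ _) hz)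
  exact IsoUB.push (f := fun n z => Hn n z - H z) (hall x hx1) (hopen x hx2)

end Prop15

set_option linter.unusedSectionVars false
section Fin16
open Filter Metric Set

lemma iso_ball_identity {E F : Type*} [NormedAddCommGroup E] [NormedSpace ℂ E]
    [NormedAddCommGroup F] [NormedSpace ℂ F] [CompleteSpace F] {Y : E → F} {p : E} {r : ℝ}
    (hd : DifferentiableOn ℂ Y (ball p r)) (h0 : ∀ᶠ z in 𝓝 p, Y z = 0) :
    ∀ z ∈ ball p r, Y z = 0 := by
  intro z hz
  obtain ⟨γ, hγ⟩ : ∃ γ : ℂ → E, ∀ t, γ t = p + t • (z - p) := ⟨_, fun _ => rfl⟩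
  have hγd : Differentiable ℂ γ := by
    rw [funext hγ]
    intro t; exact (differentiableAt_id.smul_const _).const_add _
  have hSo : IsOpen (γ ⁻¹' (ball p r)) := isOpen_ball.preimage hγd.continuous
  have hSc : Convex ℝ (γ ⁻¹' (ball p r)) := by
    intro a ha b hb s t hs ht hst
    have h1 := (convex_ball p r) ha hb hs ht hst
    have : γ (s • a + t • b) = s • γ a + t • γ b := by
      simp only [hγ]
      have e1 : s • p + t • p = p := by rw [← add_smul, hst, one_smul]
      rw [smul_add, smul_add, add_smul, smul_assoc, smul_assoc]
      nth_rewrite 1 [← e1]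
      abel
    change γ _ ∈ ball p r
    rw [this]; exact h1
  have hγ0 : γ 0 = p := by simp [hγ]
  have hγ1 : γ 1 = z := by simp [hγ]
  have hm0 : (0 : ℂ) ∈ γ ⁻¹' (ball p r) := by
    change γ 0 ∈ ball p r; rw [hγ0]
    exact mem_ball_self (lt_of_le_of_lt dist_nonneg hz)
  have hm1 : (1 : ℂ) ∈ γ ⁻¹' (ball p r) := by change γ 1 ∈ ball p r; rw [hγ1]; exact hz
  have hdg : DifferentiableOn ℂ (fun t => Y (γ t)) (γ ⁻¹' (ball p r)) :=
    hd.comp hγd.differentiableOn (fun t ht => ht)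
  have hev : (fun t => Y (γ t)) =ᶠ[𝓝 0] 0 := by
    have : Tendsto γ (𝓝 0) (𝓝 p) := hγd.continuous.tendsto' _ _ hγ0
    exact this.eventually h0
  have := (hdg.analyticOnNhd hSo).eqOn_zero_of_preconnected_of_eventuallyEq_zero
    hSc.isPreconnected hm0 hev hm1
  simp only [hγ1] at this
  exact this

lemma iso_ultra_lim {F : Type*} [NormedAddCommGroup F] [ProperSpace F] (l : Ultrafilter ℕ)
    {f : ℕ → F} {C : ℝ} (hb : ∀ᶠ n in (l : Filter ℕ), ‖f n‖ ≤ C) :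
    ∃ y, Tendsto f l (𝓝 y) := by
  obtain ⟨y, -, hy⟩ := (isCompact_closedBall (0 : F) C).ultrafilter_le_nhds' (l.map f) (by
    refine hb.mono fun n hn => ?_
    simpa using hn)
  exact ⟨y, hy⟩

lemma iso_compact_ub {E F : Type*} [TopologicalSpace E] [NormedAddCommGroup F] {l : Filter ℕ}
    {s : ℕ → ℝ} (hs : ∀ n, 0 ≤ s n) {f : ℕ → E → F} {K : Set E} (hK : IsCompact K)
    (h : ∀ z ∈ K, IsoUB l s f z) : ∃ C, ∀ᶠ n in l, ∀ z ∈ K, ‖f n z‖ ≤ C * s n := by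
  refine hK.induction_on (p := fun S => ∃ C, ∀ᶠ n in l, ∀ z ∈ S, ‖f n z‖ ≤ C * s n) ?_ ?_ ?_ ?_
  · exact ⟨0, by simp⟩
  · rintro S T hST ⟨C, hC⟩
    exact ⟨C, hC.mono fun n hn z hz => hn z (hST hz)⟩
  · rintro S T ⟨C, hC⟩ ⟨C', hC'⟩
    refine ⟨max C C', ?_⟩
    filter_upwards [hC, hC'] with n a1 a2 z hz
    rcases hz with hz | hz
    · exact (a1 z hz).trans (mul_le_mul_of_nonneg_right (le_max_left _ _) (hs n))
    · exact (a2 z hz).trans (mul_le_mul_of_nonneg_right (le_max_right _ _) (hs n))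
  · intro z hz
    obtain ⟨C, V, hV, hb⟩ := h z hz
    exact ⟨V, mem_nhdsWithin_of_mem_nhds hV, C, hb⟩

lemma iso_inf_eq {N' m d : ℕ} {p' : Cn N'} (Df : Deformation N' m d p') {ε₀ : Rm m}
    (hε₀ : ε₀ ∈ Df.X) {w0 : Cn N'} (hw0 : w0 ∈ Df.U') (i : Fin d) (h0 : Df.ρ w0 ε₀ i = 0)
    {l : Filter ℕ} [l.NeBot] {w : ℕ → Cn N'} {e : ℕ → Rm m} {c : ℕ → ℝ} {y : Cn N'} {v : Rm m}
    (hw : Tendsto w l (𝓝 w0)) (he : Tendsto e l (𝓝 ε₀)) (hz : ∀ n, Df.ρ (w n) (e n) i = 0)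
    (hcw : Tendsto (fun n => c n • (w n - w0)) l (𝓝 y))
    (hce : Tendsto (fun n => c n • (e n - ε₀)) l (𝓝 v)) :
    2 * (∑ j, wirtD (fun w => Df.ρ w ε₀ i) w0 j * y j).re +
          fderiv ℝ (fun e => Df.ρ w0 e i) ε₀ v = 0 := by
  have hf : HasFDerivAt (fun we : Cn N' × Rm m => Df.ρ we.1 we.2 i)
      (fderiv ℝ (fun we : Cn N' × Rm m => Df.ρ we.1 we.2 i) (w0, ε₀)) (w0, ε₀) :=
    (Df.analytic_ρ i _ ⟨hw0, Df.X_subset_W hε₀⟩).differentiableAt.hasFDerivAt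
  have h1 : HasFDerivAt (fun w => Df.ρ w ε₀ i)
      ((fderiv ℝ (fun we : Cn N' × Rm m => Df.ρ we.1 we.2 i) (w0, ε₀)).comp
        (ContinuousLinearMap.inl ℝ (Cn N') (Rm m))) w0 :=
    HasFDerivAt.comp (g := fun we : Cn N' × Rm m => Df.ρ we.1 we.2 i) (f := fun w => (w, ε₀)) w0 hf
      (hasFDerivAt_prodMk_left w0 ε₀)
  have h2 : HasFDerivAt (fun e => Df.ρ w0 e i)
      ((fderiv ℝ (fun we : Cn N' × Rm m => Df.ρ we.1 we.2 i) (w0, ε₀)).comp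
        (ContinuousLinearMap.inr ℝ (Cn N') (Rm m))) ε₀ :=
    HasFDerivAt.comp (g := fun we : Cn N' × Rm m => Df.ρ we.1 we.2 i) (f := fun e => (w0, e)) ε₀ hf
      (hasFDerivAt_prodMk_right w0 ε₀)
  rw [iso_wirt, h1.fderiv, h2.fderiv, ContinuousLinearMap.comp_apply, ContinuousLinearMap.comp_apply,
    ← map_add]
  have h3 : ContinuousLinearMap.inl ℝ (Cn N') (Rm m) y + ContinuousLinearMap.inr ℝ (Cn N') (Rm m) v =
    (y, v) := by simp
  rw [h3]
  have hlim := (hasFDerivWithinAt_univ.2 hf).lim (l := l) (c := c) (d := fun n => (w n - w0, e n - ε₀))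
    (v := (y, v)) (by
      have a1 : Tendsto (fun n => w n - w0) l (𝓝 0) := by simpa using hw.sub_const w0
      have a2 : Tendsto (fun n => e n - ε₀) l (𝓝 0) := by simpa using he.sub_const ε₀
      exact a1.prodMk_nhds a2) (.of_forall fun _ ↦ mem_univ _) (hcw.prodMk_nhds hce)
  refine tendsto_nhds_unique hlim ?_
  simp only [Prod.mk_add_mk, add_sub_cancel, hz, h0, sub_zero, smul_zero]
  exact tendsto_const_nhds

lemma iso_main {N N' m d dM ℓ : ℕ} (M : Set (Cn N)) (p : Cn N)
    (hM : IsGenericAt M dM p) (hmin : IsMinimalAt M dM p)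
    (p' : Cn N') (Df : Deformation N' m d p')
    (ε₀ : Rm m) (hε₀ : ε₀ ∈ Df.X)
    (H : Cn N → Cn N') (Ω : Set (Cn N)) (hΩ : IsOpen Ω) (hpΩ : p ∈ Ω)
    (hH : DifferentiableOn ℂ H Ω) (hHp : H p = p')
    (hHM : ∀ z ∈ M ∩ Ω, H z ∈ Df.Mfib ε₀) (hnd : FinNondeg M p (Df.Mfib ε₀) ℓ H)
    (hinf : ∀ v ∈ tangentSpaceAt Df.X ε₀, ∀ (Y : Cn N → Cn N') (ΩY : Set (Cn N)),
      IsOpen ΩY → p ∈ ΩY → DifferentiableOn ℂ Y ΩY → Y p = 0 →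
      (∀ i : Fin d, ∃ V, IsOpen V ∧ p ∈ V ∧ ∀ z ∈ M ∩ V,
        2 * (∑ j, wirtD (fun w => Df.ρ w ε₀ i) (H z) j * Y z j).re +
          fderiv ℝ (fun e => Df.ρ (H z) e i) ε₀ v = 0) →
      v = 0 ∧ ∃ V, IsOpen V ∧ p ∈ V ∧ ∀ z ∈ V, Y z = 0) :
    ∃ K : Set (Cn N), IsCompact K ∧ K ⊆ Ω ∧ K ∈ 𝓝 p ∧
      ∃ δ : ℝ, 0 < δ ∧
        ∀ ε ∈ Df.X, ‖ε - ε₀‖ < δ →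
          ∀ (Hnew : Cn N → Cn N') (Ω' : Set (Cn N)), IsOpen Ω' → K ⊆ Ω' →
            DifferentiableOn ℂ Hnew Ω' → Hnew p = p' →
            (∀ z ∈ M ∩ K, Hnew z ∈ Df.Mfib ε) →
            (∀ z ∈ K, ‖Hnew z - H z‖ < δ) →
            ε = ε₀ ∧ ∃ V, IsOpen V ∧ p ∈ V ∧ ∀ z ∈ V, Hnew z = H z := by
  obtain ⟨D, U, ρ, κ, φ, hP⟩ := iso_param hM
  have horb := iso_orb hP hmin
  obtain ⟨r0, hr0, hr0Ω⟩ := Metric.isOpen_iff.1 hΩ p hpΩ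
  obtain ⟨rK, hrK, hrKΩ⟩ : ∃ rK > 0, closedBall p rK ⊆ Ω :=
    ⟨r0 / 2, half_pos hr0, (closedBall_subset_ball (by linarith)).trans hr0Ω⟩
  have hbΩ : ball p rK ⊆ Ω := ball_subset_closedBall.trans hrKΩ
  obtain ⟨R, hR, hRK, hprop⟩ := iso_propagate hP horb Df hε₀ hrK (hH.mono hbΩ) hHp
    (fun z hz => hHM z ⟨hz.1, hbΩ hz.2⟩) hnd
  refine ⟨closedBall p rK, isCompact_closedBall _ _, hrKΩ, closedBall_mem_nhds _ hrK, ?_⟩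
  by_contra hcon
  push Not at hcon
  have hcon' := fun n : ℕ => hcon (1 / ((n : ℝ) + 1)) (by positivity)
  choose e heX heδ Hn Ωn hΩn hKΩn hdn hpn hMn hclose hne using hcon'
  obtain ⟨l, hl⟩ : ∃ l : Ultrafilter ℕ, (l : Filter ℕ) ≤ atTop :=
    ⟨hyperfilter ℕ, Nat.hyperfilter_le_atTop⟩
  have hδ : Tendsto (fun n : ℕ => 1 / ((n : ℝ) + 1)) l (𝓝 0) :=
    tendsto_one_div_add_atTop_nhds_zero_nat.mono_left hl
  have hδη : ∀ η > 0, ∀ᶠ n : ℕ in (l : Filter ℕ), 1 / ((n : ℝ) + 1) < η := fun η hη =>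
    hδ.eventually (gt_mem_nhds hη)
  obtain ⟨a, ha, haR⟩ : ∃ a > 0, 4 * a = R := ⟨R / 4, by linarith, by ring⟩
  obtain ⟨dn, hdn'⟩ : ∃ dn : ℕ → Cn N → Cn N', ∀ n z, dn n z = Hn n z - H z := ⟨_, fun _ _ => rfl⟩
  have hndiff : ∀ n, DifferentiableOn ℂ (Hn n) (ball p rK) := fun n =>
    (hdn n).mono (ball_subset_closedBall.trans (hKΩn n))
  have hddiff : ∀ n, DifferentiableOn ℂ (dn n) (ball p rK) := fun n => by
    rw [funext (hdn' n)]
    exact (hndiff n).sub (hH.mono hbΩ)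
  have haK : closedBall p a ⊆ ball p rK := closedBall_subset_ball (by linarith)
  have h2aK : ball p (2 * a) ⊆ ball p rK := ball_subset_ball (by linarith)
  have hmax : ∀ n, ∃ z ∈ closedBall p a, ∀ z' ∈ closedBall p a, ‖dn n z'‖ ≤ ‖dn n z‖ := fun n => by
    obtain ⟨z, hz, hm⟩ := (isCompact_closedBall p a).exists_isMaxOn ⟨p, mem_closedBall_self ha.le⟩
      ((hddiff n).continuousOn.mono haK).norm
    exact ⟨z, hz, fun z' hz' => hm hz'⟩
  choose zs hzs hzmax using hmax
  obtain ⟨s, hs⟩ : ∃ s : ℕ → ℝ, ∀ n, s n = ‖e n - ε₀‖ + ‖dn n (zs n)‖ := ⟨_, fun _ => rfl⟩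
  have hspos : ∀ n, 0 < s n := by
    intro n
    by_contra hle
    have h1 := norm_nonneg (e n - ε₀)
    have h2 := norm_nonneg (dn n (zs n))
    have h3 := hs n
    have h4 : e n = ε₀ := by
      rw [← sub_eq_zero, ← norm_eq_zero]; linarith
    obtain ⟨z, hz, hzne⟩ := hne n h4 (ball p a) isOpen_ball (mem_ball_self ha)
    have h5 := hzmax n z (ball_subset_closedBall hz)
    have h6 : dn n z = 0 := by
      rw [← norm_eq_zero]; linarith [norm_nonneg (dn n z)]
    rw [hdn', sub_eq_zero] at h6
    exact hzne h6
  have hes : ∀ n, ‖e n - ε₀‖ ≤ s n := fun n => by rw [hs]; linarith [norm_nonneg (dn n (zs n))]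
  have hds : ∀ n, ∀ z ∈ closedBall p a, ‖dn n z‖ ≤ s n := fun n z hz => by
    rw [hs]; linarith [hzmax n z hz, norm_nonneg (e n - ε₀)]
  have hUB := hprop l s Hn e hndiff (fun n z hz => (hMn n z ⟨hz.1, ball_subset_closedBall hz.2⟩).2)
    (fun η hη => (hδη η hη).mono fun n hn z hz => (hclose n z (ball_subset_closedBall hz)).trans hn)
    (fun η hη => (hδη η hη).mono fun n hn => (heδ n).trans hn) hes
    ⟨1, closedBall p a, closedBall_mem_nhds _ ha, Eventually.of_forall fun n z hz => by
      simp only; rw [one_mul, ← hdn']; exact hds n z hz⟩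
  obtain ⟨C, hC⟩ := iso_compact_ub (fun n => (hspos n).le) (isCompact_closedBall p (2 * a))
    (fun z hz => hUB z (closedBall_subset_ball (by linarith) hz))
  -- rescaled sequences
  obtain ⟨q, hq⟩ : ∃ q : ℕ → Cn N → Cn N', ∀ n z, q n z = (s n)⁻¹ • dn n z := ⟨_, fun _ _ => rfl⟩
  have hqb : ∀ᶠ n in (l : Filter ℕ), ∀ z ∈ ball p (2 * a), ‖q n z‖ ≤ C := by
    filter_upwards [hC] with n hn z hz
    have h1 := hn z (ball_subset_closedBall hz)
    rw [← hdn'] at h1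
    rw [hq, norm_smul, norm_inv, Real.norm_of_nonneg (hspos n).le, inv_mul_le_iff₀ (hspos n)]
    linarith
  have hqd : ∀ n, DifferentiableOn ℂ (q n) (ball p (2 * a)) := fun n => by
    rw [funext (hq n)]
    have := (((hddiff n).mono h2aK).const_smul (((s n)⁻¹ : ℝ) : ℂ))
    refine this.congr fun z _ => ?_
    change (s n)⁻¹ • dn n z = (((s n)⁻¹ : ℝ) : ℂ) • dn n z
    exact (Complex.coe_smul _ _).symm
  have hYex : ∀ z, ∃ y, z ∈ ball p (2 * a) → Tendsto (fun n => q n z) l (𝓝 y) := by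
    intro z
    by_cases hz : z ∈ ball p (2 * a)
    · obtain ⟨y, hy⟩ := iso_ultra_lim l (hqb.mono fun n hn => hn z hz)
      exact ⟨y, fun _ => hy⟩
    · exact ⟨0, fun h => absurd h hz⟩
  choose Y hY using hYex
  have hYd : DifferentiableOn ℂ Y (ball p (2 * a)) :=
    iso_vitali (l := (l : Filter ℕ)) (Eventually.of_forall hqd) hqb hY
  have hp2a : p ∈ ball p (2 * a) := mem_ball_self (by linarith)
  have hYp : Y p = 0 := by
    refine tendsto_nhds_unique (hY p hp2a) ?_
    have : ∀ n, q n p = 0 := fun n => by rw [hq, hdn', hpn, hHp, sub_self, smul_zero]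
    simp only [this]
    exact tendsto_const_nhds
  obtain ⟨v, hv⟩ := iso_ultra_lim l (f := fun n => (s n)⁻¹ • (e n - ε₀)) (C := 1)
    (Eventually.of_forall fun n => by
      rw [norm_smul, norm_inv, Real.norm_of_nonneg (hspos n).le, inv_mul_le_iff₀ (hspos n), mul_one]
      exact hes n)
  have het : Tendsto (fun n => e n - ε₀) l (𝓝 0) :=
    squeeze_zero_norm (fun n => (heδ n).le) hδ
  have het' : Tendsto e l (𝓝 ε₀) := tendsto_sub_nhds_zero_iff.1 het
  have hvT : v ∈ tangentSpaceAt Df.X ε₀ := by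
    refine Submodule.subset_span ?_
    refine mem_tangentConeAt_of_seq (l : Filter ℕ) (fun n => (s n)⁻¹) (fun n => e n - ε₀) het ?_ hv
    exact Eventually.of_forall fun n => by rw [add_sub_cancel]; exact heX n
  have hHc : ContinuousAt H p := (hH.differentiableAt (hΩ.mem_nhds hpΩ)).continuousAt
  have hHU : ∀ᶠ z in 𝓝 p, H z ∈ Df.U' :=
    hHc.eventually (Df.isOpen_U'.mem_nhds (by rw [hHp]; exact Df.basept_mem))
  obtain ⟨r1, hr1, hb1⟩ := Metric.eventually_nhds_iff_ball.1 hHU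
  obtain ⟨hv0, V, hVo, hpV, hV⟩ := hinf v hvT Y (ball p (2 * a)) isOpen_ball hp2a hYd hYp (by
    intro i
    refine ⟨ball p (min r1 (2 * a)), isOpen_ball, mem_ball_self (lt_min hr1 (by linarith)), ?_⟩
    rintro z ⟨hzM, hz⟩
    have hz1 := ball_subset_ball (min_le_left _ _) hz
    have hz2 := ball_subset_ball (min_le_right _ _) hz
    have hzK := h2aK hz2
    refine iso_inf_eq Df hε₀ (hb1 z hz1) i ((hHM z ⟨hzM, hbΩ hzK⟩).2 i) (l := (l : Filter ℕ))
      (w := fun n => Hn n z) (e := e) (c := fun n => (s n)⁻¹) ?_ het' ?_ ?_ hv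
    · refine tendsto_sub_nhds_zero_iff.1 (squeeze_zero_norm (fun n => ?_) hδ)
      exact (hclose n z (ball_subset_closedBall hzK)).le
    · exact fun n => (hMn n z ⟨hzM, ball_subset_closedBall hzK⟩).2 i
    · have := hY z hz2
      simpa only [hq, hdn'] using this)
  have hY0 : ∀ z ∈ ball p (2 * a), Y z = 0 := iso_ball_identity hYd (by
    have : ∀ᶠ z in 𝓝 p, z ∈ V := hVo.mem_nhds hpV
    exact this.mono hV)
  -- contradiction at the maximum points
  obtain ⟨zt, hzt, hztl⟩ := (isCompact_closedBall p a).ultrafilter_le_nhds' (l.map zs)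
    (show ∀ᶠ n in (l : Filter ℕ), zs n ∈ closedBall p a from Eventually.of_forall hzs)
  have hzt' : Tendsto zs l (𝓝 zt) := hztl
  have hzt2 : zt ∈ ball p (2 * a) := closedBall_subset_ball (by linarith) hzt
  have hqz : Tendsto (fun n => q n (zs n)) l (𝓝 0) := by
    have h1 := hY zt hzt2
    rw [hY0 zt hzt2] at h1
    have h2 : Tendsto (fun n => q n (zs n) - q n zt) l (𝓝 0) := by
      have h3 : Tendsto (fun n => 2 * C / (a / 2) * ‖zs n - zt‖) l (𝓝 0) := by
        have := (tendsto_sub_nhds_zero_iff.2 hzt').norm.const_mul (2 * C / (a / 2))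
        simpa using this
      refine squeeze_zero_norm' ?_ h3
      filter_upwards [hqb] with n hn
      have e4 : 4 * (a / 2) = 2 * a := by ring
      have hsub : closedBall p a ⊆ ball p (3 * (a / 2)) := closedBall_subset_ball (by linarith)
      exact iso_cauchy_lip (f := q n) (x := p) (r := a / 2) (M := C) (half_pos ha)
        (by rw [e4]; exact hqd n) (by rw [e4]; exact hn) (hsub (hzs n)) (hsub hzt)
    simpa using h2.add h1
  have hone : ∀ n, ‖(s n)⁻¹ • (e n - ε₀)‖ + ‖q n (zs n)‖ = 1 := by
    intro n
    rw [hq, norm_smul, norm_smul, ← mul_add, ← hs, norm_inv, Real.norm_of_nonneg (hspos n).le]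
    exact inv_mul_cancel₀ (hspos n).ne'
  rw [hv0] at hv
  have hlim := hv.norm.add hqz.norm
  simp only [hone, norm_zero, add_zero] at hlim
  exact one_ne_zero (tendsto_nhds_unique tendsto_const_nhds hlim)

end Fin16

/-- **Theorem 2.10.** If a finitely nondegenerate map `H : (M,p) → (M'_{ε₀}, p')` admits no
nontrivial infinitesimal deformation `(v, Y)` into the deformation `𝔇`
(`𝔥𝔬𝔩(H, 𝔇) = 0`), then the pair `(ε₀, H)` is isolated among pairs `(ε, Ĥ)` of parameters
and finitely nondegenerate maps `(M,p) → (M'_ε, p')`. -/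
theorem isolated_of_no_infinitesimal_deformation_into_deformation
    {N N' m d dM ℓ : ℕ} (M : Set (Cn N)) (p : Cn N)
    (hM : IsGenericAt M dM p) (hmin : IsMinimalAt M dM p)
    (p' : Cn N') (D : Deformation N' m d p')
    (ε₀ : Rm m) (hε₀ : ε₀ ∈ D.X) (kX : ℕ) (hXreg : IsRASubmanifoldAt D.X ε₀ kX)
    (H : Cn N → Cn N') (Ω : Set (Cn N)) (hΩ : IsOpen Ω) (hpΩ : p ∈ Ω)
    (hH : DifferentiableOn ℂ H Ω) (hHp : H p = p')
    (hHM : ∀ z ∈ M ∩ Ω, H z ∈ D.Mfib ε₀) (hnd : FinNondeg M p (D.Mfib ε₀) ℓ H)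
    (hinf : ∀ v ∈ tangentSpaceAt D.X ε₀, ∀ (Y : Cn N → Cn N') (ΩY : Set (Cn N)),
      IsOpen ΩY → p ∈ ΩY → DifferentiableOn ℂ Y ΩY → Y p = 0 →
      (∀ i : Fin d, ∃ V, IsOpen V ∧ p ∈ V ∧ ∀ z ∈ M ∩ V,
        2 * (∑ j, wirtD (fun w => D.ρ w ε₀ i) (H z) j * Y z j).re +
          fderiv ℝ (fun e => D.ρ (H z) e i) ε₀ v = 0) →
      v = 0 ∧ ∃ V, IsOpen V ∧ p ∈ V ∧ ∀ z ∈ V, Y z = 0) :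
    ∃ K : Set (Cn N), IsCompact K ∧ K ⊆ Ω ∧ K ∈ 𝓝 p ∧
      ∃ δ : ℝ, 0 < δ ∧
        ∀ ε ∈ D.X, ‖ε - ε₀‖ < δ →
          ∀ (Hnew : Cn N → Cn N') (Ω' : Set (Cn N)), IsOpen Ω' → K ⊆ Ω' →
            DifferentiableOn ℂ Hnew Ω' → Hnew p = p' →
            (∀ z ∈ M ∩ K, Hnew z ∈ D.Mfib ε) → FinNondeg M p (D.Mfib ε) ℓ Hnew →
            (∀ z ∈ K, ‖Hnew z - H z‖ < δ) →
            ε = ε₀ ∧ ∃ V, IsOpen V ∧ p ∈ V ∧ ∀ z ∈ V, Hnew z = H z := by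
  obtain ⟨K, h1, h2, h3, δ, hδ, h⟩ :=
    iso_main M p hM hmin p' D ε₀ hε₀ H Ω hΩ hpΩ hH hHp hHM hnd hinf
  exact ⟨K, h1, h2, h3, δ, hδ, fun ε a b Hn Ω' c e f g i _ j => h ε a b Hn Ω' c e f g i j⟩

end
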